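/- Let d ≥ 1. A sequence (f_0, f_1, …, f_{d-1}) of nonnegative integers is the sequence of face numbers of a d-dimensional simplicial polytope (f_k = number of k-dimensional faces) if and only if, defining h_0, …, h_d by Σ_{k=0}^{d} h_k t^k = (t-1)^d + Σ_{i=0}^{d-1} f_i (t-1)^{d-1-i} and g_k = h_k − h_{k-1} for 0 ≤ k ≤ d/2 (with h_{-1} = 0), the following hold: (i) h_k = h_{d-k} for all 0 ≤ k ≤ d (the Dehn–Sommerville relations); (ii) g_k ≥ 0 for 0 ≤ k ≤ d/2; and (iii) there exists a finite-dimensional graded commutative ℝ-algebra H = ⊕_{i≥0} H_i with H_0 = ℝ, generated as an ℝ-algebra by H_1, such that dim_ℝ H_i = g_i for 0 ≤ i ≤ ⌊d/2⌋ and H_i = 0 for i > ⌊d/2⌋. -/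

import Mathlib

open Classical Polynomial

section PolytopeDefs

variable {V : Type*} [AddCommGroup V] [Module ℝ V]

/-- A polytope: the convex hull of finitely many points. -/
def IsPolytope (P : Set V) : Prop := ∃ S : Finset V, P = convexHull ℝ (S : Set V)

/-- Faces of a polytope (or of a cone): the set itself, the empty face, and the
sets of maximizers of linear functionals (equivalently, intersections with
supporting hyperplanes). -/
def IsFace (P F : Set V) : Prop :=
  F = P ∨ F = ∅ ∨ ∃ l : V →ₗ[ℝ] ℝ, F = {x | x ∈ P ∧ ∀ y ∈ P, l y ≤ l x}

/-- Dimension of a polytope: the dimension of its affine span, with the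
convention `pdim ∅ = -1`. -/
noncomputable def pdim (P : Set V) : ℤ :=
  if P = ∅ then -1 else (Module.finrank ℝ (affineSpan ℝ P).direction : ℤ)

/-- The `g`-truncation: from the toric `h`-polynomial of a `d`-dimensional
polytope to its toric `g`-polynomial, via `g_k = h_k - h_{k-1}` for
`0 ≤ k ≤ d/2`, with `h_{-1} = 0`. -/
noncomputable def truncG (d : ℤ) (h : Polynomial ℚ) : Polynomial ℚ :=
  ∑ k ∈ Finset.range (d.toNat / 2 + 1),
    Polynomial.C (h.coeff k - if k = 0 then 0 else h.coeff (k - 1)) * Polynomial.X ^ k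

/-- Fuelled recursion computing the toric `h`-polynomial of the interval `[F,G]`
of a face lattice (with `F` playing the role of the empty face):
`h([F,G],t) = ∑_{F ≤ G' < G} g([F,G'],t) · (t-1)^{dim G - dim G' - 1}`. -/
noncomputable def relHAux : ℕ → Set V → Set V → Polynomial ℚ
  | 0, _, _ => 1
  | n + 1, F, G =>
      if G = F then 1
      else ∑ᶠ G' ∈ {G' : Set V | IsFace G G' ∧ F ⊆ G' ∧ G' ≠ G},
        truncG (pdim G' - pdim F - 1) (relHAux n F G') *
          (Polynomial.X - 1) ^ (pdim G - pdim G' - 1).toNat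

/-- The toric `h`-polynomial of the interval `[F,G]` in a face lattice. -/
noncomputable def relH (F G : Set V) : Polynomial ℚ := relHAux (pdim G + 1).toNat F G

/-- The toric `g`-polynomial of the interval `[F,G]` in a face lattice;
`relG F P` is the polynomial `g(P/F, t)`. -/
noncomputable def relG (F G : Set V) : Polynomial ℚ :=
  truncG (pdim G - pdim F - 1) (relH F G)

/-- The toric `h`-polynomial `h(P,t)` of a polytope `P`. -/
noncomputable def toricH (P : Set V) : Polynomial ℚ := relH ∅ P

/-- The toric `g`-polynomial `g(P,t)` of a polytope `P`. -/
noncomputable def toricG (P : Set V) : Polynomial ℚ := relG ∅ P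

end PolytopeDefs

section SimplicialDefs

variable {V : Type*} [AddCommGroup V] [Module ℝ V]

/-- A simplex: the convex hull of finitely many affinely independent points. -/
def IsSimplexSet (F : Set V) : Prop :=
  ∃ S : Finset V, AffineIndependent ℝ (fun x : (S : Set V) => (x : V)) ∧
    F = convexHull ℝ (S : Set V)

end SimplicialDefs

/-- The simplicial `h`-polynomial determined by the face numbers `f`, via
`∑ h_k t^k = (t-1)^d + ∑_{i=0}^{d-1} f_i (t-1)^{d-1-i}`. -/
noncomputable def hSimplicial (d : ℕ) (f : Fin d → ℕ) : Polynomial ℚ :=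
  (Polynomial.X - 1) ^ d +
    ∑ i : Fin d, (f i : ℚ) • (Polynomial.X - 1) ^ (d - 1 - (i : ℕ))

/-- The simplicial `g`-numbers: `g_k = h_k - h_{k-1}` (with `h_{-1} = 0`). -/
noncomputable def gSimplicial (d : ℕ) (f : Fin d → ℕ) (k : ℕ) : ℚ :=
  (hSimplicial d f).coeff k - if k = 0 then 0 else (hSimplicial d f).coeff (k - 1)

set_option linter.unusedSectionVars false

/-- Simplicial fan-like data coming from the boundary of a simplicial polytope. -/
structure SD (d : ℕ) (ι E : Type*) [Fintype ι] [AddCommGroup E] [Module ℝ E] where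
  fac : Finset (Finset ι)
  x : ι → E
  u : Finset ι → E →ₗ[ℝ] ℝ
  card : ∀ F ∈ fac, F.card = d
  ind : ∀ F ∈ fac, LinearIndependent ℝ (fun i : F => x i)
  one : ∀ F ∈ fac, ∀ i ∈ F, u F (x i) = 1
  lt : ∀ F ∈ fac, ∀ i ∉ F, u F (x i) < 1
  ridge : ∀ F ∈ fac, ∀ i ∈ F, ∃ F' ∈ fac, F' ≠ F ∧ F.erase i ⊆ F'
  ne : fac.Nonempty
  fr : Module.finrank ℝ E = d
  fd : FiniteDimensional ℝ E

/-- Combinatorial shelling data. -/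
structure Shell (d : ℕ) (ι : Type*) where
  fac : Finset (Finset ι)
  R : Finset ι → Finset ι
  rk : Finset ι → ℝ
  card : ∀ F ∈ fac, F.card = d
  sub : ∀ F ∈ fac, R F ⊆ F
  h1 : ∀ F ∈ fac, ∀ F' ∈ fac, F' ≠ F → R F ⊆ F' → rk F' < rk F
  h2 : ∀ F ∈ fac, ∀ F' ∈ fac, F' ≠ F → F \ R F ⊆ F' → rk F < rk F'
  h3 : ∀ F ∈ fac, ∀ S ⊆ F, ∃ F1 ∈ fac, R F1 ⊆ S ∧ S ⊆ F1
  h4 : ∀ F ∈ fac, ∀ S ⊆ F, ∃ F1 ∈ fac, F1 \ R F1 ⊆ S ∧ S ⊆ F1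
  ne : fac.Nonempty

noncomputable def faces {ι : Type*} [Fintype ι] (fac : Finset (Finset ι)) : Finset (Finset ι) :=
  Finset.univ.filter fun S => ∃ F ∈ fac, S ⊆ F

noncomputable def Hp {ι : Type*} [Fintype ι] (d : ℕ) (fac : Finset (Finset ι)) : ℚ[X] :=
  ∑ S ∈ faces fac, (X - 1) ^ (d - S.card)

lemma sum_Icc_pow {ι : Type*} {d : ℕ} (R F : Finset ι) (h : R ⊆ F) (hF : F.card = d) :
    ∑ S ∈ Finset.Icc R F, (X - 1 : ℚ[X]) ^ (d - S.card) = X ^ (d - R.card) := by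
  have := Finset.sum_pow_mul_eq_add_pow (X - 1 : ℚ[X]) 1 (F \ R)
  rw [Finset.card_sdiff_of_subset h, hF, sub_add_cancel] at this
  rw [← this]
  refine Finset.sum_bij' (fun S _ => F \ S) (fun T _ => F \ T) ?_ ?_ ?_ ?_ ?_
  · grind
  · grind
  · grind
  · grind
  · intro S hS
    rw [one_pow, mul_one, Finset.card_sdiff_of_subset (Finset.mem_Icc.1 hS).2, hF]

lemma part_sum {ι : Type*} {d : ℕ} (fac : Finset (Finset ι)) (R : Finset ι → Finset ι)
    (fam : Finset (Finset ι)) (hc : ∀ F ∈ fac, F.card = d) (hs : ∀ F ∈ fac, R F ⊆ F)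
    (hu : ∀ F ∈ fac, ∀ F' ∈ fac, R F ⊆ F' → R F' ⊆ F → F = F')
    (hm : ∀ S, S ∈ fam ↔ ∃ F ∈ fac, R F ⊆ S ∧ S ⊆ F) :
    ∑ S ∈ fam, (X - 1 : ℚ[X]) ^ (d - S.card) = ∑ F ∈ fac, X ^ (d - (R F).card) := by
  have : fam = fac.biUnion fun F => Finset.Icc (R F) F := by
    grind
  rw [this, Finset.sum_biUnion]
  · exact Finset.sum_congr rfl fun F hF => sum_Icc_pow _ _ (hs F hF) (hc F hF)
  · intro F hF F' hF' hne
    rw [Function.onFun, Finset.disjoint_left]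
    grind

namespace Shell
variable {d : ℕ} {ι : Type*} [Fintype ι] (s : Shell d ι)

/-- reverse shelling -/
noncomputable def rev : Shell d ι where
  fac := s.fac
  R F := F \ s.R F
  rk F := - s.rk F
  card := s.card
  sub F _ := Finset.sdiff_subset
  h1 F hF F' hF' h h' := neg_lt_neg (s.h2 F hF F' hF' h h')
  h2 F hF F' hF' h h' := by
    rw [Finset.sdiff_sdiff_eq_self (s.sub F hF)] at h'
    exact neg_lt_neg (s.h1 F hF F' hF' h h')
  h3 := s.h4
  h4 F hF S hS := by
    obtain ⟨F1, h1, h2⟩ := s.h3 F hF S hS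
    grind
  ne := s.ne

lemma uniq (F) (hF : F ∈ s.fac) (F') (hF' : F' ∈ s.fac) (h : s.R F ⊆ F') (h' : s.R F' ⊆ F) :
    F = F' := by
  by_contra hne
  exact lt_asymm (s.h1 F hF F' hF' (Ne.symm hne) h) (s.h1 F' hF' F hF hne h')

lemma hp_eq : Hp d s.fac = ∑ F ∈ s.fac, X ^ (d - (s.R F).card) := by
  refine part_sum _ _ _ s.card s.sub s.uniq fun S => ?_
  simp only [faces, Finset.mem_filter, Finset.mem_univ, true_and]
  constructor
  · rintro ⟨F, hF, h⟩; exact s.h3 F hF S h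
  grind

lemma hp_eq' : Hp d s.fac = ∑ F ∈ s.fac, X ^ (s.R F).card := by
  rw [show s.fac = s.rev.fac from rfl, s.rev.hp_eq]
  refine Finset.sum_congr rfl fun F hF => ?_
  have := s.card F hF
  have h2 := Finset.card_le_card (s.sub F hF)
  congr 1
  simp only [rev]
  rw [Finset.card_sdiff_of_subset (s.sub F hF)]
  omega

lemma coeff_hp (k : ℕ) : (Hp d s.fac).coeff k = (s.fac.filter fun F => (s.R F).card = k).card := by
  rw [hp_eq', Polynomial.finsetSum_coeff, Finset.card_filter]
  push_cast
  grind

lemma card_rev_filter {k : ℕ} (hk : k ≤ d) :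
    (s.fac.filter fun F => (s.R F).card = k).card = (s.fac.filter fun F => (s.R F).card = d - k).card := by
  have h : (Hp d s.fac).coeff k = (Hp d s.rev.fac).coeff k := rfl
  rw [coeff_hp, coeff_hp] at h
  rw [Nat.cast_inj.1 h]
  congr 1
  refine Finset.filter_congr fun F hF => ?_
  have := s.card F hF
  have h2 := Finset.card_le_card (s.sub F hF)
  simp only [rev]
  rw [Finset.card_sdiff_of_subset (s.sub F hF)]
  omega

lemma palin {k : ℕ} (hk : k ≤ d) : (Hp d s.fac).coeff k = (Hp d s.fac).coeff (d - k) := by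
  rw [coeff_hp, coeff_hp, card_rev_filter s hk]

/-- sum over faces containing a vertex -/
lemma link_eq (z : ι) : ∑ S ∈ (faces s.fac).filter (fun S => z ∈ S), (X - 1 : ℚ[X]) ^ (d - S.card) =
    ∑ F ∈ s.fac.filter (fun F => z ∈ F), X ^ (d - (insert z (s.R F)).card) := by
  refine part_sum _ (fun F => insert z (s.R F)) _ ?_ ?_ ?_ fun S => ?_
  · intro F hF; exact s.card F (Finset.mem_filter.1 hF).1
  · intro F hF
    rw [Finset.mem_filter] at hF
    exact Finset.insert_subset hF.2 (s.sub F hF.1)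
  · intro F hF F' hF' h h'
    exact s.uniq F (Finset.mem_filter.1 hF).1 F' (Finset.mem_filter.1 hF').1
      ((Finset.subset_insert _ _).trans h) ((Finset.subset_insert _ _).trans h')
  · simp only [faces, Finset.mem_filter, Finset.mem_univ, true_and]
    constructor
    · rintro ⟨⟨F, hF, h⟩, hz⟩
      obtain ⟨F1, a, b, c⟩ := s.h3 F hF S h
      grind
    grind

lemma link_coeff (z : ι) {k : ℕ} (hk : k + 1 ≤ d) :
    (∑ S ∈ (faces s.fac).filter (fun S => z ∈ S), (X - 1 : ℚ[X]) ^ (d - S.card)).coeff k =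
    (∑ S ∈ (faces s.fac).filter (fun S => z ∈ S), (X - 1 : ℚ[X]) ^ (d - S.card)).coeff (d - 1 - k) := by
  have h := s.rev.link_eq z
  rw [show s.rev.fac = s.fac from rfl] at h
  conv_lhs => rw [s.link_eq z]
  conv_rhs => rw [h]
  rw [Polynomial.finsetSum_coeff, Polynomial.finsetSum_coeff]
  refine Finset.sum_congr rfl fun F hF => ?_
  rw [Finset.mem_filter] at hF
  have h1 := s.card F hF.1
  have h2 := Finset.card_le_card (s.sub F hF.1)
  rw [Polynomial.coeff_X_pow, Polynomial.coeff_X_pow]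
  have h3 := Finset.card_sdiff_of_subset (s.sub F hF.1)
  have h5 : 1 ≤ F.card := Finset.card_pos.2 ⟨z, hF.2⟩
  congr 1
  simp only [rev, eq_iff_iff]
  grind

/-- Ball lemma: a partition of the faces missing `z` computes the `g`-vector. -/
lemma ball (z : ι) (Rc : Finset ι → Finset ι)
    (hnb : ∀ F ∈ s.fac, ∃ F' ∈ s.fac, z ∉ F' ∧ F.erase z ⊆ F')
    (hs : ∀ F ∈ s.fac, z ∉ F → Rc F ⊆ F)
    (hu : ∀ F ∈ s.fac, ∀ F' ∈ s.fac, z ∉ F → z ∉ F' → Rc F ⊆ F' → Rc F' ⊆ F → F = F')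
    (he : ∀ F ∈ s.fac, z ∉ F → ∀ S ⊆ F, ∃ F1 ∈ s.fac, z ∉ F1 ∧ Rc F1 ⊆ S ∧ S ⊆ F1)
    {k : ℕ} (hk : 1 ≤ k) (hkd : k ≤ d) :
    (Hp d s.fac).coeff k - (Hp d s.fac).coeff (k - 1) =
      ((s.fac.filter fun F => z ∉ F ∧ (Rc F).card = k).card : ℚ) -
      (s.fac.filter fun F => z ∉ F ∧ (Rc F).card = d + 1 - k).card := by
  have e : ∑ S ∈ (faces s.fac).filter (fun S => z ∉ S), (X - 1 : ℚ[X]) ^ (d - S.card) =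
    ∑ F ∈ s.fac.filter (fun F => z ∉ F), X ^ (d - (Rc F).card) := by
    refine part_sum _ Rc _ ?_ ?_ ?_ fun S => ?_
    · intro F hF; exact s.card F (Finset.mem_filter.1 hF).1
    · grind
    · grind
    · simp only [faces, Finset.mem_filter, Finset.mem_univ, true_and]
      constructor
      · rintro ⟨⟨F, hF, h⟩, hz⟩
        obtain ⟨F', a, b, c⟩ := hnb F hF
        obtain ⟨F1, p, q, r, t⟩ := he F' a b S fun i hi =>
          c (Finset.mem_erase.2 ⟨fun h => hz (h ▸ hi), h hi⟩)
        grind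
      grind
  have ea : ∀ j ≤ d, (∑ S ∈ (faces s.fac).filter (fun S => z ∉ S), (X - 1 : ℚ[X]) ^ (d - S.card)).coeff j
      = ((s.fac.filter fun F => z ∉ F ∧ (Rc F).card = d - j).card : ℚ) := by
    intro j hj
    rw [e, Polynomial.finsetSum_coeff, ← Finset.filter_filter, Finset.card_filter]
    push_cast
    refine Finset.sum_congr rfl fun F hF => ?_
    rw [Finset.mem_filter] at hF
    rw [Polynomial.coeff_X_pow]
    have := Finset.card_le_card (hs F hF.1 hF.2)
    rw [s.card F hF.1] at this
    grind
  have hH : Hp d s.fac = ∑ S ∈ (faces s.fac).filter (fun S => z ∈ S), (X - 1 : ℚ[X]) ^ (d - S.card) +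
      ∑ S ∈ (faces s.fac).filter (fun S => z ∉ S), (X - 1 : ℚ[X]) ^ (d - S.card) :=
    (Finset.sum_filter_add_sum_filter_not _ _ _).symm
  have h1 := s.link_coeff z (k := k - 1) (by omega)
  rw [s.palin hkd, hH, Polynomial.coeff_add, Polynomial.coeff_add, h1,
    show d - 1 - (k - 1) = d - k by omega, ea _ (by omega), ea _ (by omega),
    show d - (d - k) = k by omega, show d - (k - 1) = d + 1 - k by omega]
  ring
end Shell

namespace SD
variable {d : ℕ} {ι E : Type*} [Fintype ι] [AddCommGroup E] [Module ℝ E] (s : SD d ι E)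

lemma span_top {F : Finset ι} (hF : F ∈ s.fac) :
    ⊤ ≤ Submodule.span ℝ (Set.range fun i : F => s.x i) := by
  haveI := s.fd
  refine ((s.ind F hF).span_eq_top_of_card_eq_finrank' ?_).ge
  rw [s.fr, ← s.card F hF, Fintype.card_coe]

noncomputable def bas {F : Finset ι} (hF : F ∈ s.fac) : Module.Basis F ℝ E :=
  Module.Basis.mk (s.ind F hF) (s.span_top hF)

lemma bas_apply {F : Finset ι} (hF : F ∈ s.fac) (i : F) : s.bas hF i = s.x i := by
  simp [bas]

noncomputable def cf (v : E) (F : Finset ι) (i : ι) : ℝ :=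
  if h : F ∈ s.fac ∧ i ∈ F then (s.bas h.1).repr v ⟨i, h.2⟩ else 0

lemma sum_cf (v : E) {F : Finset ι} (hF : F ∈ s.fac) : ∑ i ∈ F, s.cf v F i • s.x i = v := by
  conv_rhs => rw [← (s.bas hF).sum_repr v]
  rw [← Finset.sum_coe_sort]
  refine Finset.sum_congr rfl fun i _ => ?_
  rw [bas_apply, cf, dif_pos ⟨hF, i.2⟩]

lemma exists_generic : ∃ v : E, ∀ F ∈ s.fac, ∀ i ∈ F, s.cf v F i ≠ 0 := by
  let P : Finset (Submodule ℝ E) := Finset.univ.image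
    fun p : (F : s.fac) × F.1 => LinearMap.ker ((s.bas p.1.2).coord p.2)
  have hP : ⊤ ∉ P := by
    intro h
    obtain ⟨p, -, hp⟩ := Finset.mem_image.1 h
    have h1 : s.bas p.1.2 p.2 ∈ LinearMap.ker ((s.bas p.1.2).coord p.2) := by rw [hp]; trivial
    simp at h1
  have := Subspace.biUnion_ne_univ_of_top_notMem hP
  obtain ⟨v, hv⟩ := (Set.ne_univ_iff_exists_notMem _).1 this
  refine ⟨v, fun F hF i hi h0 => hv ?_⟩
  rw [cf, dif_pos ⟨hF, hi⟩] at h0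
  simp only [Set.mem_iUnion]
  exact ⟨_, Finset.mem_image.2 ⟨⟨⟨F, hF⟩, ⟨i, hi⟩⟩, Finset.mem_univ _, rfl⟩, by simpa using h0⟩

lemma u_eq (v : E) {F F' : Finset ι} (hF : F ∈ s.fac) :
    s.u F' v = s.u F v - ∑ i ∈ F, s.cf v F i * (1 - s.u F' (s.x i)) := by
  have h : ∀ G, s.u G v = ∑ i ∈ F, s.cf v F i * s.u G (s.x i) := by
    intro G
    conv_lhs => rw [← s.sum_cf v hF]
    simp
  rw [h F', h F, ← Finset.sum_sub_distrib]
  refine Finset.sum_congr rfl fun i hi => ?_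
  rw [s.one F hF i hi]; ring

lemma rank_lt {v : E} {F F' : Finset ι} (hF : F ∈ s.fac) (hF' : F' ∈ s.fac) (hne : F' ≠ F)
    (h : ∀ i ∈ F, i ∉ F' → 0 < s.cf v F i) : s.u F' v < s.u F v := by
  rw [s.u_eq v hF, sub_lt_self_iff]
  have hn : ¬ F ⊆ F' := fun h =>
    hne (Finset.eq_of_subset_of_card_le h (by rw [s.card F hF, s.card F' hF'])).symm
  obtain ⟨i, hi, hi'⟩ := Finset.not_subset.1 hn
  refine Finset.sum_pos' (fun j hj => ?_) ⟨i, hi, ?_⟩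
  · by_cases hj' : j ∈ F'
    · rw [s.one F' hF' j hj']; simp
    · exact (mul_pos (h j hj hj') (sub_pos.2 (s.lt F' hF' j hj'))).le
  · exact mul_pos (h i hi hi') (sub_pos.2 (s.lt F' hF' i hi'))

lemma cf_neg (v : E) (F : Finset ι) (i : ι) : s.cf (-v) F i = - s.cf v F i := by
  unfold cf; split_ifs <;> simp

lemma ridge' {F : Finset ι} (hF : F ∈ s.fac) {i : ι} (hi : i ∈ F) :
    ∃ F' ∈ s.fac, i ∉ F' ∧ F.erase i ⊆ F' := by
  obtain ⟨F', h, hne, hs⟩ := s.ridge F hF i hi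
  refine ⟨F', h, fun h' => hne ?_, hs⟩
  refine (Finset.eq_of_subset_of_card_le (fun j hj => ?_) (by rw [s.card F hF, s.card F' h])).symm
  grind

lemma exists_R (v : E) {F S : Finset ι} (hF : F ∈ s.fac) (hS : S ⊆ F) :
    ∃ F1 ∈ s.fac, (∀ i ∈ F1, s.cf v F1 i < 0 → i ∈ S) ∧ S ⊆ F1 := by
  obtain ⟨F1, h1, h2⟩ := Finset.exists_max_image (s.fac.filter fun F => S ⊆ F) (fun F => s.u F v)
    ⟨F, by grind⟩
  rw [Finset.mem_filter] at h1
  refine ⟨F1, h1.1, fun i hi hc => ?_, h1.2⟩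
  by_contra hiS
  obtain ⟨F', h, hn, hs⟩ := s.ridge' h1.1 hi
  have hle := h2 F' (Finset.mem_filter.2 ⟨h, fun j hj => hs (Finset.mem_erase.2
    ⟨fun e => hiS (e ▸ hj), h1.2 hj⟩)⟩)
  have := s.rank_lt (v := -v) h1.1 h (fun e => hn (e ▸ hi)) (fun j hj hj' => by
    have : j = i := by
      grind
    rw [cf_neg, this]; linarith)
  grind

noncomputable def shell (v : E) (hv : ∀ F ∈ s.fac, ∀ i ∈ F, s.cf v F i ≠ 0) : Shell d ι where
  fac := s.fac
  R F := F.filter fun i => s.cf v F i < 0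
  rk F := s.u F v
  card := s.card
  sub F _ := Finset.filter_subset _ _
  h1 F hF F' hF' hne h := s.rank_lt hF hF' hne fun i hi hi' => by
    grind
  h2 F hF F' hF' hne h := by
    have := s.rank_lt (v := -v) hF hF' hne fun i hi hi' => by
      rw [cf_neg, neg_pos]
      grind
    grind
  h3 F hF S hS := by
    obtain ⟨F1, a, b, c⟩ := s.exists_R v hF hS
    grind
  h4 F hF S hS := by
    obtain ⟨F1, a, b, c⟩ := s.exists_R (-v) hF hS
    refine ⟨F1, a, fun i hi => ?_, c⟩
    rw [Finset.mem_sdiff, Finset.mem_filter] at hi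
    refine b i hi.1 ?_
    rw [cf_neg, neg_lt_zero]
    grind
  ne := s.ne

lemma even (S : Finset ι) (hS : S.card + 1 = d) : Even (s.fac.filter fun F => S ⊆ F).card := by
  by_cases h0 : (s.fac.filter fun F => S ⊆ F) = ∅
  · grind
  obtain ⟨F, hF⟩ := Finset.nonempty_iff_ne_empty.2 h0
  rw [Finset.mem_filter] at hF
  have key : ∀ G ∈ s.fac, S ⊆ G → ∃ w ∉ S, G = insert w S := by
    intro G hG hSG
    obtain ⟨w, hw⟩ := Finset.exists_eq_insert_iff.2 ⟨hSG, by rw [s.card G hG, hS]⟩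
    grind
  obtain ⟨w, hw, rfl⟩ := key F hF.1 hF.2
  obtain ⟨F', hF', hwF, hs⟩ := s.ridge' hF.1 (Finset.mem_insert_self w S)
  rw [Finset.erase_insert hw] at hs
  have : (s.fac.filter fun F => S ⊆ F) = {insert w S, F'} := by
    ext G
    simp only [Finset.mem_filter, Finset.mem_insert, Finset.mem_singleton]
    constructor
    · rintro ⟨hG, hSG⟩
      by_contra! hne
      obtain ⟨w', hw', rfl⟩ := key F' hF' hs
      obtain ⟨w'', hw'', rfl⟩ := key G hG hSG
      have e1 : w'' ≠ w := fun h => hne.1 (by rw [h])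
      have e2 : w'' ≠ w' := fun h => hne.2 (by rw [h])
      have e3 : w' ≠ w := fun h => hwF (by rw [h]; simp)
      have nm : ∀ {a b}, a ≠ b → a ∉ S → a ∉ insert b S := by
        grind
      -- linear relation
      have lin : ∀ a b : ℝ, a * (1 - s.u (insert w' S) (s.x w)) = b * (1 - s.u (insert w'' S) (s.x w)) →
          ∀ y, a * (s.u (insert w S) y - s.u (insert w' S) y) =
            b * (s.u (insert w S) y - s.u (insert w'' S) y) := by
        intro a b hab y
        have : a • (s.u (insert w S) - s.u (insert w' S)) = b • (s.u (insert w S) - s.u (insert w'' S)) := by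
          refine (s.bas hF.1).ext fun i => ?_
          rw [bas_apply]
          simp only [LinearMap.smul_apply, LinearMap.sub_apply, smul_eq_mul]
          rw [s.one _ hF.1 _ i.2]
          rcases Finset.mem_insert.1 i.2 with h | h
          · grind
          · rw [s.one _ hF' _ (Finset.mem_insert_of_mem h), s.one _ hG _ (Finset.mem_insert_of_mem h)]; simp
        simpa using LinearMap.congr_fun this y
      have p1 := sub_pos.2 (s.lt _ hF' w (nm e3.symm hw))
      have p2 := sub_pos.2 (s.lt _ hG w (nm e1.symm hw))
      have L := lin (1 - s.u (insert w'' S) (s.x w)) (1 - s.u (insert w' S) (s.x w)) (mul_comm _ _)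
      set α := 1 - s.u (insert w'' S) (s.x w)
      set β := 1 - s.u (insert w' S) (s.x w)
      have L1 := L (s.x w')
      have L2 := L (s.x w'')
      rw [s.one _ hF' w' (Finset.mem_insert_self _ _)] at L1
      rw [s.one _ hG w'' (Finset.mem_insert_self _ _)] at L2
      have a1 := s.lt _ hF.1 w' (nm e3 hw')
      have a2 := s.lt _ hF.1 w'' (nm e1 hw'')
      have b1 := s.lt _ hG w' (nm e2.symm hw')
      have b2 := s.lt _ hF' w'' (nm e2 hw'')
      rcases le_total α β with h | h
      · nlinarith [mul_pos p2 (sub_pos.2 b1), mul_pos p1 (sub_pos.2 b1), mul_nonneg (sub_nonneg.2 h) (sub_pos.2 a1).le,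
          mul_pos p2 (sub_pos.2 b2), mul_nonneg (sub_nonneg.2 h) (sub_pos.2 a2).le]
      · nlinarith [mul_pos p2 (sub_pos.2 b1), mul_pos p1 (sub_pos.2 b1), mul_nonneg (sub_nonneg.2 h) (sub_pos.2 a1).le,
          mul_pos p2 (sub_pos.2 b2), mul_nonneg (sub_nonneg.2 h) (sub_pos.2 a2).le]
    grind
  grind
end SD

lemma exists_derivation_ext {R K : Type*} [CommRing R] [IsDomain R] [Field K] [Algebra R K] [IsFractionRing R K]
    (D0 : R → R) (ha : ∀ x y, D0 (x + y) = D0 x + D0 y) (hm : ∀ x y, D0 (x * y) = x * D0 y + y * D0 x) :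
    ∃ D : Derivation ℤ K K, ∀ r, D (algebraMap R K r) = algebraMap R K (D0 r) := by
  have h0 : D0 0 = 0 := by simpa using ha 0 0
  have h1' : D0 1 = 0 := by simpa using hm 1 1
  let δ : R → K := fun r => algebraMap R K (D0 r)
  have hδ : ∀ r, δ r = algebraMap R K (D0 r) := fun _ => rfl
  have δa : ∀ x y, δ (x + y) = δ x + δ y := fun x y => by grind
  have δm : ∀ x y, δ (x * y) = algebraMap R K x * δ y + algebraMap R K y * δ x := fun x y => by grind
  have δ0 : δ 0 = 0 := by grind
  have δ1 : δ 1 = 0 := by grind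
  clear_value δ
  let φ0 : R →+* TrivSqZeroExt K K :=
    { toFun := fun r => TrivSqZeroExt.inl (algebraMap R K r) + TrivSqZeroExt.inr (δ r)
      map_one' := by ext <;> simp [δ1]
      map_zero' := by ext <;> simp [δ0]
      map_add' := fun a b => by ext <;> simp [δa]
      map_mul' := fun a b => by
        ext
        · simp
        · simp [δm, mul_comm] }
  have h1 : ∀ r, (φ0 r).fst = algebraMap R K r := fun r => by simp [φ0]
  have h2 : ∀ r, (φ0 r).snd = δ r := fun r => by simp [φ0]
  have hu : ∀ y : nonZeroDivisors R, IsUnit (φ0 y) := by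
    intro y
    rw [TrivSqZeroExt.isUnit_iff_isUnit_fst, h1]
    exact IsLocalization.map_units K y
  obtain ⟨φ, hφ⟩ : ∃ φ : K →+* TrivSqZeroExt K K, ∀ r, φ (algebraMap R K r) = φ0 r :=
    ⟨IsLocalization.lift hu, fun r => IsLocalization.lift_eq hu r⟩
  have hf : (TrivSqZeroExt.fstHom K K K : TrivSqZeroExt K K →+* K).comp φ = RingHom.id K := by
    refine IsLocalization.ringHom_ext (nonZeroDivisors R) ?_
    ext r
    simp [hφ, h1]
  have hf' : ∀ x, (φ x).fst = x := fun x => RingHom.congr_fun hf x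
  refine ⟨Derivation.mk' (AddMonoidHom.toIntLinearMap
    ⟨⟨fun x => (φ x).snd, by simp⟩, fun x y => by simp⟩) fun x y => ?_, fun r => ?_⟩
  · change (φ (x * y)).snd = x * (φ y).snd + y * (φ x).snd
    rw [map_mul, TrivSqZeroExt.snd_mul, hf', hf']
    simp [mul_comm]
  · change (φ _).snd = _
    rw [hφ, h2, hδ]

lemma exists_field0 (τ : Type) :
    ∃ (K : Type) (_ : Field K) (φ : MvPolynomial τ (ZMod 2) →+* K) (D : τ → Derivation ℤ K K),
      (2 : K) = 0 ∧ Function.Injective φ ∧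
      ∀ v w, D v (φ (MvPolynomial.X w)) = if v = w then 1 else 0 := by
  obtain ⟨K, _, _, _⟩ : ∃ (K : Type) (_ : Field K) (_ : Algebra (MvPolynomial τ (ZMod 2)) K),
      IsFractionRing (MvPolynomial τ (ZMod 2)) K :=
    ⟨FractionRing (MvPolynomial τ (ZMod 2)), inferInstance, inferInstance, inferInstance⟩
  have hD : ∀ v : τ, ∃ D : Derivation ℤ K K, ∀ w,
      D (algebraMap (MvPolynomial τ (ZMod 2)) K (MvPolynomial.X w)) = if v = w then 1 else 0 := by
    intro v
    obtain ⟨D, h⟩ := exists_derivation_ext (K := K) (fun p => MvPolynomial.pderiv (R := ZMod 2) v p)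
      (fun x y => map_add _ x y) (fun x y => by simp [Derivation.leibniz])
    refine ⟨D, fun w => ?_⟩
    rw [h]
    simp only [MvPolynomial.pderiv_X, Pi.single_apply]
    grind
  choose D hD using hD
  refine ⟨K, inferInstance, algebraMap _ K, D, ?_, IsFractionRing.injective _ K, hD⟩
  have : (2 : MvPolynomial τ (ZMod 2)) = 0 := CharP.cast_eq_zero _ 2
  rw [← map_ofNat (algebraMap (MvPolynomial τ (ZMod 2)) K) 2, this, map_zero]

theorem exists_field (d : ℕ) (ι : Type) [Fintype ι] :
    ∃ (K : Type) (_ : Field K) (a : Fin d → ι → K) (a0 : Fin d → K) (t : ι → K)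
      (D : Fin d → ι → Derivation ℤ K K) (Dt : ι → Derivation ℤ K K),
      (2 : K) = 0 ∧ (∀ r j r' j', D r j (a r' j') = if r = r' ∧ j = j' then 1 else 0) ∧
      (∀ r j r', D r j (a0 r') = 0) ∧ (∀ j r j', Dt j (a r j') = 0) ∧ (∀ j r, Dt j (a0 r) = 0) ∧
      (∀ j j', Dt j (t j') = if j = j' then 1 else 0) ∧
      (∀ e : Fin d → Option ι, Function.Injective e →
        (Matrix.of fun r k => (e k).elim (a0 r) (a r)).det ≠ 0) := by
  obtain ⟨K, _, φ, D, h2, hφ, hD⟩ := exists_field0 ((Fin d × Option ι) ⊕ ι)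
  refine ⟨K, inferInstance, fun r j => φ (MvPolynomial.X (Sum.inl (r, some j))),
    fun r => φ (MvPolynomial.X (Sum.inl (r, none))),
    fun j => φ (MvPolynomial.X (Sum.inr j)), fun r j => D (Sum.inl (r, some j)),
    fun j => D (Sum.inr j), h2, ?_, ?_, ?_, ?_, ?_, ?_⟩
  · grind
  · grind
  · grind
  · grind
  · grind
  · intro e he h0
    have h1 : (Matrix.of fun r k => (e k).elim (φ (MvPolynomial.X (Sum.inl (r, none))))
        (fun j => φ (MvPolynomial.X (Sum.inl (r, some j)))) : Matrix (Fin d) (Fin d) K) =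
        ((Matrix.mvPolynomialX (Fin d) (Fin d) (ZMod 2)).map
          (MvPolynomial.rename (fun p : Fin d × Fin d => (Sum.inl (p.1, e p.2) : (Fin d × Option ι) ⊕ ι)))).map (φ) := by
      ext r k
      simp only [Matrix.of_apply, Matrix.map_apply, Matrix.mvPolynomialX_apply, MvPolynomial.rename_X]
      cases e k <;> rfl
    rw [h1, ← RingHom.mapMatrix_apply, ← RingHom.map_det] at h0
    have h2 := hφ (h0.trans (map_zero _).symm)
    rw [← AlgHom.mapMatrix_apply, ← AlgHom.map_det] at h2
    have h3 := MvPolynomial.rename_injective _ (fun p q h => by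
      simp only [Sum.inl.injEq, Prod.mk.injEq] at h
      exact Prod.ext h.1 (he h.2)) (h2.trans (map_zero _).symm)
    exact Matrix.det_mvPolynomialX_ne_zero (Fin d) (ZMod 2) h3

section Loc
variable {d : ℕ} {K : Type} [Field K]

lemma neg_c2 (h2 : (2 : K) = 0) (x : K) : -x = x := by
  grind

lemma der_prod {α : Type*} [DecidableEq α] (D : Derivation ℤ K K) (s : Finset α) (f : α → K) :
    D (∏ i ∈ s, f i) = ∑ j ∈ s, D (f j) * ∏ i ∈ s.erase j, f i := by
  induction s using Finset.induction_on with
  | empty => simp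
  | insert a s ha ih =>
    rw [Finset.prod_insert ha, Derivation.leibniz, ih, Finset.sum_insert ha, Finset.erase_insert ha]
    simp only [smul_eq_mul]
    rw [add_comm, Finset.mul_sum, mul_comm]
    congr 1
    refine Finset.sum_congr rfl fun j hj => ?_
    have : j ≠ a := fun h => ha (h ▸ hj)
    rw [Finset.erase_insert_of_ne (Ne.symm this), Finset.prod_insert (by simp [ha])]
    ring

lemma der_det (D : Derivation ℤ K K) (A : Matrix (Fin d) (Fin d) K) :
    D A.det = ∑ j, (A.updateCol j fun r => D (A r j)).det := by
  simp only [Matrix.det_apply, map_sum]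
  rw [Finset.sum_comm]
  refine Finset.sum_congr rfl fun σ _ => ?_
  have e : D (Equiv.Perm.sign σ • ∏ i, A (σ i) i) = Equiv.Perm.sign σ • D (∏ i, A (σ i) i) := by
    rcases Int.units_eq_one_or (Equiv.Perm.sign σ) with h | h <;> simp [h]
  rw [e, der_prod, Finset.smul_sum]
  refine Finset.sum_congr rfl fun j _ => ?_
  congr 1
  rw [← Finset.mul_prod_erase _ _ (Finset.mem_univ j)]
  congr 1
  · simp
  · refine Finset.prod_congr rfl fun i hi => ?_
    simp [Finset.ne_of_mem_erase hi]

variable (D : Derivation ℤ K K) (A : Matrix (Fin d) (Fin d) K) (a0 : Fin d → K) (ρ : Fin d) (n : Fin d → K)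

lemma der_det' (hA : A.det ≠ 0) (hD : ∀ r k, D (A r k) = if r = ρ then n k else 0) :
    D A.det = A.det * ∑ k, n k * A⁻¹ k ρ := by
  rw [der_det, Finset.mul_sum]
  refine Finset.sum_congr rfl fun j _ => ?_
  have : (fun r => D (A r j)) = n j • Pi.single ρ 1 := by
    ext r; rw [hD]; simp [Pi.single_apply]
  rw [this, Matrix.det_updateCol_smul, Matrix.inv_def, Matrix.smul_apply, ← Matrix.cramer_apply,
    Matrix.cramer_eq_adjugate_mulVec, Ring.inverse_eq_inv']
  simp only [smul_eq_mul, Matrix.mulVec_single, MulOpposite.op_one, one_smul, Matrix.col_apply]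
  field_simp

lemma der_inv (hA : A.det ≠ 0) (hD : ∀ r k, D (A r k) = if r = ρ then n k else 0) (u v : Fin d) :
    D (A⁻¹ u v) = - (A⁻¹ u ρ * ∑ k, n k * A⁻¹ k v) := by
  have h1 : A * A⁻¹ = 1 := Matrix.mul_nonsing_inv _ (isUnit_iff_ne_zero.2 hA)
  have h1' : A⁻¹ * A = 1 := Matrix.nonsing_inv_mul _ (isUnit_iff_ne_zero.2 hA)
  have h3 : ∀ r, (∑ k, A r k * D (A⁻¹ k v)) = - if r = ρ then ∑ k, n k * A⁻¹ k v else 0 := by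
    intro r
    have : D ((A * A⁻¹) r v) = 0 := by
      rw [h1, Matrix.one_apply]; split_ifs <;> simp
    rw [Matrix.mul_apply, map_sum] at this
    simp only [Derivation.leibniz, smul_eq_mul, Finset.sum_add_distrib, hD] at this
    by_cases hr : r = ρ
    · grind
    · simpa [hr] using this
  have h4 : D (A⁻¹ u v) = ∑ r, A⁻¹ u r * ∑ k, A r k * D (A⁻¹ k v) := by
    have : (A⁻¹ * A).mulVec (fun k => D (A⁻¹ k v)) u = D (A⁻¹ u v) := by rw [h1', Matrix.one_mulVec]
    rw [← this, ← Matrix.mulVec_mulVec]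
    rfl
  rw [h4]
  simp [h3]

lemma der_y (hA : A.det ≠ 0) (hD : ∀ r k, D (A r k) = if r = ρ then n k else 0)
    (h0 : ∀ r, D (a0 r) = 0) (w : Fin d) :
    D (A⁻¹.mulVec a0 w) = - (A⁻¹ w ρ * ∑ k, n k * A⁻¹.mulVec a0 k) := by
  simp only [Matrix.mulVec, dotProduct, map_sum, Derivation.leibniz, smul_eq_mul, h0, mul_zero, zero_add,
    der_inv D A ρ n hA hD, Finset.mul_sum, Finset.sum_neg_distrib, mul_neg]
  rw [Finset.sum_comm]
  grind

/-- apply a derivation to coefficients -/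
noncomputable def Dc {σ : Type} : MvPolynomial σ K →+ MvPolynomial σ K where
  toFun p := ∑ m ∈ p.support, MvPolynomial.monomial m (D (p.coeff m))
  map_zero' := by simp
  map_add' p q := by
    have key : ∀ r : MvPolynomial σ K, r.support ⊆ p.support ∪ q.support →
        ∑ m ∈ r.support, MvPolynomial.monomial m (D (r.coeff m)) =
        ∑ m ∈ p.support ∪ q.support, MvPolynomial.monomial m (D (r.coeff m)) := by
      intro r hr
      refine Finset.sum_subset hr fun m _ hm => ?_
      grind
    rw [key _ MvPolynomial.support_add, key p Finset.subset_union_left, key q Finset.subset_union_right,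
      ← Finset.sum_add_distrib]
    simp

lemma Dc_monomial {σ : Type} (m : σ →₀ ℕ) (c : K) :
    Dc D (MvPolynomial.monomial m c) = MvPolynomial.monomial m (D c) := by
  simp only [Dc, AddMonoidHom.coe_mk, ZeroHom.coe_mk]
  by_cases hc : c = 0
  · simp [hc]
  · rw [MvPolynomial.support_monomial, if_neg hc]; simp

lemma Dc_C_mul {σ : Type} (c : K) (p : MvPolynomial σ K) :
    Dc D (MvPolynomial.C c * p) = MvPolynomial.C (D c) * p + MvPolynomial.C c * Dc D p := by
  induction p using MvPolynomial.induction_on' with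
  | monomial m a =>
    simp only [MvPolynomial.C_mul_monomial, Dc_monomial, Derivation.leibniz, smul_eq_mul, map_add]
    rw [add_comm, mul_comm a]
  | add p q hp hq => rw [mul_add, map_add, hp, hq, map_add]; ring

lemma Dc_X_mul {σ : Type} (k : σ) (p : MvPolynomial σ K) :
    Dc D (MvPolynomial.X k * p) = MvPolynomial.X k * Dc D p := by
  induction p using MvPolynomial.induction_on' with
  | monomial m a => simp only [MvPolynomial.X, MvPolynomial.monomial_mul, Dc_monomial, one_mul]
  | add p q hp hq => rw [mul_add, map_add, hp, hq, map_add]; ring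

lemma Dc_pderiv (k : Fin d) (p : MvPolynomial (Fin d) K) :
    Dc D (MvPolynomial.pderiv k p) = MvPolynomial.pderiv k (Dc D p) := by
  induction p using MvPolynomial.induction_on' with
  | monomial m a => simp [MvPolynomial.pderiv_monomial, Dc_monomial, mul_comm]
  | add p q hp hq => grind

lemma der_eval (y : Fin d → K) (p : MvPolynomial (Fin d) K) :
    D (MvPolynomial.eval y p) = MvPolynomial.eval y (Dc D p) +
      ∑ w, MvPolynomial.eval y (MvPolynomial.pderiv w p) * D (y w) := by
  induction p using MvPolynomial.induction_on with
  | C a =>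
    rw [MvPolynomial.C_apply, Dc_monomial, ← MvPolynomial.C_apply, ← MvPolynomial.C_apply]
    simp
  | add p q hp hq =>
    simp only [map_add, hp, hq, add_mul, Finset.sum_add_distrib]; ring
  | mul_X p k hp =>
    rw [mul_comm p, Dc_X_mul]
    simp only [map_mul, MvPolynomial.eval_X, Derivation.leibniz, smul_eq_mul, hp, map_add, MvPolynomial.pderiv_X,
      Pi.single_apply]
    simp only [mul_add, add_mul, Finset.sum_add_distrib, Finset.mul_sum, mul_assoc, add_assoc]
    congr 2
    simp [apply_ite (MvPolynomial.eval y)]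

/-- directional derivative -/
noncomputable def del (B : Matrix (Fin d) (Fin d) K) (ρ : Fin d) :
    Derivation K (MvPolynomial (Fin d) K) (MvPolynomial (Fin d) K) :=
  ∑ u, B u ρ • MvPolynomial.pderiv u

lemma del_apply (B : Matrix (Fin d) (Fin d) K) (p : MvPolynomial (Fin d) K) :
    del B ρ p = ∑ u, MvPolynomial.C (B u ρ) * MvPolynomial.pderiv u p := by
  have : ∀ s : Finset (Fin d), (∑ u ∈ s, B u ρ • MvPolynomial.pderiv (R := K) u) p =
      ∑ u ∈ s, MvPolynomial.C (B u ρ) * MvPolynomial.pderiv u p := by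
    intro s
    induction s using Finset.induction_on with
    | empty => simp
    | insert a s ha ih =>
      rw [Finset.sum_insert ha, Finset.sum_insert ha, Derivation.add_apply, ih, Derivation.smul_apply,
        MvPolynomial.smul_eq_C_mul]
  exact this _

lemma pderiv_comm (u v : Fin d) (p : MvPolynomial (Fin d) K) :
    MvPolynomial.pderiv u (MvPolynomial.pderiv v p) = MvPolynomial.pderiv v (MvPolynomial.pderiv u p) := by
  have : ⁅MvPolynomial.pderiv (R := K) u, MvPolynomial.pderiv (R := K) v⁆ = 0 := by
    refine MvPolynomial.derivation_ext fun i => ?_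
    simp [Derivation.commutator_apply, MvPolynomial.pderiv_X, Pi.single_apply, apply_ite]
  have := congrArg (fun D => D p) this
  simpa [Derivation.commutator_apply, sub_eq_zero] using this

lemma del_comm (B : Matrix (Fin d) (Fin d) K) (ρ ρ' : Fin d) (p : MvPolynomial (Fin d) K) :
    del B ρ (del B ρ' p) = del B ρ' (del B ρ p) := by
  simp only [del_apply, map_sum, MvPolynomial.pderiv_C_mul, Finset.mul_sum]
  rw [Finset.sum_comm]
  refine Finset.sum_congr rfl fun u _ => Finset.sum_congr rfl fun v _ => ?_
  rw [pderiv_comm]; ring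

noncomputable def Yl : MvPolynomial (Fin d) K := ∑ k, MvPolynomial.C (n k) * MvPolynomial.X k

lemma del_Yl (B : Matrix (Fin d) (Fin d) K) : del B ρ (Yl n) = MvPolynomial.C (∑ k, n k * B k ρ) := by
  simp only [del_apply, Yl, map_sum, MvPolynomial.pderiv_C_mul, MvPolynomial.pderiv_X, Pi.single_apply]
  refine Finset.sum_congr rfl fun u _ => ?_
  simp [mul_comm]

lemma Dc_Yl (hn : ∀ k, D (n k) = 0) (p : MvPolynomial (Fin d) K) : Dc D (Yl n * p) = Yl n * Dc D p := by
  simp only [Yl, Finset.sum_mul, map_sum, mul_assoc, Dc_C_mul, Dc_X_mul, hn, map_zero, zero_mul, zero_add]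

lemma Dc_del (hA : A.det ≠ 0) (hD : ∀ r k, D (A r k) = if r = ρ then n k else 0) (ρ' : Fin d)
    (p : MvPolynomial (Fin d) K) :
    Dc D (del A⁻¹ ρ' p) = del A⁻¹ ρ' (Dc D p) - MvPolynomial.C (∑ k, n k * A⁻¹ k ρ') * del A⁻¹ ρ p := by
  simp only [del_apply, map_sum, Dc_C_mul, der_inv D A ρ n hA hD, Dc_pderiv, Finset.sum_add_distrib, map_neg,
    map_mul, Finset.mul_sum]
  rw [add_comm, sub_eq_add_neg, ← Finset.sum_neg_distrib]
  congr 1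
  refine Finset.sum_congr rfl fun u _ => ?_
  simp only [Finset.sum_mul, neg_mul]
  grind

/-- the twisted operator -/
noncomputable def Th : MvPolynomial (Fin d) K →+ MvPolynomial (Fin d) K :=
  Dc D + ((del A⁻¹ ρ : MvPolynomial (Fin d) K →ₗ[K] _).toAddMonoidHom).comp (AddMonoidHom.mulLeft (Yl n))

lemma Th_apply (p : MvPolynomial (Fin d) K) : Th D A ρ n p = Dc D p + del A⁻¹ ρ (Yl n * p) := rfl

lemma negp (h2 : (2 : K) = 0) (p : MvPolynomial (Fin d) K) : p + p = 0 := by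
  rw [← two_mul, show (2 : MvPolynomial (Fin d) K) = MvPolynomial.C 2 from (map_ofNat MvPolynomial.C 2).symm, h2]; simp

lemma Th_del (h2 : (2 : K) = 0) (hA : A.det ≠ 0) (hD : ∀ r k, D (A r k) = if r = ρ then n k else 0) (ρ' : Fin d)
    (p : MvPolynomial (Fin d) K) : Th D A ρ n (del A⁻¹ ρ' p) = del A⁻¹ ρ' (Th D A ρ n p) := by
  rw [Th_apply, Th_apply, Dc_del D A ρ n hA hD, map_add, del_comm A⁻¹ ρ' ρ (Yl n * p),
    (del A⁻¹ ρ').leibniz (Yl n) p, del_Yl, map_add]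
  simp only [smul_eq_mul]
  rw [mul_comm p, ← MvPolynomial.smul_eq_C_mul, ← MvPolynomial.smul_eq_C_mul, Derivation.map_smul]
  linear_combination -negp h2 ((∑ k, n k * A⁻¹ k ρ') • del A⁻¹ ρ p)

lemma der_eval' (h2 : (2 : K) = 0) (hA : A.det ≠ 0) (hD : ∀ r k, D (A r k) = if r = ρ then n k else 0)
    (h0 : ∀ r, D (a0 r) = 0) (p : MvPolynomial (Fin d) K) :
    D (A.det * MvPolynomial.eval (A⁻¹.mulVec a0) p) =
      A.det * MvPolynomial.eval (A⁻¹.mulVec a0) (Th D A ρ n p) := by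
  rw [Derivation.leibniz, der_eval, der_det' D A ρ n hA hD, Th_apply, (del A⁻¹ ρ).leibniz, del_Yl]
  simp only [der_y D A a0 ρ n hA hD h0, smul_eq_mul, neg_c2 h2]
  have e1 : MvPolynomial.eval (A⁻¹.mulVec a0) (Yl n) = ∑ k, n k * A⁻¹.mulVec a0 k := by simp [Yl]
  simp only [map_add, map_mul, MvPolynomial.eval_C, del_apply, map_sum, e1]
  set s := ∑ k, n k * A⁻¹.mulVec a0 k
  have e2 : ∀ x : Fin d, (MvPolynomial.eval (A⁻¹.mulVec a0)) ((MvPolynomial.pderiv x) p) * (A⁻¹ x ρ * s) =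
    s * (A⁻¹ x ρ * (MvPolynomial.eval (A⁻¹.mulVec a0)) ((MvPolynomial.pderiv x) p)) := fun x => by ring
  simp only [e2, ← Finset.mul_sum]
  ring
end Loc

section Loc2
variable {d : ℕ} {K : Type} [Field K]

lemma sum_bij_perm {M : Type*} [AddCommMonoid M] (g : (Fin d → Fin d) → M)
    (h : ∀ σ, ¬ Function.Injective σ → g σ = 0) : ∑ σ, g σ = ∑ σ : Equiv.Perm (Fin d), g σ := by
  rw [← Finset.sum_subset (Finset.subset_univ (Finset.univ.filter Function.Injective))]
  · refine Finset.sum_bij' (fun σ hσ => Equiv.ofBijective σ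
      (Finite.injective_iff_bijective.1 (Finset.mem_filter.1 hσ).2)) (fun σ _ => ⇑σ) ?_ ?_ ?_ ?_ ?_
    · simp
    · intro σ _; simp [σ.injective]
    · grind
    · grind
    · intro σ _; rfl
  grind

lemma prod_del_comm {S : Type*} [CommRing S] [Algebra K S] (h2 : (2 : K) = 0) (p : Fin d → S)
    (hp : ∀ u, p u * p u = 0) (B : Matrix (Fin d) (Fin d) K) :
    ∏ ρ, ∑ u, B u ρ • p u = B.det • ∏ u, p u := by
  rw [Finset.prod_univ_sum, Fintype.piFinset_univ, sum_bij_perm]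
  · rw [Matrix.det_apply, Finset.sum_smul]
    refine Finset.sum_congr rfl fun σ _ => ?_
    rw [Finset.prod_smul, Equiv.prod_comp σ p]
    congr 1
    rcases Int.units_eq_one_or (Equiv.Perm.sign σ) with h | h <;> simp [h, neg_c2 h2]
  · intro σ hσ
    obtain ⟨a, b, hab, hne⟩ : ∃ a b, σ a = σ b ∧ a ≠ b := by
      simpa [Function.Injective] using hσ
    have h0 : ∏ i, p (σ i) = 0 := by
      rw [← Finset.mul_prod_erase _ _ (Finset.mem_univ a),
        ← Finset.mul_prod_erase (Finset.univ.erase a) _ (Finset.mem_erase.2 ⟨hne.symm, Finset.mem_univ b⟩),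
        ← mul_assoc, hab, hp, zero_mul]
    rw [Finset.prod_smul, h0, smul_zero]

lemma pderiv_sq (h2 : (2 : K) = 0) (u : Fin d) (p : MvPolynomial (Fin d) K) :
    MvPolynomial.pderiv u (MvPolynomial.pderiv u p) = 0 := by
  induction p using MvPolynomial.induction_on' with
  | monomial m a =>
    simp only [MvPolynomial.pderiv_monomial]
    have : (((m u : ℕ) : K) * (((m - Finsupp.single u 1 : Fin d →₀ ℕ) u : ℕ) : K)) = 0 := by
      have : Even (m u * (m - Finsupp.single u 1 : Fin d →₀ ℕ) u) := by
        simp only [Finsupp.coe_tsub, Pi.sub_apply, Finsupp.single_eq_same]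
        grind
      obtain ⟨c, hc⟩ := this
      rw [← Nat.cast_mul, hc, Nat.cast_add, ← two_mul, h2, zero_mul]
    grind
  | add p q hp hq => grind

lemma del_prod (h2 : (2 : K) = 0) (B : Matrix (Fin d) (Fin d) K) (q : Fin d →₀ ℕ) :
    (List.ofFn fun ρ => (del B ρ : Module.End K (MvPolynomial (Fin d) K))).prod
      ((∏ k, MvPolynomial.X k) * MvPolynomial.monomial (q + q) 1) =
    B.det • MvPolynomial.monomial (q + q) 1 := by
  let P : Fin d → Module.End K (MvPolynomial (Fin d) K) := fun u => (MvPolynomial.pderiv (R := K) u : _ →ₗ[K] _)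
  have hP : ∀ u p, P u p = MvPolynomial.pderiv u p := fun _ _ => rfl
  have hc : ∀ a ∈ Set.range P, ∀ b ∈ Set.range P, a * b = b * a := by
    rintro _ ⟨u, rfl⟩ _ ⟨v, rfl⟩
    refine LinearMap.ext fun p => ?_
    simp only [Module.End.mul_apply, hP, pderiv_comm u v]
  let _ : CommRing (Algebra.adjoin K (Set.range P)) := Algebra.adjoinCommRingOfComm K hc
  let p : Fin d → Algebra.adjoin K (Set.range P) := fun u => ⟨P u, Algebra.subset_adjoin ⟨u, rfl⟩⟩
  have hpp : ∀ u, p u * p u = 0 := by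
    intro u
    refine Subtype.ext (LinearMap.ext fun f => ?_)
    change P u (P u f) = 0
    rw [hP, hP, pderiv_sq h2]
  have e1 : (List.ofFn fun ρ => (del B ρ : Module.End K (MvPolynomial (Fin d) K))) =
      (List.ofFn fun ρ => ∑ u, B u ρ • p u).map (Algebra.adjoin K (Set.range P)).val := by
    rw [List.map_ofFn]
    congr 1
    funext ρ
    refine LinearMap.ext fun f => ?_
    simp only [Function.comp, map_sum, map_smul, LinearMap.sum_apply]
    exact (del_apply ρ B f).trans (Finset.sum_congr rfl fun u _ => (MvPolynomial.smul_eq_C_mul _ _).symm)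
  have e2 : ∀ s : Finset (Fin d), (Algebra.adjoin K (Set.range P)).val (∏ u ∈ s, p u)
      (MvPolynomial.monomial ((∑ k, Finsupp.single k 1) + (q + q)) 1) =
      MvPolynomial.monomial ((∑ k ∈ sᶜ, Finsupp.single k 1) + (q + q)) 1 := by
    intro s
    induction s using Finset.induction_on with
    | empty => simp
    | insert a s ha ih =>
      rw [Finset.prod_insert ha, map_mul, Module.End.mul_apply, ih]
      change MvPolynomial.pderiv a _ = _
      have hs : (∑ k ∈ sᶜ, Finsupp.single k 1 : Fin d →₀ ℕ) = Finsupp.single a 1 + ∑ k ∈ (insert a s)ᶜ, Finsupp.single k 1 := by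
        rw [Finset.compl_insert]
        exact (Finset.add_sum_erase sᶜ (fun k => Finsupp.single k 1) (by simpa using ha)).symm
      rw [MvPolynomial.pderiv_monomial, hs, add_assoc, add_tsub_cancel_left]
      congr 1
      have : (∑ k ∈ (insert a s)ᶜ, Finsupp.single k 1 : Fin d →₀ ℕ) a = 0 := by
        rw [Finsupp.finsetSum_apply]
        refine Finset.sum_eq_zero fun k hk => ?_
        rw [Finsupp.single_apply, if_neg]
        rintro rfl; simp at hk
      simp only [Finsupp.add_apply, Finsupp.single_eq_same, this, Nat.cast_add, Nat.cast_one, Nat.cast_zero]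
      grind
  have e3 : (∏ k, MvPolynomial.X k : MvPolynomial (Fin d) K) = MvPolynomial.monomial (∑ k, Finsupp.single k 1) 1 := by
    rw [MvPolynomial.monomial_sum_one]; rfl
  rw [e1, ← map_list_prod, List.prod_ofFn, prod_del_comm h2 p hpp, map_smul, LinearMap.smul_apply, e3,
    MvPolynomial.monomial_mul, one_mul, e2]
  simp

lemma Dc_int (D : Derivation ℤ K K) (f : MvPolynomial (Fin d) K)
    (hf : f ∈ (MvPolynomial.map (σ := Fin d) (Int.castRingHom K)).range) : Dc D f = 0 := by
  obtain ⟨g, rfl⟩ := hf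
  induction g using MvPolynomial.induction_on' with
  | monomial m a => rw [MvPolynomial.map_monomial, Dc_monomial]; simp
  | add p q hp hq => grind
end Loc2

section Facet
variable {d : ℕ} {ι K : Type} [Fintype ι] [Field K] (a : Fin d → ι → K) (a0 : Fin d → K)
  (D : Fin d → ι → Derivation ℤ K K)

/-- indicator -/
noncomputable def nn (e : Fin d → ι) (i : ι) (k : Fin d) : K := if e k = i then 1 else 0
noncomputable def Am (e : Fin d → ι) : Matrix (Fin d) (Fin d) K := Matrix.of fun r k => a r (e k)
noncomputable def yy (e : Fin d → ι) : Fin d → K := (Am a e)⁻¹.mulVec a0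
noncomputable def Ye (e : Fin d → ι) (i : ι) : K := ∑ k, nn e i k * yy a a0 e k
noncomputable def Wt (e : Fin d → ι) : K := (Am a e).det * ∏ k, yy a a0 e k
noncomputable def pse (e : Fin d → ι) : MvPolynomial ι K →ₗ[K] K :=
  (Wt a a0 e)⁻¹ • (MvPolynomial.aeval (Ye a a0 e)).toLinearMap

lemma pse_apply (e : Fin d → ι) (p : MvPolynomial ι K) :
    pse a a0 e p = (Wt a a0 e)⁻¹ * MvPolynomial.eval (Ye a a0 e) p := by
  simp [pse, MvPolynomial.aeval_eq_eval]

/-- iterated derivations -/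
noncomputable def DL (l : List (Fin d × ι)) (x : K) : K := l.foldr (fun p x => D p.1 p.2 x) x

lemma DL_add (l : List (Fin d × ι)) (x y : K) : DL D l (x + y) = DL D l x + DL D l y := by
  induction l with
  | nil => rfl
  | cons p l ih => change D _ _ (DL D l _) = D _ _ (DL D l _) + D _ _ (DL D l _); grind

lemma DL_zero (l : List (Fin d × ι)) : DL D l 0 = 0 := by
  simpa using DL_add D l 0 0

lemma DL_sum (l : List (Fin d × ι)) {α : Type*} (s : Finset α) (f : α → K) :
    DL D l (∑ i ∈ s, f i) = ∑ i ∈ s, DL D l (f i) := by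
  induction s using Finset.induction_on with
  | empty => simp [DL_zero]
  | insert a s ha ih => rw [Finset.sum_insert ha, Finset.sum_insert ha, DL_add, ih]

lemma der_sq (h2 : (2 : K) = 0) (D : Derivation ℤ K K) (c x : K) : D (c ^ 2 * x) = c ^ 2 * D x := by
  rw [Derivation.leibniz, Derivation.leibniz_pow]
  simp only [smul_eq_mul, nsmul_eq_mul, Nat.cast_ofNat, h2, zero_mul, mul_zero, add_zero]

lemma DL_sq (h2 : (2 : K) = 0) (l : List (Fin d × ι)) (c x : K) : DL D l (c ^ 2 * x) = c ^ 2 * DL D l x := by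
  induction l with
  | nil => rfl
  | cons p l ih => change D _ _ (DL D l _) = _ * D _ _ (DL D l _); rw [ih, der_sq h2]

lemma comm_list {M : Type*} [AddCommGroup M] [Module K M] (l : List (Module.End K M)) (T : M →+ M)
    (h : ∀ f ∈ l, ∀ x, T (f x) = f (T x)) (x : M) : T (l.prod x) = l.prod (T x) := by
  induction l with
  | nil => rfl
  | cons f l ih =>
    rw [List.prod_cons, Module.End.mul_apply, h f (by simp), ih fun g hg => h g (by simp [hg])]
    rfl

variable (e : Fin d → ι)

lemma D_Am (hD : ∀ r j r' j', D r j (a r' j') = if r = r' ∧ j = j' then 1 else 0) (ρ : Fin d) (i : ι)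
    (r k : Fin d) : D ρ i (Am a e r k) = if r = ρ then nn e i k else 0 := by
  simp only [Am, Matrix.of_apply, hD, nn, ← ite_and, eq_comm]

lemma Yl_range (i : ι) : Yl (nn (K := K) e i) ∈ (MvPolynomial.map (σ := Fin d) (Int.castRingHom K)).range := by
  refine Subring.sum_mem _ fun k _ => Subring.mul_mem _ ?_ ⟨MvPolynomial.X k, by simp⟩
  unfold nn
  split_ifs
  · simp
  · simp

lemma DL_eval (h2 : (2 : K) = 0)
    (hA : (Am a e).det ≠ 0)
    (hD : ∀ r j r' j', D r j (a r' j') = if r = r' ∧ j = j' then 1 else 0)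
    (hD0 : ∀ r j r', D r j (a0 r') = 0)
    (l : List (Fin d × ι)) (f : MvPolynomial (Fin d) K)
    (hf : f ∈ (MvPolynomial.map (σ := Fin d) (Int.castRingHom K)).range) :
    DL D l ((Am a e).det * MvPolynomial.eval (yy a a0 e) f) = (Am a e).det * MvPolynomial.eval (yy a a0 e)
      ((l.map fun p => (del (Am a e)⁻¹ p.1 : Module.End K (MvPolynomial (Fin d) K))).prod
        ((l.map fun p => Yl (nn e p.2)).prod * f)) := by
  induction l with
  | nil => simp [DL]
  | cons p l ih =>
    change D _ _ (DL D l _) = _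
    rw [ih, yy, der_eval' (D p.1 p.2) (Am a e) a0 p.1 (nn e p.2) h2 hA (D_Am a D e hD _ _) (hD0 _ _)]
    congr 2
    refine (comm_list (K := K) _ (Th (D p.1 p.2) (Am a e) p.1 (nn e p.2)) ?_ _).trans ?_
    rotate_left
    · rw [Th_apply, Dc_int, zero_add, List.map_cons, List.prod_cons, Module.End.mul_apply]
      · symm
        refine (comm_list (K := K) _ ((del (Am a e)⁻¹ p.1 : MvPolynomial (Fin d) K →ₗ[K] _).toAddMonoidHom) ?_ _).trans ?_
        · intro f hf x
          obtain ⟨q, -, rfl⟩ := List.mem_map.1 hf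
          exact del_comm _ _ _ _
        · simp only [List.map_cons, List.prod_cons, mul_assoc]; rfl
      · refine Subring.mul_mem _ (Subring.list_prod_mem _ fun g hg => ?_) hf
        obtain ⟨q, -, rfl⟩ := List.mem_map.1 hg
        exact Yl_range _ _
    · intro f hf x
      obtain ⟨q, -, rfl⟩ := List.mem_map.1 hf
      exact Th_del (D p.1 p.2) (Am a e) p.1 (nn e p.2) h2 hA (D_Am a D e hD _ _) q.1 x

/-- restriction to a facet -/
noncomputable def phi : MvPolynomial ι K →ₐ[K] MvPolynomial (Fin d) K :=
  MvPolynomial.aeval fun i => Yl (nn e i)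

lemma eval_phi (p : MvPolynomial ι K) :
    MvPolynomial.eval (yy a a0 e) (phi e p) = MvPolynomial.eval (Ye a a0 e) p := by
  induction p using MvPolynomial.induction_on with
  | C c => simp [phi]
  | add p q hp hq => grind
  | mul_X p i hp => rw [map_mul, map_mul, map_mul, hp]; simp [phi, Ye, Yl]

lemma Yl_e (he : Function.Injective e) (k : Fin d) : Yl (nn (K := K) e (e k)) = MvPolynomial.X k := by
  rw [Yl, Finset.sum_eq_single k]
  · simp [nn]
  · intro j _ hj; simp [nn, he.ne hj]
  · simp

lemma phi_monomial (he : Function.Injective e) (q : ι →₀ ℕ) :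
    phi e (MvPolynomial.monomial q (1 : K)) = 0 ∨ 
    phi e (MvPolynomial.monomial q (1 : K)) = MvPolynomial.monomial (Finsupp.equivFunOnFinite.symm (q ∘ e)) 1 := by
  rw [MvPolynomial.monomial_eq, map_one, one_mul, Finsupp.prod_fintype _ _ (by simp), map_prod]
  simp only [phi, map_pow, MvPolynomial.aeval_X]
  by_cases h : ∃ i, q i ≠ 0 ∧ i ∉ Set.range e
  · left
    obtain ⟨i, hi, hi'⟩ := h
    refine Finset.prod_eq_zero (Finset.mem_univ i) ?_
    have : Yl (nn (K := K) e i) = 0 := by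
      refine Finset.sum_eq_zero fun k _ => ?_
      rw [nn, if_neg fun h => hi' ⟨k, h⟩]; simp
    rw [this, zero_pow hi]
  · right
    push Not at h
    rw [← Finset.prod_subset (Finset.subset_univ (Finset.univ.image e)), Finset.prod_image he.injOn]
    · simp only [Yl_e e he]
      rw [MvPolynomial.monomial_eq, map_one, one_mul, Finsupp.prod_fintype _ _ (by simp)]
      rfl
    · intro i _ hi
      have : q i = 0 := by
        grind
      rw [this, pow_zero]

lemma pse_mon (hA : (Am a e).det ≠ 0)
    (hy : ∀ k, yy a a0 e k ≠ 0) (p : MvPolynomial ι K) :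
    pse a a0 e p = (Wt a a0 e)⁻¹ ^ 2 * ((Am a e).det *
      MvPolynomial.eval (yy a a0 e) ((∏ k, MvPolynomial.X k) * phi e p)) := by
  have hW : Wt a a0 e ≠ 0 := mul_ne_zero hA (Finset.prod_ne_zero_iff.2 fun k _ => hy k)
  rw [pse_apply, map_mul, eval_phi]
  have : MvPolynomial.eval (yy a a0 e) (∏ k, MvPolynomial.X k) = ∏ k, yy a a0 e k := by simp [map_prod]
  rw [this, ← mul_assoc (Am a e).det]
  change _ = _ * (Wt a a0 e * _)
  field_simp

lemma phi_range (m : ι →₀ ℕ) : (∏ k, MvPolynomial.X k) * phi e (MvPolynomial.monomial m (1 : K)) ∈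
    (MvPolynomial.map (σ := Fin d) (Int.castRingHom K)).range := by
  refine Subring.mul_mem _ (Subring.prod_mem _ fun k _ => ⟨MvPolynomial.X k, by simp⟩) ?_
  rw [MvPolynomial.monomial_eq, map_one, one_mul, Finsupp.prod_fintype _ _ (by simp), map_prod]
  refine Subring.prod_mem _ fun j _ => ?_
  rw [map_pow, phi, MvPolynomial.aeval_X]
  exact Subring.pow_mem _ (Yl_range e j) _

lemma Dt_pse (h2 : (2 : K) = 0)
    (hA : (Am a e).det ≠ 0)
    (hy : ∀ k, yy a a0 e k ≠ 0) (ρ : Fin d) (Dt : Derivation ℤ K K) (ha : ∀ r j, Dt (a r j) = 0)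
    (ha0 : ∀ r, Dt (a0 r) = 0) (m : ι →₀ ℕ) : Dt (pse a a0 e (MvPolynomial.monomial m 1)) = 0 := by
  rw [pse_mon a a0 e hA hy, der_sq h2, yy, der_eval' Dt (Am a e) a0 ρ 0 h2 hA (by simp [Am, ha]) ha0, Th_apply,
    Dc_int _ _ (phi_range e m)]
  simp [Yl]

theorem DL_pse (h2 : (2 : K) = 0)
    (hA : (Am a e).det ≠ 0)
    (hD : ∀ r j r' j', D r j (a r' j') = if r = r' ∧ j = j' then 1 else 0)
    (hD0 : ∀ r j r', D r j (a0 r') = 0)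
    (he : Function.Injective e) (hy : ∀ k, yy a a0 e k ≠ 0) (i : Fin d → ι) (m q : ι →₀ ℕ)
    (h : ∑ r, Finsupp.single (i r) 1 + m = q + q) :
    DL D (List.ofFn fun r => (r, i r)) (pse a a0 e (MvPolynomial.monomial m 1)) =
      (pse a a0 e (MvPolynomial.monomial q 1)) ^ 2 := by
  have hmul : ∀ p q : ι →₀ ℕ, phi e (MvPolynomial.monomial (p + q) (1 : K)) =
      phi e (MvPolynomial.monomial p 1) * phi e (MvPolynomial.monomial q 1) := by
    intro p q; rw [← map_mul, MvPolynomial.monomial_mul, one_mul]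
  rw [pse_mon a a0 e hA hy, DL_sq D h2, DL_eval a a0 D e h2 hA hD hD0]
  · have e2 : ((List.ofFn fun r => (r, i r)).map fun p => Yl (nn (K := K) e p.2)).prod *
        ((∏ k, MvPolynomial.X k) * phi e (MvPolynomial.monomial m 1)) =
        (∏ k, MvPolynomial.X k) * phi e (MvPolynomial.monomial (q + q) 1) := by
      rw [List.map_ofFn, List.prod_ofFn, ← h, hmul, MvPolynomial.monomial_sum_one, map_prod]
      have : ∀ r, phi e (MvPolynomial.monomial (Finsupp.single (i r) 1) (1 : K)) = Yl (nn e (i r)) := by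
        intro r
        exact MvPolynomial.aeval_X _ _
      grind
    rw [e2, pse_apply, ← eval_phi]
    rw [hmul]
    rcases phi_monomial (K := K) e he q with h0 | h0
    · grind
    · rw [h0, MvPolynomial.monomial_mul, one_mul, List.map_ofFn]
      have := del_prod h2 (Am a e)⁻¹ (Finsupp.equivFunOnFinite.symm (q ∘ e))
      simp only [Function.comp_def] at this ⊢
      rw [this, MvPolynomial.smul_eq_C_mul, map_mul, MvPolynomial.eval_C, Matrix.det_nonsing_inv, Ring.inverse_eq_inv',
        ← mul_assoc (Am a e).det, mul_inv_cancel₀ hA, one_mul, mul_pow]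
      congr 1
      rw [pow_two, ← map_mul, MvPolynomial.monomial_mul, one_mul]
  · exact phi_range e m
end Facet

lemma det_range {d : ℕ} {K α : Type} [Field K] (h2 : (2 : K) = 0) (c : Fin d → α → K) (e e' : Fin d → α)
    (he : Function.Injective e') (h : ∀ k, ∃ k', e k' = e' k) :
    (Matrix.of fun r k => c r (e k)).det = (Matrix.of fun r k => c r (e' k)).det := by
  choose σ hσ using h
  have hi : Function.Injective σ := fun x y hxy => he (by grind)
  have := Matrix.det_permute' (Equiv.ofBijective σ (Finite.injective_iff_bijective.1 hi)) (Matrix.of fun r k => c r (e k))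
  have e1 : (Matrix.of fun r k => c r (e k)).submatrix id (Equiv.ofBijective σ (Finite.injective_iff_bijective.1 hi)) =
      Matrix.of fun r k => c r (e' k) := by
    ext r k; simp [hσ]
  rw [e1] at this
  rw [this]
  rcases Int.units_eq_one_or (Equiv.Perm.sign (Equiv.ofBijective σ (Finite.injective_iff_bijective.1 hi))) with h | h <;>
    simp [h, neg_c2 h2]

/-- data in characteristic two -/
structure CD (d : ℕ) (ι K : Type) [Fintype ι] [Field K] where
  s : Shell d ι
  even : ∀ S : Finset ι, S.card + 1 = d → Even (s.fac.filter fun F => S ⊆ F).card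
  a : Fin d → ι → K
  a0 : Fin d → K
  t : ι → K
  D : Fin d → ι → Derivation ℤ K K
  Dt : ι → Derivation ℤ K K
  h2 : (2 : K) = 0
  hD : ∀ r j r' j', D r j (a r' j') = if r = r' ∧ j = j' then 1 else 0
  hD0 : ∀ r j r', D r j (a0 r') = 0
  hDta : ∀ j r j', Dt j (a r j') = 0
  hDta0 : ∀ j r, Dt j (a0 r) = 0
  hDtt : ∀ j j', Dt j (t j') = if j = j' then 1 else 0
  gen : ∀ e : Fin d → Option ι, Function.Injective e → (Matrix.of fun r k => (e k).elim (a0 r) (a r)).det ≠ 0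
  en : Finset ι → Fin d → ι
  en_inj : ∀ F ∈ s.fac, Function.Injective (en F)
  en_img : ∀ F ∈ s.fac, ∀ i, i ∈ F ↔ ∃ k, en F k = i

namespace CD
variable {d : ℕ} {ι K : Type} [Fintype ι] [Field K] (C : CD d ι K)

noncomputable def up (F : Finset ι) (k : Fin d) : Fin d → Option ι := Function.update (some ∘ C.en F) k none

lemma up_inj {F : Finset ι} (hF : F ∈ C.s.fac) (k : Fin d) : Function.Injective (C.up F k) := by
  intro x y h
  by_cases hx : x = k <;> by_cases hy : y = k <;> simp_all [up, (C.en_inj F hF).eq_iff]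

noncomputable def om (F : Finset ι) (k : Fin d) : Matrix (Fin d) (Fin d) K :=
  Matrix.of fun r k' => (C.up F k k').elim (C.a0 r) (C.a r)

lemma om_eq (F : Finset ι) (k : Fin d) : C.om F k = (Am C.a (C.en F)).updateCol k C.a0 := by
  ext r k'
  by_cases h : k' = k
  · subst h; simp [om, up]
  · simp [om, up, h, Am]

lemma hA {F : Finset ι} (hF : F ∈ C.s.fac) : (Am C.a (C.en F)).det ≠ 0 :=
  C.gen (some ∘ C.en F) ((Option.some_injective _).comp (C.en_inj F hF))

lemma om_det {F : Finset ι} (hF : F ∈ C.s.fac) (k : Fin d) :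
    (C.om F k).det = (Am C.a (C.en F)).det * yy C.a C.a0 (C.en F) k := by
  have := congrArg (fun v => (Am C.a (C.en F))⁻¹.mulVec v) (Matrix.mulVec_cramer (Am C.a (C.en F)) C.a0)
  simp only [Matrix.mulVec_mulVec, Matrix.nonsing_inv_mul _ (C.hA hF).isUnit, Matrix.one_mulVec, Matrix.mulVec_smul] at this
  have h := congrFun this k
  rw [Matrix.cramer_apply, ← om_eq] at h
  exact h

lemma hy {F : Finset ι} (hF : F ∈ C.s.fac) (k : Fin d) : yy C.a C.a0 (C.en F) k ≠ 0 := fun h =>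
  C.gen _ (C.up_inj hF k) (by have := C.om_det hF k; rw [h, mul_zero] at this; exact this)

lemma Ye_en {F : Finset ι} (hF : F ∈ C.s.fac) (k : Fin d) :
    Ye C.a C.a0 (C.en F) (C.en F k) = yy C.a C.a0 (C.en F) k := by
  rw [Ye, Finset.sum_eq_single k]
  · simp [nn]
  · intro j _ hj; simp [nn, (C.en_inj F hF).ne hj]
  · simp

lemma Ye_off {F : Finset ι} (hF : F ∈ C.s.fac) {i : ι} (hi : i ∉ F) : Ye C.a C.a0 (C.en F) i = 0 :=
  Finset.sum_eq_zero fun k _ => by rw [nn, if_neg fun h => hi ((C.en_img F hF i).2 ⟨k, h⟩), zero_mul]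

lemma sum_Ye {F : Finset ι} (hF : F ∈ C.s.fac) (r : Fin d) : ∑ i, C.a r i * Ye C.a C.a0 (C.en F) i = C.a0 r := by
  simp only [Ye, Finset.mul_sum]
  rw [Finset.sum_comm]
  simp only [nn, ite_mul, one_mul, zero_mul, mul_ite, mul_zero, Finset.sum_ite_eq, Finset.mem_univ, if_true]
  have := congrFun (Matrix.mulVec_mulVec C.a0 (Am C.a (C.en F)) (Am C.a (C.en F))⁻¹) r
  rw [Matrix.mul_nonsing_inv _ (C.hA hF).isUnit, Matrix.one_mulVec] at this
  exact this

/-- the functional -/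
noncomputable def psi : MvPolynomial ι K →ₗ[K] K := ∑ F ∈ C.s.fac, pse C.a C.a0 (C.en F)

lemma psi_apply (p) : C.psi p = ∑ F ∈ C.s.fac, pse C.a C.a0 (C.en F) p := by simp [psi]

lemma pse_off {F : Finset ι} (hF : F ∈ C.s.fac) (m : ι →₀ ℕ) (h : ¬ m.support ⊆ F) :
    pse C.a C.a0 (C.en F) (MvPolynomial.monomial m 1) = 0 := by
  obtain ⟨i, hi, hi'⟩ := Finset.not_subset.1 h
  rw [pse_apply, MvPolynomial.eval_monomial, Finsupp.prod, Finset.prod_eq_zero hi, mul_zero, mul_zero]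
  rw [C.Ye_off hF hi', zero_pow (Finsupp.mem_support_iff.1 hi)]

lemma psi_off (m : ι →₀ ℕ) (h : ∀ F ∈ C.s.fac, ¬ m.support ⊆ F) : C.psi (MvPolynomial.monomial m 1) = 0 := by
  rw [psi_apply]; exact Finset.sum_eq_zero fun F hF => C.pse_off hF m (h F hF)

noncomputable def chi (S : Finset ι) : ι →₀ ℕ := ∑ i ∈ S, Finsupp.single i 1

lemma chi_apply (S : Finset ι) (i : ι) : chi S i = if i ∈ S then 1 else 0 := by
  rw [chi, Finsupp.finsetSum_apply]; simp [Finsupp.single_apply]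

lemma chi_support (S : Finset ι) : (chi S).support = S := by ext i; simp [chi_apply]

lemma chi_degree (S : Finset ι) : (chi S).degree = S.card := by
  rw [chi, map_sum]; simp [Finsupp.degree_single]

lemma eval_chi (S : Finset ι) (y : ι → K) : MvPolynomial.eval y (MvPolynomial.monomial (chi S) 1) = ∏ i ∈ S, y i := by
  rw [MvPolynomial.eval_monomial, one_mul, Finsupp.prod, chi_support]
  exact Finset.prod_congr rfl fun i hi => by rw [chi_apply, if_pos hi, pow_one]

lemma prod_fac {F : Finset ι} (hF : F ∈ C.s.fac) (g : ι → K) : ∏ i ∈ F, g i = ∏ k, g (C.en F k) := by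
  have : F = Finset.univ.image (C.en F) := by ext i; simp [C.en_img F hF i]
  conv_lhs => rw [this]
  rw [Finset.prod_image (C.en_inj F hF).injOn]

lemma psi_fac {F : Finset ι} (hF : F ∈ C.s.fac) : C.psi (MvPolynomial.monomial (chi F) 1) ≠ 0 := by
  rw [psi_apply, Finset.sum_eq_single_of_mem F hF]
  · rw [pse_apply, eval_chi, C.prod_fac hF]
    refine mul_ne_zero (inv_ne_zero (mul_ne_zero (C.hA hF) ?_)) ?_
    · exact Finset.prod_ne_zero_iff.2 fun k _ => C.hy hF k
    · exact Finset.prod_ne_zero_iff.2 fun k _ => by rw [C.Ye_en hF]; exact C.hy hF k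
  · intro F' hF' hne
    refine C.pse_off hF' _ fun h => hne ?_
    rw [chi_support] at h
    exact (Finset.eq_of_subset_of_card_le h (by rw [C.s.card F hF, C.s.card F' hF'])).symm

/-- linear form -/
noncomputable def lin (c : ι → K) : MvPolynomial ι K := ∑ i, c i • MvPolynomial.X i

lemma lin_mul (L : MvPolynomial ι K →ₗ[K] K) (c : ι → K) (p) :
    L (lin c * p) = ∑ i, c i * L (MvPolynomial.X i * p) := by
  simp only [lin, Finset.sum_mul, map_sum, smul_mul_assoc, map_smul, smul_eq_mul]

lemma X_mon (i : ι) (m : ι →₀ ℕ) : MvPolynomial.X i * MvPolynomial.monomial m (1 : K) =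
    MvPolynomial.monomial (Finsupp.single i 1 + m) 1 := by
  rw [MvPolynomial.X, MvPolynomial.monomial_mul, one_mul]

lemma psi_theta (r : Fin d) (p) : C.psi (lin (C.a r) * p) = C.a0 r * C.psi p := by
  simp only [psi_apply, Finset.mul_sum]
  refine Finset.sum_congr rfl fun F hF => ?_
  rw [pse_apply, pse_apply, map_mul, lin]
  simp only [map_sum, MvPolynomial.smul_eval, MvPolynomial.eval_X]
  rw [C.sum_Ye hF]; ring

lemma psi_ridge (S : Finset ι) (hS : S.card + 1 = d) : C.psi (MvPolynomial.monomial (chi S) 1) = 0 := by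
  rw [psi_apply, ← Finset.sum_filter_of_ne (p := fun F => S ⊆ F) (fun F hF h => by
    by_contra h'; exact h (C.pse_off hF _ (by rwa [chi_support])))]
  have key : ∀ F ∈ C.s.fac, S ⊆ F → ∃ k, pse C.a C.a0 (C.en F) (MvPolynomial.monomial (chi S) 1) = (C.om F k).det⁻¹ ∧
      ∀ o, (∃ k', C.up F k k' = o) ↔ (o = none ∨ ∃ i ∈ S, o = some i) := by
    intro F hF hSF
    obtain ⟨p, hp⟩ : ∃ p, F \ S = {p} := by
      rw [← Finset.card_eq_one, Finset.card_sdiff_of_subset hSF, C.s.card F hF]; omega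
    have hp1 : p ∈ F ∧ p ∉ S := by rw [← Finset.mem_sdiff, hp]; simp
    have hp2 : ∀ i ∈ F, i ≠ p → i ∈ S := fun i hi hip => by
      by_contra h; exact hip (Finset.mem_singleton.1 (hp ▸ Finset.mem_sdiff.2 ⟨hi, h⟩))
    obtain ⟨k, hk⟩ := (C.en_img F hF p).1 hp1.1
    refine ⟨k, ?_, ?_⟩
    · rw [pse_apply, eval_chi, C.om_det hF, Wt]
      have e1 : insert p S = F := by
        grind
      have e2 : ∏ k, yy C.a C.a0 (C.en F) k = yy C.a C.a0 (C.en F) k * ∏ i ∈ S, Ye C.a C.a0 (C.en F) i := by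
        rw [← C.Ye_en hF k, hk, ← Finset.prod_insert hp1.2, e1, C.prod_fac hF]
        exact Finset.prod_congr rfl fun k _ => (C.Ye_en hF k).symm
      have e3 : ∏ i ∈ S, Ye C.a C.a0 (C.en F) i ≠ 0 := Finset.prod_ne_zero_iff.2 fun i hi => by
        obtain ⟨k, rfl⟩ := (C.en_img F hF i).1 (hSF hi)
        rw [C.Ye_en hF]; exact C.hy hF k
      grind
    · intro o
      constructor
      · rintro ⟨k', rfl⟩
        by_cases h : k' = k
        · subst h; simp [up]
        · right
          refine ⟨C.en F k', hp2 _ ((C.en_img F hF _).2 ⟨k', rfl⟩) fun h' => h (C.en_inj F hF (by rw [h', hk])), ?_⟩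
          simp [up, h]
      · rintro (rfl | ⟨i, hi, rfl⟩)
        · exact ⟨k, by simp [up]⟩
        · obtain ⟨k', rfl⟩ := (C.en_img F hF i).1 (hSF hi)
          refine ⟨k', ?_⟩
          have : k' ≠ k := by rintro rfl; rw [hk] at hi; grind
          simp [up, this]
  rcases (C.s.fac.filter fun F => S ⊆ F).eq_empty_or_nonempty with h | ⟨F0, h0⟩
  · grind
  · obtain ⟨h01, h02⟩ := Finset.mem_filter.1 h0
    obtain ⟨k0, -, h04⟩ := key F0 h01 h02
    rw [Finset.sum_congr rfl (g := fun _ => (C.om F0 k0).det⁻¹), Finset.sum_const]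
    · obtain ⟨c, hc⟩ := C.even S hS
      rw [hc, nsmul_eq_mul, Nat.cast_add, ← two_mul, C.h2, zero_mul, zero_mul]
    · intro F hF
      obtain ⟨h1, h2⟩ := Finset.mem_filter.1 hF
      obtain ⟨k, h3, h4⟩ := key F h1 h2
      rw [h3]
      congr 1
      refine det_range C.h2 (fun r (o : Option ι) => o.elim (C.a0 r) (C.a r)) _ _ (C.up_inj h01 k0) fun k' => ?_
      exact (h4 _).2 ((h04 _).1 ⟨k', rfl⟩)

lemma dual (A : Matrix (Fin d) (Fin d) K) (hA : A.det ≠ 0) (w : Fin d) :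
    ∃ c : Fin d → K, ∀ k, ∑ r, c r * A r k = if w = k then 1 else 0 := by
  refine ⟨fun r => A⁻¹ w r, fun k => ?_⟩
  have := congrFun (congrFun (Matrix.nonsing_inv_mul A hA.isUnit) w) k
  rwa [Matrix.mul_apply, Matrix.one_apply] at this

lemma sum_lin (L : MvPolynomial ι K →ₗ[K] K) (c : Fin d → K) (p) :
    ∑ r, c r * L (lin (C.a r) * p) = ∑ i, (∑ r, c r * C.a r i) * L (MvPolynomial.X i * p) := by
  simp only [lin_mul, Finset.mul_sum, Finset.sum_mul]
  rw [Finset.sum_comm]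
  grind

theorem psi_zero (m : ι →₀ ℕ) (hm : m.degree + 1 = d) : C.psi (MvPolynomial.monomial m 1) = 0 := by
  induction hn : d - m.support.card using Nat.strong_induction_on generalizing m with
  | _ n ih =>
  by_cases hf : ∃ F ∈ C.s.fac, m.support ⊆ F
  swap
  · push Not at hf; exact C.psi_off m hf
  obtain ⟨F, hF, hmF⟩ := hf
  by_cases h1 : ∀ i, m i ≤ 1
  · have : m = chi m.support := by
      ext i
      rw [chi_apply]
      grind
    rw [this]
    rw [this, chi_degree] at hm
    exact C.psi_ridge _ hm
  push Not at h1
  obtain ⟨w, hw⟩ := h1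
  obtain ⟨m', rfl⟩ : ∃ m', m = Finsupp.single w 1 + m' :=
    ⟨m - Finsupp.single w 1, (add_tsub_cancel_of_le (by rw [Finsupp.single_le_iff]; omega)).symm⟩
  have hw' : m' w ≠ 0 := by simp at hw; omega
  have hsup : (Finsupp.single w 1 + m').support = m'.support := by
    ext i; by_cases h : w = i
    · grind
    · simp [h, Finsupp.single_apply]
  rw [hsup] at hn hmF
  have hdeg : m'.degree + 2 = d := by
    rw [map_add, Finsupp.degree_single] at hm; omega
  have hcard : m'.support.card ≤ m'.degree := by
    rw [Finsupp.degree, Finset.card_eq_sum_ones]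
    exact Finset.sum_le_sum fun i hi => Nat.one_le_iff_ne_zero.2 (Finsupp.mem_support_iff.1 hi)
  obtain ⟨p, hpF, hp⟩ : ∃ p ∈ F, p ∉ m'.support := by
    by_contra h; push Not at h
    have := Finset.card_le_card (show F ⊆ m'.support from h)
    rw [C.s.card F hF] at this; omega
  obtain ⟨kp, rfl⟩ := (C.en_img F hF p).1 hpF
  obtain ⟨kw, rfl⟩ := (C.en_img F hF w).1 (hmF (Finsupp.mem_support_iff.2 hw'))
  have hne : kw ≠ kp := by rintro rfl; grind
  obtain ⟨c, hc⟩ := dual (C.om F kp) (C.gen _ (C.up_inj hF kp)) kw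
  have h1 := C.sum_lin C.psi c (MvPolynomial.monomial m' 1)
  simp only [psi_theta, ← mul_assoc, ← Finset.sum_mul] at h1
  have h2 : ∑ r, c r * C.a0 r = 0 := by
    have := hc kp
    rw [if_neg hne] at this
    simpa [om, up] using this
  have h3 : ∀ k, k ≠ kp → ∑ r, c r * C.a r (C.en F k) = if kw = k then 1 else 0 := by
    intro k hk
    have := hc k
    simpa [om, up, hk] using this
  rw [h2, zero_mul, Finset.sum_eq_single (C.en F kw)] at h1
  · rw [h3 kw hne, if_pos rfl, one_mul, X_mon] at h1
    grind
  · intro i _ hi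
    by_cases hi' : i ∈ m'.support
    · obtain ⟨k, rfl⟩ := (C.en_img F hF i).1 (hmF hi')
      rw [h3 k (by rintro rfl; exact hp hi'), if_neg (by rintro rfl; exact hi rfl), zero_mul]
    · rw [X_mon]
      have hs : (Finsupp.single i 1 + m').support = insert i m'.support := by
        ext j; by_cases h : i = j
        · subst h; simp
        · simp [h, Finsupp.single_apply, Ne.symm h]
      rw [ih (d - (insert i m'.support).card) ?_ _ ?_ (by rw [hs]), mul_zero]
      · grind
      · rw [map_add, Finsupp.degree_single]; omega
  · simp
end CD

section Gen
variable {ι K : Type} [Fintype ι] [Field K]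

lemma exists_tuple (d : ℕ) (m : ι →₀ ℕ) (h : m.degree = d) : ∃ i : Fin d → ι, ∑ r, Finsupp.single (i r) 1 = m := by
  induction d generalizing m with
  | zero => exact ⟨Fin.elim0, by simpa using ((Finsupp.degree_eq_zero_iff m).1 h).symm⟩
  | succ n ih =>
    have : m ≠ 0 := by rintro rfl; simp at h
    obtain ⟨i, hi⟩ := Finsupp.ne_iff.1 this
    have hle : Finsupp.single i 1 ≤ m := by
      rw [Finsupp.single_le_iff]; grind
    have e := add_tsub_cancel_of_le hle
    obtain ⟨f, hf⟩ := ih (m - Finsupp.single i 1) (by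
      have := congrArg Finsupp.degree e
      rw [map_add, Finsupp.degree_single] at this; omega)
    refine ⟨Fin.cons i f, ?_⟩
    rw [Fin.sum_univ_succ]; simp only [Fin.cons_zero, Fin.cons_succ]; rw [hf, e]

lemma exists_split (n : ℕ) (w : ι →₀ ℕ) (h : n ≤ w.degree) : ∃ μ ν, w = μ + ν ∧ μ.degree = n := by
  obtain ⟨i, hi⟩ := exists_tuple _ w rfl
  obtain ⟨k, hk⟩ := Nat.exists_eq_add_of_le h
  refine ⟨∑ r : Fin n, Finsupp.single (i (Fin.cast hk.symm (Fin.castAdd k r))) 1,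
    ∑ r : Fin k, Finsupp.single (i (Fin.cast hk.symm (Fin.natAdd n r))) 1, ?_, ?_⟩
  · rw [← Fin.sum_univ_add (fun r => Finsupp.single (i (Fin.cast hk.symm r)) 1)]
    conv_lhs => rw [← hi]
    exact (Equiv.sum_comp (finCongr hk.symm) (fun r => Finsupp.single (i r) 1)).symm
  · simp [map_sum, Finsupp.degree_single]

lemma mon_exp (p : MvPolynomial ι K) : p = ∑ v ∈ p.support, p.coeff v • MvPolynomial.monomial v (1 : K) := by
  conv_lhs => rw [MvPolynomial.as_sum p]
  exact Finset.sum_congr rfl fun v _ => by rw [MvPolynomial.smul_monomial, smul_eq_mul, mul_one]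

lemma hom_ext {M : Type*} [AddCommGroup M] [Module K M] (L L' : MvPolynomial ι K →ₗ[K] M) {k : ℕ}
    (h : ∀ m : ι →₀ ℕ, m.degree = k → L (MvPolynomial.monomial m 1) = L' (MvPolynomial.monomial m 1)) {p} (hp : p.IsHomogeneous k) :
    L p = L' p := by
  rw [mon_exp p, map_sum, map_sum]
  refine Finset.sum_congr rfl fun v hv => ?_
  rw [map_smul, map_smul, h]
  by_contra h'
  exact MvPolynomial.mem_support_iff.1 hv (hp.coeff_eq_zero h')

/-- multiplication followed by functional -/
noncomputable def lm {M : Type*} [AddCommGroup M] [Module K M] (L : MvPolynomial ι K →ₗ[K] M) (g : MvPolynomial ι K) :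
    MvPolynomial ι K →ₗ[K] M := L ∘ₗ LinearMap.mulLeft K g

lemma lm_apply {M : Type*} [AddCommGroup M] [Module K M] (L : MvPolynomial ι K →ₗ[K] M) (g p : MvPolynomial ι K) :
    lm L g p = L (g * p) := rfl

lemma hom_zero {L : MvPolynomial ι K →ₗ[K] K} {g : MvPolynomial ι K} {k : ℕ}
    (h : ∀ m : ι →₀ ℕ, m.degree = k → L (g * MvPolynomial.monomial m 1) = 0) {p} (hp : p.IsHomogeneous k) : L (g * p) = 0 := by
  simpa [lm_apply] using hom_ext (lm L g) 0 (by simpa [lm_apply] using h) hp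
end Gen

namespace CD
variable {d : ℕ} {ι K : Type} [Fintype ι] [Field K] (C : CD d ι K)

lemma DL_psi (i : Fin d → ι) (m q : ι →₀ ℕ) (h : ∑ r, Finsupp.single (i r) 1 + m = q + q) :
    DL C.D (List.ofFn fun r => (r, i r)) (C.psi (MvPolynomial.monomial m 1)) = (C.psi (MvPolynomial.monomial q 1)) ^ 2 := by
  have := CharTwo.of_one_ne_zero_of_two_eq_zero (one_ne_zero (α := K)) C.h2
  rw [psi_apply, psi_apply, DL_sum, CharTwo.sum_sq]
  exact Finset.sum_congr rfl fun F hF =>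
    DL_pse C.a C.a0 C.D (C.en F) C.h2 (C.hA hF) C.hD C.hD0 (C.en_inj F hF) (C.hy hF) i m q h

lemma aniso (g : MvPolynomial ι K) (k : ℕ) (hk : 2 * k ≤ d)
    (h : ∀ u : ι →₀ ℕ, u.degree + 2 * k = d → C.psi (g * g * MvPolynomial.monomial u 1) = 0)
    (w : ι →₀ ℕ) (hw : w.degree + k = d) : C.psi (g * MvPolynomial.monomial w 1) = 0 := by
  have := CharTwo.of_one_ne_zero_of_two_eq_zero (one_ne_zero (α := K)) C.h2
  obtain ⟨μ, ν, rfl, hμ⟩ := exists_split (d - 2 * k) w (by omega)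
  rw [map_add] at hw
  obtain ⟨i, hi⟩ := exists_tuple d (μ + (ν + ν)) (by simp only [map_add]; omega)
  have h1 := congrArg (DL C.D (List.ofFn fun r => (r, i r))) (h μ (by omega))
  have e1 : g * g = ∑ v ∈ g.support, (g.coeff v) ^ 2 • MvPolynomial.monomial (v + v) (1 : K) := by
    conv_lhs => rw [← pow_two, mon_exp g]
    rw [CharTwo.sum_sq]
    exact Finset.sum_congr rfl fun v _ => by rw [_root_.smul_pow, pow_two (MvPolynomial.monomial v 1), MvPolynomial.monomial_mul, one_mul]
  rw [e1, Finset.sum_mul, map_sum, DL_sum, DL_zero, Finset.sum_congr rfl (g := fun v =>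
    (g.coeff v * C.psi (MvPolynomial.monomial (v + (μ + ν)) 1)) ^ 2), ← CharTwo.sum_sq] at h1
  · have h2 := pow_eq_zero_iff (two_ne_zero) |>.1 h1
    conv_lhs => rw [mon_exp g]
    rw [Finset.sum_mul, map_sum, ← h2]
    refine Finset.sum_congr rfl fun v _ => ?_
    rw [smul_mul_assoc, map_smul, MvPolynomial.monomial_mul, one_mul, smul_eq_mul]
  · intro v _
    rw [smul_mul_assoc, map_smul, MvPolynomial.monomial_mul, one_mul, smul_eq_mul, DL_sq _ C.h2, mul_pow, C.DL_psi]
    grind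

lemma Dt_psi (hd : 0 < d) (j : ι) (p : MvPolynomial ι K) : C.Dt j (C.psi p) = C.psi (Dc (C.Dt j) p) := by
  induction p using MvPolynomial.induction_on' with
  | monomial m c =>
    have h0 : ∀ c : K, C.psi (MvPolynomial.monomial m c) = c * C.psi (MvPolynomial.monomial m 1) := by
      intro c; rw [← smul_eq_mul, ← map_smul, MvPolynomial.smul_monomial, smul_eq_mul, mul_one]
    rw [Dc_monomial, h0, h0 (C.Dt j c), Derivation.leibniz]
    have : C.Dt j (C.psi (MvPolynomial.monomial m 1)) = 0 := by
      rw [psi_apply, map_sum]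
      exact Finset.sum_eq_zero fun F hF => Dt_pse C.a C.a0 (C.en F) C.h2 (C.hA hF) (C.hy hF) ⟨0, hd⟩ (C.Dt j)
        (C.hDta j) (C.hDta0 j) m
    rw [this]; simp [mul_comm]
  | add p q hp hq => grind

lemma Dc_mon (j : ι) (w : ι →₀ ℕ) (p : MvPolynomial ι K) :
    Dc (C.Dt j) (p * MvPolynomial.monomial w 1) = Dc (C.Dt j) p * MvPolynomial.monomial w 1 := by
  induction p using MvPolynomial.induction_on' with
  | monomial m c => simp [MvPolynomial.monomial_mul, Dc_monomial]
  | add p q hp hq => rw [add_mul, map_add, hp, hq, map_add, add_mul]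

lemma Dc_lin (j : ι) (p : MvPolynomial ι K) :
    Dc (C.Dt j) (lin C.t * p) = MvPolynomial.X j * p + lin C.t * Dc (C.Dt j) p := by
  simp only [lin, Finset.sum_mul, map_sum, MvPolynomial.smul_eq_C_mul, mul_assoc, Dc_C_mul, Dc_X_mul, C.hDtt,
    Finset.sum_add_distrib]
  congr 1
  rw [Finset.sum_eq_single j] <;> grind

lemma Dc_hom (j : ι) {p : MvPolynomial ι K} {k : ℕ} (hp : p.IsHomogeneous k) : (Dc (C.Dt j) p).IsHomogeneous k := by
  rw [Dc]
  refine MvPolynomial.IsHomogeneous.sum _ _ _ fun m hm => MvPolynomial.isHomogeneous_monomial _ ?_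
  by_contra h'
  exact MvPolynomial.mem_support_iff.1 hm (hp.coeff_eq_zero h')

lemma lefschetz (g : MvPolynomial ι K) (k : ℕ) (hk : 2 * k < d) (hg : g.IsHomogeneous k)
    (h : ∀ w : ι →₀ ℕ, w.degree + k + 1 = d → C.psi (lin C.t * g * MvPolynomial.monomial w 1) = 0)
    (w : ι →₀ ℕ) (hw : w.degree + k = d) : C.psi (g * MvPolynomial.monomial w 1) = 0 := by
  have hh : ∀ p : MvPolynomial ι K, p.IsHomogeneous (d - 1 - k) → C.psi (lin C.t * g * p) = 0 := fun p hp =>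
    hom_zero (fun m hm => h m (by omega)) hp
  refine C.aniso g k hk.le (fun u hu => ?_) w hw
  obtain ⟨μ, ν, rfl, hμ⟩ := exists_split 1 u (by omega)
  obtain ⟨j, hj⟩ := exists_tuple 1 μ hμ
  rw [map_add] at hu
  have h1 : ∀ p : MvPolynomial ι K, p.IsHomogeneous (d - 1 - k) →
      C.psi ((MvPolynomial.X (j 0) * g + lin C.t * Dc (C.Dt (j 0)) g) * p) = 0 := fun p hp => by
    refine hom_zero (fun m hm => ?_) hp
    rw [← Dc_lin, ← Dc_mon, ← C.Dt_psi (by omega), h m (by omega), map_zero]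
  have hgν : (g * MvPolynomial.monomial ν (1 : K)).IsHomogeneous (d - 1 - k) := by
    convert hg.mul (MvPolynomial.isHomogeneous_monomial (1 : K) rfl) using 1; omega
  have h2 := h1 _ hgν
  have h3 := hh (Dc (C.Dt (j 0)) g * MvPolynomial.monomial ν (1 : K)) (by
    convert (C.Dc_hom (j 0) hg).mul (MvPolynomial.isHomogeneous_monomial (1 : K) rfl) using 1; omega)
  rw [add_mul, map_add, show lin C.t * Dc (C.Dt (j 0)) g * (g * MvPolynomial.monomial ν (1 : K)) =
    lin C.t * g * (Dc (C.Dt (j 0)) g * MvPolynomial.monomial ν (1 : K)) by ring, h3, add_zero] at h2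
  rw [← h2, ← hj]
  simp only [Fin.sum_univ_one, Fin.isValue]
  rw [← X_mon]
  congr 1; ring

lemma span_shell (s : Shell d ι) (hs : s.fac = C.s.fac) (L : MvPolynomial ι K →ₗ[K] K) (k : ℕ)
    (h1 : ∀ m : ι →₀ ℕ, m.degree = k → (∀ F ∈ s.fac, ¬ m.support ⊆ F) → L (MvPolynomial.monomial m 1) = 0)
    (h2 : ∀ r, ∀ m : ι →₀ ℕ, m.degree + 1 = k → L (lin (C.a r) * MvPolynomial.monomial m 1) = 0)
    (h3 : ∀ F ∈ s.fac, (s.R F).card = k → L (MvPolynomial.monomial (chi (s.R F)) 1) = 0)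
    (m : ι →₀ ℕ) (hm : m.degree = k) : L (MvPolynomial.monomial m 1) = 0 := by
  have key : ∀ n, ∀ F ∈ s.fac, (s.fac.filter fun G => s.rk G < s.rk F).card = n → ∀ m : ι →₀ ℕ, m.degree = k →
      chi (s.R F) ≤ m → L (MvPolynomial.monomial m 1) = 0 := by
    intro n
    induction n using Nat.strong_induction_on with
    | _ n ih =>
    intro F hF hn
    have step : ∀ m : ι →₀ ℕ, m.degree = k → chi (s.R F) ≤ m → ¬ m.support ⊆ F → L (MvPolynomial.monomial m 1) = 0 := by
      intro m hm hle hnot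
      by_cases hf : ∃ F ∈ s.fac, m.support ⊆ F
      swap
      · grind
      obtain ⟨F', hF', hmF'⟩ := hf
      obtain ⟨F1, hF1, hR, hS⟩ := s.h3 F' hF' _ hmF'
      have hne : F1 ≠ F := by rintro rfl; grind
      have hlt := s.h1 F hF F1 hF1 hne ((fun i hi => hS (Finsupp.mem_support_iff.2 (by
        have := hle i; rw [chi_apply, if_pos hi] at this; omega))))
      refine ih _ ?_ F1 hF1 rfl m hm fun i => ?_
      · rw [← hn]
        refine Finset.card_lt_card ⟨fun G hG => ?_, fun h => ?_⟩
        · grind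
        · have := h (Finset.mem_filter.2 ⟨hF1, hlt⟩)
          grind
      · rw [chi_apply]; split_ifs with h
        · grind
        grind
    intro m hm hle
    by_cases hmF : m.support ⊆ F
    swap
    · grind
    obtain ⟨m', rfl⟩ := exists_add_of_le hle
    by_cases h0 : m' = 0
    · subst h0
      rw [add_zero] at hm ⊢
      exact h3 F hF (by rw [← hm, chi_degree])
    obtain ⟨w, hw⟩ := Finsupp.ne_iff.1 h0
    obtain ⟨m'', rfl⟩ : ∃ m'', m' = Finsupp.single w 1 + m'' :=
      ⟨m' - Finsupp.single w 1, (add_tsub_cancel_of_le (by rw [Finsupp.single_le_iff]; grind)).symm⟩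
    have hwF : w ∈ F := hmF (by rw [Finsupp.mem_support_iff]; simp)
    obtain ⟨kw, rfl⟩ := (C.en_img F (hs ▸ hF) w).1 hwF
    obtain ⟨c, hc⟩ := dual _ (C.hA (hs ▸ hF)) kw
    rw [show chi (s.R F) + (Finsupp.single (C.en F kw) 1 + m'') = Finsupp.single (C.en F kw) 1 + (chi (s.R F) + m'') by abel] at *
    have e := C.sum_lin L c (MvPolynomial.monomial (chi (s.R F) + m'') 1)
    rw [map_add, Finsupp.degree_single] at hm
    rw [Finset.sum_eq_zero (fun r _ => by grind), Finset.sum_eq_single (C.en F kw)] at e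
    · have := hc kw
      rw [if_pos rfl] at this
      rw [show ∑ r, c r * C.a r (C.en F kw) = 1 from this, one_mul, X_mon] at e
      exact e.symm
    · intro i _ hi
      by_cases hiF : i ∈ F
      · obtain ⟨k', rfl⟩ := (C.en_img F (hs ▸ hF) i).1 hiF
        have := hc k'
        rw [if_neg (by rintro rfl; exact hi rfl)] at this
        rw [show ∑ r, c r * C.a r (C.en F k') = 0 from this, zero_mul]
      · rw [X_mon, step, mul_zero]
        · rw [map_add, Finsupp.degree_single]; exact hm
        · rw [← add_assoc, add_comm _ (chi _), add_assoc]; exact le_self_add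
        · intro h; exact hiF (h (by rw [Finsupp.mem_support_iff]; simp))
    · simp
  by_cases hf : ∃ F ∈ s.fac, m.support ⊆ F
  swap
  · grind
  obtain ⟨F', hF', hmF'⟩ := hf
  obtain ⟨F1, hF1, hR, hS⟩ := s.h3 F' hF' _ hmF'
  refine key _ F1 hF1 rfl m hm fun i => ?_
  rw [chi_apply]; split_ifs with h
  · grind
  grind
end CD

lemma basis_count {α K M : Type*} [LinearOrder α] [Field K] [AddCommGroup M] [Module K M] (v : α → M) (s : Finset α) :
    (s.filter fun m => v m ∉ Submodule.span K (v '' {m' | m' ∈ s ∧ m' < m})).card =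
      Module.finrank K (Submodule.span K (v '' (s : Set α))) := by
  suffices H : LinearIndepOn K v ((s.filter fun m => v m ∉ Submodule.span K (v '' {m' | m' ∈ s ∧ m' < m}) : Finset α) : Set α) ∧
      Submodule.span K (v '' ((s.filter fun m => v m ∉ Submodule.span K (v '' {m' | m' ∈ s ∧ m' < m}) : Finset α) : Set α)) =
      Submodule.span K (v '' (s : Set α)) by
    rw [← H.2, Set.image_eq_range]
    have := finrank_span_eq_card (R := K) (b := fun x : ((s.filter fun m => v m ∉ Submodule.span K (v '' {m' | m' ∈ s ∧ m' < m}) : Finset α) : Set α) => v x) H.1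
    rw [this]; simp
  induction s using Finset.induction_on_max with
  | empty => simp
  | insert a s ha ih =>
    have has : a ∉ s := fun h => lt_irrefl _ (ha a h)
    have e1 : {m' | m' ∈ insert a s ∧ m' < a} = (s : Set α) := by
      grind
    have e2 : ∀ m ∈ s, {m' | m' ∈ insert a s ∧ m' < m} = {m' | m' ∈ s ∧ m' < m} := by
      grind
    rw [Finset.filter_insert, e1, Finset.filter_congr (fun m hm => by rw [e2 m hm])]
    set B := s.filter fun m => v m ∉ Submodule.span K (v '' {m' | m' ∈ s ∧ m' < m})
    split_ifs with h
    · refine ⟨ih.1, ?_⟩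
      rw [ih.2, Finset.coe_insert, Set.image_insert_eq, Submodule.span_insert_eq_span]
      grind
    · rw [Finset.coe_insert, Finset.coe_insert, Set.image_insert_eq, Set.image_insert_eq, Submodule.span_insert, Submodule.span_insert, ih.2]
      exact ⟨ih.1.insert (by rw [ih.2]; exact h), rfl⟩

theorem std_ideal' {ι K : Type} [Fintype ι] [LinearOrder ι] [Field K] (Q : ℕ → Type) [∀ k, AddCommGroup (Q k)] [∀ k, Module K (Q k)]
    (Ψ : ∀ k, MvPolynomial ι K →ₗ[K] Q k)
    (hc : ∀ k p i, p.IsHomogeneous k → Ψ k p = 0 → Ψ (k + 1) (MvPolynomial.X i * p) = 0) :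
    ∃ Γ : Set (ι →₀ ℕ), (∀ m ∈ Γ, ∀ m' ≤ m, m' ∈ Γ) ∧
      ∀ k, Set.ncard {m | m ∈ Γ ∧ m.degree = k} =
        Module.finrank K ((MvPolynomial.homogeneousSubmodule ι K k).map (Ψ k)) := by
  let v : ∀ k, (ι →₀ ℕ) → Q k := fun k m => Ψ k (MvPolynomial.monomial m 1)
  let T : (ι →₀ ℕ) → ℕ → Set (ι →₀ ℕ) := fun m k => {m' | m'.degree = k ∧ toLex m' < toLex m}
  let Γ : Set (ι →₀ ℕ) := {m | v m.degree m ∉ Submodule.span K (v m.degree '' T m m.degree)}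
  have step0 : ∀ m i, v m.degree m ∈ Submodule.span K (v m.degree '' T m m.degree) →
      v (m.degree + 1) (Finsupp.single i 1 + m) ∈ Submodule.span K (v (m.degree + 1) '' T (Finsupp.single i 1 + m) (m.degree + 1)) := by
    intro m i hspan
    obtain ⟨c, hc1, hc2⟩ := (Finsupp.mem_span_image_iff_linearCombination K).1 hspan
    rw [Finsupp.linearCombination_apply, Finsupp.sum] at hc2
    have h0 : Ψ m.degree (MvPolynomial.monomial m 1 - ∑ x ∈ c.support, c x • MvPolynomial.monomial x (1 : K)) = 0 := by
      rw [map_sub, map_sum, sub_eq_zero, ← show _ = Ψ m.degree (MvPolynomial.monomial m 1) from hc2]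
      exact Finset.sum_congr rfl fun x _ => by rw [map_smul]
    have h1 := hc _ _ i ?_ h0
    · rw [mul_sub, map_sub, sub_eq_zero, CD.X_mon, Finset.mul_sum, map_sum] at h1
      rw [show v (m.degree + 1) (Finsupp.single i 1 + m) = _ from h1]
      refine Submodule.sum_mem _ fun x hx => ?_
      rw [mul_smul_comm, map_smul, CD.X_mon]
      obtain ⟨hx1, hx2⟩ := hc1 hx
      have hT : Finsupp.single i 1 + x ∈ T (Finsupp.single i 1 + m) (m.degree + 1) := by
        refine ⟨by rw [map_add, Finsupp.degree_single, hx1, add_comm], ?_⟩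
        rw [toLex_add, toLex_add]
        grind
      exact Submodule.smul_mem _ _ (Submodule.subset_span (Set.mem_image_of_mem (v (m.degree + 1)) hT))
    · refine MvPolynomial.IsHomogeneous.sub (MvPolynomial.isHomogeneous_monomial _ rfl)
        (MvPolynomial.IsHomogeneous.sum _ _ _ fun x hx => ?_)
      rw [MvPolynomial.smul_monomial]
      exact MvPolynomial.isHomogeneous_monomial _ (hc1 hx).1
  have step : ∀ m i, Finsupp.single i 1 + m ∈ Γ → m ∈ Γ := by
    intro m i hm hspan
    have h := step0 m i hspan
    rw [show m.degree + 1 = (Finsupp.single i 1 + m).degree by rw [map_add, Finsupp.degree_single, add_comm]] at h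
    exact hm h
  refine ⟨Γ, ?_, ?_⟩
  · intro m hm m' hle
    obtain ⟨r, rfl⟩ := exists_add_of_le hle
    clear hle
    induction hn : r.degree generalizing r with
    | zero => rw [(Finsupp.degree_eq_zero_iff r).1 hn, add_zero] at hm; exact hm
    | succ n ih =>
      obtain ⟨μ, ν, rfl, hμ⟩ := exists_split 1 r (by omega)
      obtain ⟨j, hj⟩ := exists_tuple 1 μ hμ
      simp only [Fin.sum_univ_one, Fin.isValue] at hj
      subst hj
      rw [map_add] at hn
      refine ih ν (step _ (j 0) ?_) (by omega)
      grind
  · intro k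
    let s : Finset (Lex (ι →₀ ℕ)) := (Finset.finsuppAntidiag Finset.univ k).map toLex.toEmbedding
    have hs : ∀ x, x ∈ s ↔ (ofLex x).degree = k := by
      intro x
      simp only [s, Finset.mem_map, Finset.mem_finsuppAntidiag, Finset.subset_univ, and_true]
      constructor
      · rintro ⟨y, hy, rfl⟩; rw [← hy, Finsupp.degree_eq_sum]; rfl
      · intro h; exact ⟨ofLex x, by rw [← h, Finsupp.degree_eq_sum], rfl⟩
    have h := basis_count (K := K) (fun x => v k (ofLex x)) s
    have himg : ∀ m : ι →₀ ℕ, (fun x => v k (ofLex x)) '' {m' | m' ∈ s ∧ m' < toLex m} = v k '' T m k := by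
      intro m; ext y
      constructor
      · rintro ⟨x, hx, rfl⟩; exact ⟨ofLex x, ⟨(hs x).1 hx.1, hx.2⟩, rfl⟩
      · rintro ⟨x, hx, rfl⟩; exact ⟨toLex x, ⟨(hs _).2 hx.1, hx.2⟩, rfl⟩
    have e1 : (MvPolynomial.homogeneousSubmodule ι K k).map (Ψ k) = Submodule.span K ((fun x => v k (ofLex x)) '' (s : Set _)) := by
      apply le_antisymm
      · rintro _ ⟨p, hp, rfl⟩
        rw [mon_exp p, map_sum]
        refine Submodule.sum_mem _ fun x hx => ?_
        rw [map_smul]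
        refine Submodule.smul_mem _ _ (Submodule.subset_span ⟨toLex x, (hs _).2 ?_, rfl⟩)
        by_contra h'
        exact MvPolynomial.mem_support_iff.1 hx (MvPolynomial.IsHomogeneous.coeff_eq_zero hp h')
      · rw [Submodule.span_le]
        rintro _ ⟨x, hx, rfl⟩
        exact ⟨_, MvPolynomial.isHomogeneous_monomial _ ((hs _).1 hx), rfl⟩
    rw [e1, ← h, ← Set.ncard_coe_finset]
    refine Set.ncard_congr (fun m _ => toLex m) ?_ ?_ ?_
    · rintro m ⟨hm, rfl⟩
      rw [Finset.mem_coe, Finset.mem_filter, hs, himg]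
      exact ⟨rfl, hm⟩
    · grind
    · intro x hx
      rw [Finset.mem_coe, Finset.mem_filter, hs, ← toLex_ofLex x, himg] at hx
      obtain ⟨h1, h2⟩ := hx
      rw [ofLex_toLex] at h1 h2
      subst h1
      exact ⟨ofLex x, ⟨h2, rfl⟩, rfl⟩

theorem std_ideal {ι K : Type} [Fintype ι] [Field K] (Q : ℕ → Type) [∀ k, AddCommGroup (Q k)] [∀ k, Module K (Q k)]
    (Ψ : ∀ k, MvPolynomial ι K →ₗ[K] Q k)
    (hc : ∀ k p i, p.IsHomogeneous k → Ψ k p = 0 → Ψ (k + 1) (MvPolynomial.X i * p) = 0) :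
    ∃ Γ : Set (ι →₀ ℕ), (∀ m ∈ Γ, ∀ m' ≤ m, m' ∈ Γ) ∧
      ∀ k, Set.ncard {m | m ∈ Γ ∧ m.degree = k} =
        Module.finrank K ((MvPolynomial.homogeneousSubmodule ι K k).map (Ψ k)) :=
  @std_ideal' ι K _ (LinearOrder.lift' (Fintype.equivFin ι) (Fintype.equivFin ι).injective) _ Q _ _ Ψ hc

namespace CD
variable {d : ℕ} {ι K : Type} [Fintype ι] [Field K] (C : CD d ι K)

abbrev TT (k : ℕ) := {F : Finset ι // F ∈ C.s.fac ∧ (C.s.R F).card = k}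

noncomputable def Phi (k : ℕ) : MvPolynomial ι K →ₗ[K] (C.TT k → K) :=
  LinearMap.pi fun F => C.psi ∘ₗ LinearMap.mulRight K (MvPolynomial.monomial (chi (F.1 \ C.s.R F.1)) 1)

lemma Phi_apply (k : ℕ) (p) (F : C.TT k) : C.Phi k p F = C.psi (p * MvPolynomial.monomial (chi (F.1 \ C.s.R F.1)) 1) := rfl

def NN (k : ℕ) (p : MvPolynomial ι K) : Prop :=
  ∀ w : ι →₀ ℕ, w.degree + k = d → C.psi (p * MvPolynomial.monomial w 1) = 0

lemma NN_X {k : ℕ} {p} (h : C.NN k p) (i : ι) : C.NN (k + 1) (MvPolynomial.X i * p) := by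
  intro w hw
  rw [mul_comm _ p, mul_assoc, X_mon]
  exact h _ (by rw [map_add, Finsupp.degree_single]; omega)

lemma NN_lin {k : ℕ} {p} (h : C.NN k p) (c : ι → K) : C.NN (k + 1) (lin c * p) := by
  intro w hw
  rw [mul_assoc, lin_mul]
  exact Finset.sum_eq_zero fun i _ => by rw [← mul_assoc, C.NN_X h i w hw, mul_zero]

lemma Phi_iff {k : ℕ} (hk : k ≤ d) {p : MvPolynomial ι K} (hp : p.IsHomogeneous k) : C.Phi k p = 0 ↔ C.NN k p := by
  constructor
  · intro h w hw
    refine C.span_shell C.s.rev rfl (lm C.psi p) (d - k) ?_ ?_ ?_ w (by omega)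
    · intro m _ hm
      rw [lm_apply]
      conv_lhs => rw [mon_exp p]
      rw [Finset.sum_mul, map_sum]
      refine Finset.sum_eq_zero fun v _ => ?_
      rw [smul_mul_assoc, map_smul, MvPolynomial.monomial_mul, one_mul, C.psi_off, smul_zero]
      intro F hF hs
      refine hm F hF fun i hi => hs ?_
      rw [Finsupp.mem_support_iff] at hi ⊢
      rw [Finsupp.add_apply]; omega
    · intro r m hm
      rw [lm_apply, mul_left_comm, psi_theta, mul_comm p]
      rw [hom_zero (fun m' hm' => ?_) hp, mul_zero]
      rw [MvPolynomial.monomial_mul, one_mul, C.psi_zero _ (by rw [map_add]; omega)]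
    · intro F hF hR
      have hsub := C.s.sub F hF
      have hRk : (C.s.R F).card = k := by
        have h1 : (F \ C.s.R F).card = d - k := hR
        rw [Finset.card_sdiff_of_subset hsub, C.s.card F hF] at h1
        have := Finset.card_le_card hsub
        rw [C.s.card F hF] at this
        omega
      exact congrFun h ⟨F, hF, hRk⟩
  · intro h
    funext F
    rw [Phi_apply]
    refine h _ ?_
    rw [chi_degree, Finset.card_sdiff_of_subset (C.s.sub _ F.2.1), C.s.card _ F.2.1, F.2.2]; omega

lemma chi_add {R F : Finset ι} (h : R ⊆ F) : chi R + chi (F \ R) = chi F := by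
  ext i
  simp only [Finsupp.add_apply, chi_apply, Finset.mem_sdiff]
  grind

lemma Phi_surj (k : ℕ) : (MvPolynomial.homogeneousSubmodule ι K k).map (C.Phi k) = ⊤ := by
  have tri : ∀ F F' : C.TT k, F ≠ F' → C.s.rk F'.1 ≤ C.s.rk F.1 →
      C.Phi k (MvPolynomial.monomial (chi (C.s.R F'.1)) 1) F = 0 := by
    intro F F' hne hrk
    rw [Phi_apply, MvPolynomial.monomial_mul, one_mul]
    refine C.psi_off _ fun G hG hs => ?_
    have hR : C.s.R F'.1 ⊆ G := fun i hi => hs (by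
      rw [Finsupp.mem_support_iff, Finsupp.add_apply, chi_apply, if_pos hi]; omega)
    have hR' : F.1 \ C.s.R F.1 ⊆ G := fun i hi => hs (by
      rw [Finsupp.mem_support_iff, Finsupp.add_apply, chi_apply (F.1 \ _), if_pos hi]; omega)
    by_cases h1 : G = F'.1
    · have := C.s.h2 _ F.2.1 _ hG (by rw [h1]; grind) hR'
      grind
    · have h3 := C.s.h1 _ F'.2.1 _ hG h1 hR
      by_cases h2 : G = F.1
      · grind
      · have := C.s.h2 _ F.2.1 _ hG h2 hR'
        linarith
  have li : LinearIndependent K fun F : C.TT k => C.Phi k (MvPolynomial.monomial (chi (C.s.R F.1)) 1) := by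
    rw [Fintype.linearIndependent_iff]
    intro g hg
    by_contra hcon
    push Not at hcon
    obtain ⟨F0, h0⟩ := hcon
    obtain ⟨F, hF, hmax⟩ := Finset.exists_max_image (Finset.univ.filter fun F => g F ≠ 0) (fun F : C.TT k => C.s.rk F.1)
      ⟨F0, by simp [h0]⟩
    rw [Finset.mem_filter] at hF
    have h1 := congrFun hg F
    rw [Finset.sum_apply, Finset.sum_eq_single F] at h1
    · rw [Pi.smul_apply, Phi_apply, MvPolynomial.monomial_mul, one_mul, chi_add (C.s.sub _ F.2.1)] at h1
      exact (mul_ne_zero hF.2 (C.psi_fac F.2.1)) h1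
    · intro F' _ hne
      rw [Pi.smul_apply]
      by_cases hgF : g F' = 0
      · rw [hgF, zero_smul]
      · rw [tri F F' hne.symm (hmax F' (by simp [hgF])), smul_zero]
    · simp
  rw [eq_top_iff, ← li.span_eq_top_of_card_eq_finrank' (by simp), Submodule.span_le]
  rintro _ ⟨F, rfl⟩
  exact ⟨_, MvPolynomial.isHomogeneous_monomial _ (by rw [chi_degree, F.2.2]), rfl⟩

noncomputable def WW : ∀ k, Submodule K (C.TT k → K)
  | 0 => ⊥
  | k + 1 => (MvPolynomial.homogeneousSubmodule ι K k).map (lm (C.Phi (k + 1)) (lin C.t))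

lemma lin_hom (c : ι → K) : (lin c : MvPolynomial ι K).IsHomogeneous 1 :=
  MvPolynomial.IsHomogeneous.sum _ _ _ fun i _ => by
    rw [MvPolynomial.smul_eq_C_mul]; exact MvPolynomial.isHomogeneous_C_mul_X _ _

lemma lin_iff {k : ℕ} (hk : 2 * (k + 1) ≤ d) {p : MvPolynomial ι K} (hp : p.IsHomogeneous k) :
    C.Phi (k + 1) (lin C.t * p) = 0 ↔ C.Phi k p = 0 := by
  have h1 : (lin C.t * p).IsHomogeneous (k + 1) := by rw [add_comm]; exact (lin_hom _).mul hp
  rw [C.Phi_iff (by omega) h1, C.Phi_iff (by omega) hp]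
  exact ⟨fun h => C.lefschetz p k (by omega) hp fun w hw => h w (by omega), fun h => C.NN_lin h _⟩

lemma finrank_map {M : Type*} [AddCommGroup M] [Module K M] (k : ℕ) (L : MvPolynomial ι K →ₗ[K] M) :
    Module.finrank K ((MvPolynomial.homogeneousSubmodule ι K k).map L) +
    Module.finrank K (LinearMap.ker (L.domRestrict (MvPolynomial.homogeneousSubmodule ι K k))) =
    Module.finrank K (MvPolynomial.homogeneousSubmodule ι K k) := by
  have : Module.Finite K (MvPolynomial.homogeneousSubmodule ι K k) :=
    Module.Finite.iff_fg.2 (MvPolynomial.homogeneousSubmodule_fg _ _ _)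
  have := LinearMap.finrank_range_add_finrank_ker (L.domRestrict (MvPolynomial.homogeneousSubmodule ι K k))
  rwa [LinearMap.range_domRestrict] at this

lemma finrank_WW {k : ℕ} (hk : 2 * (k + 1) ≤ d) : Module.finrank K (C.WW (k + 1)) = Fintype.card (C.TT k) := by
  have h1 := finrank_map k (lm (C.Phi (k + 1)) (lin C.t))
  have h2 := finrank_map k (C.Phi k)
  have e : LinearMap.ker ((lm (C.Phi (k + 1)) (lin C.t)).domRestrict (MvPolynomial.homogeneousSubmodule ι K k)) =
      LinearMap.ker ((C.Phi k).domRestrict (MvPolynomial.homogeneousSubmodule ι K k)) := by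
    ext p
    rw [LinearMap.mem_ker, LinearMap.mem_ker, LinearMap.domRestrict_apply, LinearMap.domRestrict_apply, lm_apply]
    exact C.lin_iff hk p.2
  rw [e] at h1
  rw [Phi_surj, finrank_top, Module.finrank_fintype_fun_eq_card] at h2
  rw [WW]
  omega

theorem order_ideal : ∃ Γ : Set (ι →₀ ℕ), (∀ m ∈ Γ, ∀ m' ≤ m, m' ∈ Γ) ∧
    Set.ncard {m | m ∈ Γ ∧ m.degree = 0} = (C.s.fac.filter fun F => (C.s.R F).card = 0).card ∧
    (∀ k, 2 * (k + 1) ≤ d → Set.ncard {m | m ∈ Γ ∧ m.degree = k + 1} + (C.s.fac.filter fun F => (C.s.R F).card = k).card =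
      (C.s.fac.filter fun F => (C.s.R F).card = k + 1).card) ∧
    ∀ k, d < 2 * k → Set.ncard {m | m ∈ Γ ∧ m.degree = k} = 0 := by
  let Ψ : ∀ k, MvPolynomial ι K →ₗ[K] (C.TT k → K) ⧸ C.WW k := fun k =>
    if 2 * k ≤ d then (C.WW k).mkQ ∘ₗ C.Phi k else 0
  have hΨ : ∀ k, 2 * k ≤ d → Ψ k = (C.WW k).mkQ ∘ₗ C.Phi k := fun k hk => if_pos hk
  have hΨ' : ∀ k, ¬ 2 * k ≤ d → Ψ k = 0 := fun k hk => if_neg hk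
  have hT : ∀ k, Fintype.card (C.TT k) = (C.s.fac.filter fun F => (C.s.R F).card = k).card := by
    intro k; rw [Fintype.card_subtype]; congr 1; ext F; simp
  have hdim : ∀ k, 2 * k ≤ d → Module.finrank K ((MvPolynomial.homogeneousSubmodule ι K k).map (Ψ k)) +
      Module.finrank K (C.WW k) = Fintype.card (C.TT k) := by
    intro k hk
    rw [hΨ k hk, Submodule.map_comp, Phi_surj, Submodule.map_top, Submodule.range_mkQ, finrank_top,
      Submodule.finrank_quotient_add_finrank, Module.finrank_fintype_fun_eq_card]
  obtain ⟨Γ, hΓ, hΓ'⟩ := std_ideal (K := K) (fun k => (C.TT k → K) ⧸ C.WW k) Ψ (by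
    intro k p i hp h
    by_cases hk : 2 * (k + 1) ≤ d
    swap
    · rw [hΨ' _ hk, LinearMap.zero_apply]
    rw [hΨ _ (by omega), LinearMap.comp_apply, Submodule.mkQ_apply, Submodule.Quotient.mk_eq_zero] at h ⊢
    match k, hk, hp, h with
    | 0, hk, hp, h =>
      rw [WW, Submodule.mem_bot, C.Phi_iff (by omega) hp] at h
      have h1 : (MvPolynomial.X i * p).IsHomogeneous (0 + 1) := by rw [add_comm]; exact (MvPolynomial.isHomogeneous_X _ _).mul hp
      rw [(C.Phi_iff (by omega) h1).2 (C.NN_X h i)]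
      exact Submodule.zero_mem _
    | k + 1, hk, hp, h =>
      obtain ⟨q, hq, hqp⟩ := h
      have hℓq : (lin C.t * q).IsHomogeneous (k + 1) := by rw [add_comm]; exact (lin_hom _).mul hq
      have h2 : C.Phi (k + 1) (p - lin C.t * q) = 0 := by rw [map_sub, ← hqp, lm_apply, sub_self]
      have h3 : (p - lin C.t * q).IsHomogeneous (k + 1) := hp.sub hℓq
      have h4 := C.NN_X ((C.Phi_iff (by omega) h3).1 h2) i
      have h5 : (MvPolynomial.X i * (p - lin C.t * q)).IsHomogeneous (k + 1 + 1) := by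
        rw [add_comm]; exact (MvPolynomial.isHomogeneous_X _ _).mul h3
      have h6 := (C.Phi_iff (by omega) h5).2 h4
      rw [mul_sub, map_sub, sub_eq_zero] at h6
      rw [h6]
      refine ⟨MvPolynomial.X i * q, ?_, ?_⟩
      · rw [add_comm]; exact (MvPolynomial.isHomogeneous_X K i).mul hq
      · rw [lm_apply, mul_left_comm])
  refine ⟨Γ, hΓ, ?_, ?_, ?_⟩
  · have := hdim 0 (by omega)
    have e0 : Module.finrank K (C.WW 0) = 0 := finrank_bot _ _
    rw [hΓ', ← hT, ← this, e0, add_zero]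
  · intro k hk
    rw [hΓ', ← hT, ← hT, ← C.finrank_WW hk]; grind
  · intro k hk
    rw [hΓ', hΨ' k (by omega), Submodule.map_zero, finrank_bot]
end CD

theorem SD.order_ideal {d : ℕ} {ι E : Type} [Fintype ι] [AddCommGroup E] [Module ℝ E] (s : SD d ι E) :
    ∃ Γ : Set (ι →₀ ℕ), (∀ m ∈ Γ, ∀ m' ≤ m, m' ∈ Γ) ∧
    (∀ k, 2 * k ≤ d → (Set.ncard {m | m ∈ Γ ∧ m.degree = k} : ℚ) =
      (Hp d s.fac).coeff k - if k = 0 then 0 else (Hp d s.fac).coeff (k - 1)) ∧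
    ∀ k, d < 2 * k → Set.ncard {m | m ∈ Γ ∧ m.degree = k} = 0 := by
  obtain ⟨v, hv⟩ := s.exists_generic
  obtain ⟨K, _, a, a0, t, D, Dt, h2, hD, hD0, hDta, hDta0, hDtt, gen⟩ := exists_field d ι
  have hen : ∀ F : Finset ι, ∃ e : Fin d → ι, F ∈ s.fac → Function.Injective e ∧ ∀ i, i ∈ F ↔ ∃ k, e k = i := by
    intro F
    by_cases hF : F ∈ s.fac
    · let e := Finset.equivFinOfCardEq (s.card F hF)
      refine ⟨fun k => e.symm k, fun _ => ⟨fun k k' h => e.symm.injective (Subtype.ext h), fun i => ⟨fun hi => ⟨e ⟨i, hi⟩, by simp⟩, ?_⟩⟩⟩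
      grind
    · obtain ⟨F, hF'⟩ := s.ne
      let e := Finset.equivFinOfCardEq (s.card F hF')
      exact ⟨fun k => e.symm k, fun h => absurd h hF⟩
  choose en hen using hen
  let C : CD d ι K := ⟨s.shell v hv, s.even, a, a0, t, D, Dt, h2, hD, hD0, hDta, hDta0, hDtt, gen, en,
    fun F hF => (hen F hF).1, fun F hF => (hen F hF).2⟩
  obtain ⟨Γ, h1, h2, h3, h4⟩ := C.order_ideal
  have hc : ∀ k, (Hp d s.fac).coeff k = (C.s.fac.filter fun F => (C.s.R F).card = k).card := fun k => C.s.coeff_hp k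
  refine ⟨Γ, h1, fun k hk => ?_, h4⟩
  match k with
  | 0 => rw [h2, hc]; simp
  | k + 1 => simp only [hc, if_neg (Nat.succ_ne_zero k), Nat.add_sub_cancel]; rw [← h3 k hk]; push_cast; ring

noncomputable def gr {A M : Type} [AddCommGroup A] [Module ℝ A] (c : A →ₗ[ℝ] (M → ℝ)) (deg : M → ℕ) (k : ℕ) : Submodule ℝ A where
  carrier := {a | ∀ m, deg m ≠ k → c a m = 0}
  add_mem' ha hb m hm := by rw [map_add, Pi.add_apply, ha m hm, hb m hm, add_zero]
  zero_mem' m _ := by rw [map_zero]; rfl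
  smul_mem' r a ha m hm := by rw [map_smul, Pi.smul_apply, ha m hm, smul_zero]

lemma gr_decomp {A M : Type} [Fintype M] [AddCommGroup A] [Module ℝ A] (c : A ≃ₗ[ℝ] (M → ℝ)) (deg : M → ℕ) :
    Nonempty (DirectSum.Decomposition (gr c.toLinearMap deg)) ∧
    ∀ k, Module.finrank ℝ (gr c.toLinearMap deg k) = Fintype.card {m // deg m = k} := by
  let q : ℕ → (M → ℝ) →ₗ[ℝ] (M → ℝ) := fun k => LinearMap.pi fun m => if deg m = k then LinearMap.proj m else 0
  have hq : ∀ k f m, q k f m = if deg m = k then f m else 0 := by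
    intro k f m; simp only [q, LinearMap.pi_apply]; split_ifs <;> rfl
  let p : ∀ k, A →ₗ[ℝ] gr c.toLinearMap deg k := fun k =>
    LinearMap.codRestrict _ (c.symm.toLinearMap ∘ₗ q k ∘ₗ c.toLinearMap) fun a m hm => by simp [hq, hm]
  have hp : ∀ k a m, c (p k a) m = if deg m = k then c a m else 0 := by
    intro k a m
    rw [← hq, show (p k a : A) = c.symm (q k (c a)) from rfl, c.apply_symm_apply]
  constructor
  · obtain ⟨N, hN⟩ : ∃ N, ∀ m, deg m < N := ⟨Finset.univ.sup deg + 1, fun m => Nat.lt_succ_of_le (Finset.le_sup (Finset.mem_univ m))⟩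
    refine ⟨DirectSum.Decomposition.ofLinearMap _ (∑ k ∈ Finset.range N, DirectSum.lof ℝ ℕ (fun k => gr c.toLinearMap deg k) k ∘ₗ p k) ?_ ?_⟩
    · ext a
      apply c.injective
      ext m
      simp only [LinearMap.comp_apply, LinearMap.sum_apply, map_sum, DirectSum.coeLinearMap_lof, Finset.sum_apply, hp, LinearMap.id_apply]
      rw [Finset.sum_ite_eq, if_pos (Finset.mem_range.2 (hN m))]
    · refine DirectSum.linearMap_ext _ fun k => LinearMap.ext fun x => ?_
      simp only [LinearMap.comp_apply, LinearMap.sum_apply, DirectSum.coeLinearMap_lof, LinearMap.id_apply]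
      have h0 : ∀ j, j ≠ k → p j x = 0 := by
        intro j hj
        apply Subtype.ext; apply c.injective; ext m
        rw [hp]
        split_ifs with h
        · exact (x.2 m (h ▸ hj)).trans (by simp)
        · simp
      have h1 : p k x = x := by
        apply Subtype.ext; apply c.injective; ext m
        rw [hp]
        split_ifs with h
        · rfl
        · exact (x.2 m h).symm
      rw [Finset.sum_eq_single k]
      · rw [h1]
      · grind
      · intro hk
        have : x = 0 := by
          apply Subtype.ext; apply c.injective; ext m
          exact (x.2 m fun h => hk (Finset.mem_range.2 (h ▸ hN m))).trans (by simp)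
        grind
  · intro k
    let L : gr c.toLinearMap deg k →ₗ[ℝ] ({m // deg m = k} → ℝ) := LinearMap.pi fun m => LinearMap.proj m.1 ∘ₗ c.toLinearMap ∘ₗ Submodule.subtype _
    have hL : Function.Bijective L := by
      constructor
      · rw [injective_iff_map_eq_zero]
        intro a ha
        apply Subtype.ext; apply c.injective; ext m
        by_cases h : deg m = k
        · exact (congrFun ha ⟨m, h⟩).trans (by simp)
        · exact (a.2 m h).trans (by simp)
      · intro f
        refine ⟨⟨c.symm fun m => if h : deg m = k then f ⟨m, h⟩ else 0, fun m hm => by simp [hm]⟩, ?_⟩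
        ext m
        simp [L, m.2]
    rw [(LinearEquiv.ofBijective L hL).finrank_eq, Module.finrank_fintype_fun_eq_card]

theorem alg_of_ideal {ι : Type} [Fintype ι] (Γ : Set (ι →₀ ℕ)) (hΓ : ∀ m ∈ Γ, ∀ m' ≤ m, m' ∈ Γ)
    (N : ℕ) (hN : ∀ m ∈ Γ, m.degree ≤ N) :
    ∃ (A : Type) (_ : CommRing A) (_ : Algebra ℝ A) (𝒜 : ℕ → Submodule ℝ A) (_ : GradedAlgebra 𝒜),
      FiniteDimensional ℝ A ∧ Algebra.adjoin ℝ ((𝒜 1 : Submodule ℝ A) : Set A) = ⊤ ∧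
      ∀ k, Module.finrank ℝ (𝒜 k) = Set.ncard {m | m ∈ Γ ∧ m.degree = k} := by
  have hfin : Γ.Finite := by
    refine Set.Finite.subset ((Set.finite_le_nat N).biUnion fun k _ => (Finset.finsuppAntidiag Finset.univ k).finite_toSet) fun m hm => ?_
    rw [Set.mem_iUnion₂]
    refine ⟨m.degree, hN m hm, ?_⟩
    simp [Finsupp.degree_eq_sum]
  haveI := hfin.fintype
  let I : Ideal (MvPolynomial ι ℝ) :=
    { carrier := {p | ∀ m ∈ Γ, p.coeff m = 0}
      add_mem' := fun ha hb m hm => by rw [MvPolynomial.coeff_add, ha m hm, hb m hm, add_zero]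
      zero_mem' := fun m _ => MvPolynomial.coeff_zero m
      smul_mem' := fun r a ha m hm => by
        rw [smul_eq_mul, MvPolynomial.coeff_mul]
        refine Finset.sum_eq_zero fun x hx => ?_
        rw [Finset.HasAntidiagonal.mem_antidiagonal] at hx
        rw [ha _ (hΓ m hm x.2 (hx ▸ le_add_self)), mul_zero] }
  let c0 : MvPolynomial ι ℝ →ₗ[ℝ] (Γ → ℝ) := LinearMap.pi fun m => MvPolynomial.lcoeff ℝ m.1
  let c1 : (MvPolynomial ι ℝ ⧸ I) →ₗ[ℝ] (Γ → ℝ) :=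
    (Submodule.liftQ (I.restrictScalars ℝ) c0 fun p hp => LinearMap.mem_ker.2 (funext fun m => hp m.1 m.2)) ∘ₗ
      (Submodule.Quotient.restrictScalarsEquiv ℝ I).symm.toLinearMap
  have hc1 : ∀ p m, c1 (Ideal.Quotient.mk I p) m = p.coeff m.1 := fun p m => rfl
  have hb : Function.Bijective c1 := by
    constructor
    · rw [injective_iff_map_eq_zero]
      intro a ha
      obtain ⟨p, rfl⟩ := Ideal.Quotient.mk_surjective a
      exact Ideal.Quotient.eq_zero_iff_mem.2 fun m hm => congrFun ha ⟨m, hm⟩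
    · intro f
      refine ⟨Ideal.Quotient.mk I (∑ m : Γ, MvPolynomial.monomial m.1 (f m)), ?_⟩
      ext m
      rw [hc1, MvPolynomial.coeff_sum, Finset.sum_eq_single m]
      · simp
      · intro m' _ hne
        rw [MvPolynomial.coeff_monomial, if_neg fun h => hne (Subtype.ext h)]
      · simp
  let c := LinearEquiv.ofBijective c1 hb
  have hc : ∀ p m, c (Ideal.Quotient.mk I p) m = p.coeff m.1 := fun p m => rfl
  obtain ⟨⟨dec⟩, hfr⟩ := gr_decomp c fun m => m.1.degree
  let 𝒜 := gr c.toLinearMap fun m => m.1.degree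
  have h𝒜 : ∀ k p, Ideal.Quotient.mk I p ∈ 𝒜 k ↔ ∀ m : Γ, m.1.degree ≠ k → p.coeff m.1 = 0 := fun k p => Iff.rfl
  haveI : SetLike.GradedMonoid 𝒜 :=
    { one_mem := by
        rw [← map_one (Ideal.Quotient.mk I), h𝒜]
        intro m hm
        rw [MvPolynomial.coeff_one, if_neg]
        grind
      mul_mem := by
        intro i j a b ha hb
        obtain ⟨p, rfl⟩ := Ideal.Quotient.mk_surjective a
        obtain ⟨q, rfl⟩ := Ideal.Quotient.mk_surjective b
        rw [h𝒜] at ha hb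
        rw [← map_mul, h𝒜]
        intro m hm
        rw [MvPolynomial.coeff_mul]
        refine Finset.sum_eq_zero fun x hx => ?_
        rw [Finset.HasAntidiagonal.mem_antidiagonal] at hx
        by_cases h1 : x.1.degree = i
        · rw [hb ⟨x.2, hΓ m.1 m.2 x.2 (hx ▸ le_add_self)⟩ ?_, mul_zero]
          grind
        · rw [ha ⟨x.1, hΓ m.1 m.2 x.1 (hx ▸ le_self_add)⟩ h1, zero_mul] }
  refine ⟨MvPolynomial ι ℝ ⧸ I, inferInstance, inferInstance, 𝒜, { toDecomposition := dec }, ?_, ?_, ?_⟩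
  · exact Module.Finite.equiv c.symm
  · rw [eq_top_iff, ← (AlgHom.range_eq_top (Ideal.Quotient.mkₐ ℝ I)).2 (Ideal.Quotient.mkₐ_surjective ℝ I), ← Algebra.map_top,
      ← MvPolynomial.adjoin_range_X, AlgHom.map_adjoin]
    refine Algebra.adjoin_mono ?_
    rintro _ ⟨_, ⟨i, rfl⟩, rfl⟩
    refine (h𝒜 1 _).2 fun m hm => ?_
    rw [MvPolynomial.coeff_X, if_neg]
    intro h; exact hm (by rw [← h]; simp)
  · intro k
    rw [hfr, ← Nat.card_eq_fintype_card, ← Nat.card_coe_set_eq]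
    exact Nat.card_congr (Equiv.subtypeSubtypeEquivSubtypeInter (· ∈ Γ) fun m => m.degree = k)

theorem ideal_of_alg {A : Type} [CommRing A] [Algebra ℝ A] (𝒜 : ℕ → Submodule ℝ A) [GradedAlgebra 𝒜]
    [FiniteDimensional ℝ A] (hA : Algebra.adjoin ℝ ((𝒜 1 : Submodule ℝ A) : Set A) = ⊤) :
    ∃ Γ : Set (Fin (Module.finrank ℝ (𝒜 1)) →₀ ℕ), (∀ m ∈ Γ, ∀ m' ≤ m, m' ∈ Γ) ∧
      ∀ k, Set.ncard {m | m ∈ Γ ∧ m.degree = k} = Module.finrank ℝ (𝒜 k) := by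
  let b := Module.finBasis ℝ (𝒜 1)
  let φ : MvPolynomial (Fin (Module.finrank ℝ (𝒜 1))) ℝ →ₐ[ℝ] A := MvPolynomial.aeval fun i => (b i : A)
  obtain ⟨Γ, h1, h2⟩ := std_ideal (fun _ => A) (fun _ => φ.toLinearMap) (by
    intro k p i _ h
    simp only [AlgHom.toLinearMap_apply] at h ⊢
    grind)
  refine ⟨Γ, h1, fun k => ?_⟩
  rw [h2]
  have hs : Function.Surjective φ := by
    rw [← AlgHom.range_eq_top, eq_top_iff, ← hA]
    refine Algebra.adjoin_le fun a ha => ?_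
    have : a = ((∑ i, b.repr ⟨a, ha⟩ i • b i : 𝒜 1) : A) := by rw [b.sum_repr]
    rw [this]
    simp only [Submodule.coe_sum, Submodule.coe_smul]
    refine Subalgebra.sum_mem _ fun i _ => Subalgebra.smul_mem _ ?_ _
    exact (AlgHom.mem_range φ).2 ⟨MvPolynomial.X i, by simp [φ]⟩
  have hm : ∀ k p, MvPolynomial.IsHomogeneous p k → φ p ∈ 𝒜 k := by
    intro k p hp
    rw [p.as_sum, map_sum]
    refine Submodule.sum_mem _ fun m hm => ?_
    have hd := hp (MvPolynomial.mem_support_iff.1 hm)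
    rw [MvPolynomial.aeval_monomial, ← Algebra.smul_def]
    refine Submodule.smul_mem _ _ ?_
    rw [Pi.one_def, ← Finsupp.degree_eq_weight_one] at hd
    subst hd
    rw [Finsupp.prod, Finsupp.degree_apply]
    refine SetLike.prod_mem_graded _ _ _ fun i _ => ?_
    have := SetLike.pow_mem_graded (A := 𝒜) (m i) (b i).2
    grind
  have e : (MvPolynomial.homogeneousSubmodule _ ℝ k).map φ.toLinearMap = 𝒜 k := by
    apply le_antisymm
    · rintro _ ⟨p, hp, rfl⟩; exact hm k p hp
    · intro a ha
      obtain ⟨p, rfl⟩ := hs a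
      refine ⟨MvPolynomial.homogeneousComponent k p, MvPolynomial.homogeneousComponent_isHomogeneous k p, ?_⟩
      have h3 : φ p = ∑ i ∈ Finset.range (p.totalDegree + 1), φ (MvPolynomial.homogeneousComponent i p) := by
        rw [← map_sum, MvPolynomial.sum_homogeneousComponent]
      rw [AlgHom.toLinearMap_apply]
      rw [← DirectSum.decompose_of_mem_same 𝒜 ha]
      conv_rhs => rw [h3]
      rw [DirectSum.decompose_sum, DFinsupp.finsetSum_apply, Submodule.coe_sum]
      rw [Finset.sum_eq_single k]
      · rw [DirectSum.decompose_of_mem_same]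
        exact hm _ _ (MvPolynomial.homogeneousComponent_isHomogeneous k p)
      · intro j _ hj
        exact DirectSum.decompose_of_mem_ne 𝒜 (hm _ _ (MvPolynomial.homogeneousComponent_isHomogeneous j p)) hj
      · intro hk
        rw [MvPolynomial.homogeneousComponent_eq_zero _ _ (by grind), map_zero]
        simp
  rw [e]

lemma count_le' (p : ℕ → Prop) (n : ℕ) : Nat.count p n ≤ n := by
  rw [Nat.count_eq_card_filter_range]; grind

section comp
variable {ι : Type} [DecidableEq ι] (i j : ι)

noncomputable def ln (u : ι → ℕ) (t : ℕ) : ι → ℕ := Function.update (Function.update u j t) i (u i + u j - t)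

def pr (A : Finset (ι → ℕ)) (u : ι → ℕ) (t : ℕ) : Prop := t ≤ u i + u j ∧ ln i j u t ∈ A

noncomputable def cmpr (A : Finset (ι → ℕ)) : Finset (ι → ℕ) :=
  (A.biUnion fun v => (Finset.range (v i + v j + 1)).image (ln i j v)).filter
    fun u => u j < Nat.count (pr i j A u) (u i + u j + 1)

variable {i j} (hij : i ≠ j)

lemma ln_i (u : ι → ℕ) (t : ℕ) : ln i j u t i = u i + u j - t := by simp [ln]
lemma ln_j (hij : i ≠ j) (u : ι → ℕ) (t : ℕ) : ln i j u t j = t := by simp [ln, hij.symm]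
lemma ln_l (u : ι → ℕ) (t : ℕ) {l : ι} (h : l ≠ i) (h' : l ≠ j) : ln i j u t l = u l := by simp [ln, h, h']

lemma ln_ln (hij : i ≠ j) (u : ι → ℕ) {t : ℕ} (ht : t ≤ u i + u j) (t' : ℕ) : ln i j (ln i j u t) t' = ln i j u t' := by
  ext l
  by_cases h : l = i
  · subst h; rw [ln_i, ln_i, ln_i, ln_j hij]; omega
  by_cases h' : l = j
  · subst h'; rw [ln_j hij, ln_j hij]
  · rw [ln_l _ _ h h', ln_l _ _ h h', ln_l _ _ h h']

lemma ln_self (hij : i ≠ j) (u : ι → ℕ) : ln i j u (u j) = u := by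
  ext l
  by_cases h : l = i
  · subst h; rw [ln_i]; omega
  by_cases h' : l = j
  · subst h'; rw [ln_j hij]
  · rw [ln_l _ _ h h']

lemma pr_ln (hij : i ≠ j) (A : Finset (ι → ℕ)) (u : ι → ℕ) {t : ℕ} (ht : t ≤ u i + u j) : pr i j A (ln i j u t) = pr i j A u := by
  ext t'
  unfold pr
  rw [ln_ln hij u ht, ln_i, ln_j hij, Nat.sub_add_cancel ht]

lemma mem_cmpr (hij : i ≠ j) (A : Finset (ι → ℕ)) (u : ι → ℕ) :
    u ∈ cmpr i j A ↔ u j < Nat.count (pr i j A u) (u i + u j + 1) := by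
  unfold cmpr
  rw [Finset.mem_filter, and_iff_right_iff_imp]
  intro h
  rw [Nat.count_eq_card_filter_range] at h
  obtain ⟨t, ht⟩ := Finset.card_pos.1 (lt_of_le_of_lt (Nat.zero_le _) h)
  rw [Finset.mem_filter] at ht
  rw [Finset.mem_biUnion]
  refine ⟨_, ht.2.2, Finset.mem_image.2 ⟨u j, ?_, ?_⟩⟩
  · rw [Finset.mem_range, ln_i, ln_j hij]; have := ht.2.1; omega
  · rw [ln_ln hij u ht.2.1, ln_self hij]

lemma cmp_bij (hij : i ≠ j) (A : Finset (ι → ℕ)) :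
    (∀ u ∈ A, ln i j u (Nat.count (pr i j A u) (u j)) ∈ cmpr i j A) ∧ (cmpr i j A).card = A.card := by
  have h1 : ∀ u ∈ A, pr i j A u (u j) := fun u hu => ⟨by omega, by rwa [ln_self hij]⟩
  have h2 : ∀ u, Nat.count (pr i j A u) (u j) ≤ u i + u j := fun u => (count_le' _ _).trans (by omega)
  have h3 : ∀ u ∈ A, ln i j u (Nat.count (pr i j A u) (u j)) ∈ cmpr i j A := by
    intro u hu
    rw [mem_cmpr hij, pr_ln hij A u (h2 u), ln_i, ln_j hij, Nat.sub_add_cancel (h2 u)]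
    exact Nat.count_strict_mono (h1 u hu) (by omega)
  have h4 : ∀ u ∈ cmpr i j A, pr i j A u (Nat.nth (pr i j A u) (u j)) ∧ Nat.count (pr i j A u) (Nat.nth (pr i j A u) (u j)) = u j := by
    intro u hu
    rw [mem_cmpr hij] at hu
    have h5 : ∀ hf : (Set.ofPred (pr i j A u)).Finite, u j < hf.toFinset.card := fun hf =>
      hu.trans_le (Nat.count_le_card hf _)
    exact ⟨Nat.nth_mem _ h5, Nat.count_nth h5⟩
  refine ⟨h3, (Finset.card_nbij' (fun u => ln i j u (Nat.count (pr i j A u) (u j)))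
    (fun u => ln i j u (Nat.nth (pr i j A u) (u j))) h3 (fun u hu => (h4 u hu).1.2) ?_ ?_).symm⟩
  · intro u hu
    dsimp only
    rw [pr_ln hij A u (h2 u), ln_ln hij u (h2 u), ln_j hij, Nat.nth_count (h1 u hu), ln_self hij]
  · intro u hu
    dsimp only
    rw [pr_ln hij A u (h4 u hu).1.1, ln_ln hij u (h4 u hu).1.1, ln_j hij, (h4 u hu).2, ln_self hij]

lemma shadow_seg (T : ℕ) (p q : ℕ → Prop) (h1 : ∀ t ≤ T, p t → q t) (h2 : ∀ t ≤ T, p (t + 1) → q t) :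
    min (Nat.count p (T + 1 + 1)) (T + 1) ≤ Nat.count q (T + 1) := by
  by_cases h : ∀ t ≤ T, q t
  · rw [Nat.count_eq_card_filter_range q, Finset.filter_true_of_mem fun t ht => h t (by simp at ht; omega)]
    simp
  · push Not at h
    obtain ⟨s, hs, hq⟩ := h
    refine (min_le_left _ _).trans ?_
    rw [Nat.count_eq_card_filter_range, Nat.count_eq_card_filter_range]
    have a1 : ¬ p s := fun h => hq (h1 s hs h)
    have a2 : ¬ p (s + 1) := fun h => hq (h2 s hs h)
    have a3 : ∀ t, p t → t ≠ s ∧ t ≠ s + 1 := fun t ht => ⟨fun h => a1 (h ▸ ht), fun h => a2 (h ▸ ht)⟩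
    refine Finset.card_le_card_of_injOn (fun t => if t < s then t else t - 1) ?_ ?_
    · intro t ht
      grind
    · intro t ht t' ht' h
      grind

lemma cmp_shadow (hij : i ≠ j) {A B : Finset (ι → ℕ)} (hAB : ∀ u l, u + Pi.single l 1 ∈ A → u ∈ B)
    (u : ι → ℕ) (l : ι) (h : u + Pi.single l 1 ∈ cmpr i j A) : u ∈ cmpr i j B := by
  rw [mem_cmpr hij] at h ⊢
  by_cases hl : l = i ∨ l = j
  · set v := u + Pi.single l 1 with hv
    have e : v i + v j = u i + u j + 1 ∧ u j ≤ v j := by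
      rcases hl with rfl | rfl <;> simp [hv, hij, hij.symm] <;> omega
    have el : ∀ m, m ≠ i → m ≠ j → v m = u m := by
      intro m h1 h2
      have : m ≠ l := by rintro rfl; tauto
      simp [hv, this]
    have := shadow_seg (u i + u j) (pr i j A v) (pr i j B u) (fun t ht hp => ⟨ht, hAB _ i ?_⟩) (fun t ht hp => ⟨ht, hAB _ j ?_⟩)
    · grind
    · convert hp.2 using 1
      ext m
      rw [Pi.add_apply]
      by_cases h1 : m = i
      · subst h1; rw [ln_i, ln_i, e.1, Pi.single_eq_same]; omega
      by_cases h2 : m = j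
      · subst h2; rw [ln_j hij, ln_j hij, Pi.single_eq_of_ne h1]; omega
      · rw [ln_l _ _ h1 h2, ln_l _ _ h1 h2, Pi.single_eq_of_ne h1, el m h1 h2, add_zero]
    · convert hp.2 using 1
      ext m
      rw [Pi.add_apply]
      by_cases h2 : m = j
      · subst h2; rw [ln_j hij, ln_j hij, Pi.single_eq_same]
      by_cases h1 : m = i
      · subst h1; rw [ln_i, ln_i, e.1, Pi.single_eq_of_ne h2]; omega
      · rw [ln_l _ _ h1 h2, ln_l _ _ h1 h2, Pi.single_eq_of_ne h2, el m h1 h2, add_zero]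
  · push Not at hl
    have e1 : (u + Pi.single l 1 : ι → ℕ) i = u i := by simp [hl.1.symm]
    have e2 : (u + Pi.single l 1 : ι → ℕ) j = u j := by simp [hl.2.symm]
    rw [e1, e2] at h
    refine h.trans_le (Nat.count_mono_left fun t _ ht => ⟨by have := ht.1; omega, hAB _ l ?_⟩)
    convert ht.2 using 1
    ext m
    rw [Pi.add_apply]
    by_cases h1 : m = i
    · subst h1; rw [ln_i, ln_i, e1, e2, Pi.single_eq_of_ne hl.1.symm, add_zero]
    by_cases h2 : m = j
    · subst h2; rw [ln_j hij, ln_j hij, Pi.single_eq_of_ne hl.2.symm, add_zero]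
    · rw [ln_l _ _ h1 h2, ln_l _ _ h1 h2, Pi.add_apply]

lemma exists_stable [Fintype ι] (i : ι) (A B : Finset (ι → ℕ)) (k : ℕ) (hA : ∀ u ∈ A, ∑ l, u l = k) (hAB : ∀ u l, u + Pi.single l 1 ∈ A → u ∈ B) :
    ∃ A' B' : Finset (ι → ℕ), A'.card = A.card ∧ B'.card = B.card ∧ (∀ u ∈ A', ∑ l, u l = k) ∧
      (∀ u l, u + Pi.single l 1 ∈ A' → u ∈ B') ∧ ∀ (u : ι → ℕ) (j : ι), u + Pi.single j 1 ∈ A' → u + Pi.single i 1 ∈ A' := by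
  let S : Set ℕ := {w | ∃ A' B' : Finset (ι → ℕ), A'.card = A.card ∧ B'.card = B.card ∧ (∀ u ∈ A', ∑ l, u l = k) ∧
      (∀ u l, u + Pi.single l 1 ∈ A' → u ∈ B') ∧ ∑ u ∈ A', u i = w}
  have hb : ∀ w ∈ S, w ≤ A.card * k := by
    rintro w ⟨A', B', h1, -, h2, -, rfl⟩
    rw [← h1, ← smul_eq_mul]
    exact Finset.sum_le_card_nsmul _ _ _ fun u hu => (h2 u hu) ▸ Finset.single_le_sum (f := u) (fun _ _ => Nat.zero_le _) (Finset.mem_univ i)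
  have hne : S.Nonempty := ⟨_, A, B, rfl, rfl, hA, hAB, rfl⟩
  obtain ⟨A', B', h1, h2, h3, h4, h5⟩ := Nat.sSup_mem hne ⟨_, hb⟩
  refine ⟨A', B', h1, h2, h3, h4, fun u j hu => ?_⟩
  by_cases hij : i = j
  · rwa [hij]
  have hc := cmp_bij hij A'
  have hdeg : ∀ u t, t ≤ u i + u j → ∑ l, ln i j u t l = ∑ l, u l := by
    intro u t ht
    rw [← Finset.add_sum_erase _ _ (Finset.mem_univ i), ← Finset.add_sum_erase _ u (Finset.mem_univ i),
      ← Finset.add_sum_erase (Finset.univ.erase i) _ (Finset.mem_erase.2 ⟨Ne.symm hij, Finset.mem_univ j⟩),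
      ← Finset.add_sum_erase (Finset.univ.erase i) u (Finset.mem_erase.2 ⟨Ne.symm hij, Finset.mem_univ j⟩), ln_i, ln_j hij]
    have : ∑ l ∈ (Finset.univ.erase i).erase j, ln i j u t l = ∑ l ∈ (Finset.univ.erase i).erase j, u l :=
      Finset.sum_congr rfl fun l hl => by
        simp only [Finset.mem_erase] at hl
        exact ln_l _ _ hl.2.1 hl.1
    omega
  have hS : (∑ u ∈ cmpr i j A', u i) ∈ S := by
    refine ⟨cmpr i j A', cmpr i j B', hc.2.trans h1, (cmp_bij hij B').2.trans h2, fun u hu => ?_, cmp_shadow hij h4, rfl⟩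
    unfold cmpr at hu
    simp only [Finset.mem_filter, Finset.mem_biUnion, Finset.mem_image, Finset.mem_range] at hu
    grind
  have hle := le_csSup ⟨_, hb⟩ hS
  rw [← h5] at hle
  let φ : (ι → ℕ) → (ι → ℕ) := fun u => ln i j u (Nat.count (pr i j A' u) (u j))
  have hφi : ∀ u, u i ≤ φ u i := fun u => by
    have : Nat.count (pr i j A' u) (u j) ≤ u j := count_le' _ _
    simp only [φ, ln_i]; omega
  have hinj : Set.InjOn φ A' := by
    intro u hu v hv h
    have hu2 : Nat.count (pr i j A' u) (u j) ≤ u i + u j := (count_le' _ _).trans (by omega)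
    have hv2 : Nat.count (pr i j A' v) (v j) ≤ v i + v j := (count_le' _ _).trans (by omega)
    have e1 : pr i j A' u = pr i j A' v := by rw [← pr_ln hij A' u hu2, ← pr_ln hij A' v hv2]; grind
    have e2 := congrFun h j
    simp only [φ, ln_j hij] at e2
    rw [e1] at e2
    have hpu : pr i j A' v (u j) := e1 ▸ ⟨by omega, by rwa [ln_self hij]⟩
    have hpv : pr i j A' v (v j) := ⟨by omega, by rwa [ln_self hij]⟩
    have e3 := Nat.count_injective hpu hpv e2
    rw [← ln_self hij u, ← ln_self hij v, ← ln_ln hij u hu2 (u j), ← ln_ln hij v hv2 (v j)]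
    grind
  have himg : A'.image φ = cmpr i j A' := Finset.eq_of_subset_of_card_le
    (fun v hv => by obtain ⟨u, hu, rfl⟩ := Finset.mem_image.1 hv; grind) (by grind)
  rw [← himg, Finset.sum_image hinj] at hle
  have heq := (Finset.sum_eq_sum_iff_of_le fun u _ => hφi u).1 (le_antisymm (Finset.sum_le_sum fun u _ => hφi u) hle) _ hu
  set v := u + Pi.single j 1 with hv
  have e1 : v j = u j + 1 := by simp [hv]
  have e2 : Nat.count (pr i j A' v) (v j) = v j := by
    have : Nat.count (pr i j A' v) (v j) ≤ v j := count_le' _ _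
    simp only [φ, ln_i] at heq; omega
  have e3 : pr i j A' v (u j) := by
    have h6 : Nat.count (pr i j A' v) (u j) ≤ u j := count_le' _ _
    grind
  convert e3.2 using 1
  ext l
  rw [Pi.add_apply]
  by_cases hi : l = i
  · subst hi; rw [ln_i, e1, Pi.single_eq_same, hv, Pi.add_apply, Pi.single_eq_of_ne hij]; omega
  by_cases hj : l = j
  · subst hj; rw [ln_j hij, Pi.single_eq_of_ne hi]; omega
  · rw [ln_l _ _ hi hj, hv, Pi.add_apply, Pi.single_eq_of_ne hi, Pi.single_eq_of_ne hj]
end comp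

lemma mc_le (b k : ℕ) : Nat.multichoose b (k + 1) ≤ 1 + ∑ j ∈ Finset.range (k + 1), Nat.multichoose (b - 1) (j + 1) := by
  cases b with
  | zero => rw [Nat.multichoose_zero_succ]; omega
  | succ c =>
    rw [Nat.add_sub_cancel]
    induction k with
    | zero => simp [add_comm]
    | succ k ih => rw [Finset.sum_range_succ, Nat.multichoose_succ_succ]; omega

lemma mc_sum (b : ℕ → ℕ) (k : ℕ) : ∑ m ∈ Finset.range k, Nat.multichoose (b (m + 1)) (m + 1) ≤
    k + ∑ r ∈ Finset.range (k + 1), ∑ i ∈ Finset.range (k - r), Nat.multichoose (b (i + r + 1) - 1) (i + 1) := by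
  induction k with
  | zero => simp
  | succ k ih =>
    rw [Finset.sum_range_succ, Finset.sum_range_succ _ (k + 1), Nat.sub_self, Finset.range_zero, Finset.sum_empty, add_zero]
    have e : ∀ r ∈ Finset.range (k + 1), ∑ i ∈ Finset.range (k + 1 - r), Nat.multichoose (b (i + r + 1) - 1) (i + 1) =
        ∑ i ∈ Finset.range (k - r), Nat.multichoose (b (i + r + 1) - 1) (i + 1) + Nat.multichoose (b (k + 1) - 1) (k - r + 1) := by
      intro r hr
      have hr := Finset.mem_range.1 hr
      rw [show k + 1 - r = k - r + 1 by omega, Finset.sum_range_succ, show k - r + r + 1 = k + 1 by omega]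
    rw [Finset.sum_congr rfl e, Finset.sum_add_distrib]
    have := Finset.sum_range_reflect (fun j => Nat.multichoose (b (k + 1) - 1) (j + 1)) (k + 1)
    simp only [Nat.add_sub_cancel] at this
    have h2 := mc_le (b (k + 1)) k
    omega

theorem mac (n : ℕ) : ∀ (k : ℕ) (b : ℕ → ℕ) (A B : Finset (Fin n → ℕ)), (∀ u ∈ A, ∑ l, u l = k + 1) →
    (∀ u l, u + Pi.single l 1 ∈ A → u ∈ B) →
    ∑ i ∈ Finset.range (k + 1), Nat.multichoose (b i) (i + 1) < A.card →
    ∑ i ∈ Finset.range k, Nat.multichoose (b (i + 1)) (i + 1) < B.card := by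
  induction n with
  | zero =>
    intro k b A B hA _ h
    obtain ⟨u, hu⟩ := Finset.card_pos.1 (lt_of_le_of_lt (Nat.zero_le _) h)
    have := hA u hu
    simp at this
  | succ n ih =>
    intro k b A B hA hAB h
    obtain ⟨A', B', h1, h2, h3, h4, h5⟩ := exists_stable 0 A B (k + 1) hA hAB
    rw [← h1] at h; rw [← h2]
    clear hA hAB h1 h2
    let S : Finset (Fin (n + 1) → ℕ) → ℕ → Finset (Fin n → ℕ) := fun A r => (A.filter fun u => u 0 = r).image Fin.tail
    have hS : ∀ A r w, w ∈ S A r ↔ (Fin.cons r w : Fin (n + 1) → ℕ) ∈ A := by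
      intro A r w
      simp only [S, Finset.mem_image, Finset.mem_filter]
      constructor
      · rintro ⟨u, ⟨hu, rfl⟩, rfl⟩; rwa [Fin.cons_self_tail]
      · intro h; exact ⟨_, ⟨h, by simp⟩, by simp⟩
    have hSc : ∀ A r, (S A r).card = (A.filter fun u => u 0 = r).card := by
      intro A r
      refine Finset.card_image_of_injOn fun u hu v hv h => ?_
      simp only [Finset.coe_filter, Set.mem_ofPred_eq] at hu hv
      rw [← Fin.cons_self_tail u, ← Fin.cons_self_tail v, hu.2, hv.2, h]
    have cA : A'.card = ∑ r ∈ Finset.range (k + 2), (S A' r).card := by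
      simp only [hSc]
      refine Finset.card_eq_sum_card_fiberwise fun u hu => ?_
      have h6 := h3 u hu
      have h7 := Finset.single_le_sum (f := u) (fun _ _ => Nat.zero_le _) (Finset.mem_univ 0)
      grind
    have cB : ∑ r ∈ Finset.range (k + 1), (S B' r).card ≤ B'.card := by
      simp only [hSc]
      rw [← Finset.card_biUnion]
      · exact Finset.card_le_card (Finset.biUnion_subset.2 fun r _ => Finset.filter_subset _ _)
      · intro r _ r' _ hne
        exact Finset.disjoint_filter.2 fun u _ h h' => hne (h.symm.trans h')
    have sAB : ∀ r, (S A' (r + 1)).card ≤ (S B' r).card := by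
      intro r
      refine Finset.card_le_card fun w hw => ?_
      rw [hS] at hw ⊢
      refine h4 _ 0 ?_
      convert hw using 1
      ext l
      refine Fin.cases ?_ (fun l => ?_) l <;> simp
    have hB : ∑ r ∈ Finset.range (k + 1), (S A' (r + 1)).card ≤ B'.card := (Finset.sum_le_sum fun r _ => sAB r).trans cB
    rw [Finset.sum_range_succ'] at cA
    refine lt_of_lt_of_le ?_ hB
    by_cases hc : ∑ i ∈ Finset.range (k + 1), Nat.multichoose (b i - 1) (i + 1) < (S A' 0).card
    · have hr : ∀ r ≤ k + 1, ∑ i ∈ Finset.range (k + 1 - r), Nat.multichoose (b (i + r) - 1) (i + 1) < (S A' r).card := by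
        intro r
        induction r with
        | zero => intro _; exact hc
        | succ r ihr =>
          intro hrk
          have := ih (k - r) (fun i => b (i + r) - 1) (S A' r) (S A' (r + 1)) ?_ ?_ ?_
          · grind
          · intro w hw
            have := h3 _ ((hS _ _ _).1 hw)
            rw [Fin.sum_univ_succ] at this
            simp only [Fin.cons_zero, Fin.cons_succ] at this
            omega
          · intro w l hw
            rw [hS] at hw ⊢
            have := h5 (Fin.cons r w) l.succ ?_
            · convert this using 1
              ext m
              refine Fin.cases ?_ (fun m => ?_) m <;> simp
            · convert hw using 1
              ext m
              refine Fin.cases ?_ (fun m => ?_) m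
              · simp
              · simp [Pi.single_apply]
          grind
      have h6 : ∑ r ∈ Finset.range (k + 1), (1 + ∑ i ∈ Finset.range (k - r), Nat.multichoose (b (i + r + 1) - 1) (i + 1)) ≤
          ∑ r ∈ Finset.range (k + 1), (S A' (r + 1)).card := by
        refine Finset.sum_le_sum fun r hrr => ?_
        have := hr (r + 1) (by have := Finset.mem_range.1 hrr; omega)
        grind
      rw [Finset.sum_add_distrib] at h6
      simp only [Finset.sum_const, Finset.card_range, smul_eq_mul, mul_one] at h6
      have := mc_sum b k
      omega
    · have h7 : ∀ c i, Nat.multichoose c (i + 1 + 1) = Nat.multichoose (c - 1) (i + 1 + 1) + Nat.multichoose c (i + 1) := by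
        intro c i
        cases c with
        | zero => simp
        | succ c => rw [Nat.multichoose_succ_succ]; rfl
      have h8 : ∑ i ∈ Finset.range (k + 1), Nat.multichoose (b i - 1) (i + 1) + ∑ i ∈ Finset.range k, Nat.multichoose (b (i + 1)) (i + 1) ≤
          ∑ i ∈ Finset.range (k + 1), Nat.multichoose (b i) (i + 1) := by
        rw [Finset.sum_range_succ', Finset.sum_range_succ' (fun i => Nat.multichoose (b i) (i + 1))]
        simp only [zero_add, Nat.multichoose_one_right]
        rw [Finset.sum_congr rfl fun i _ => h7 (b (i + 1)) i, Finset.sum_add_distrib]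
        omega
      omega

def rkc (k : ℕ) (b : ℕ → ℕ) : ℕ := ∑ i ∈ Finset.range k, Nat.multichoose (b i) (i + 1)
def Mon (e : ℕ) (a : ℕ → ℕ) : Prop := ∀ i j, i ≤ j → j < e → a i ≤ a j
def bt (e : ℕ) (a : ℕ → ℕ) (j i : ℕ) : ℕ := a (e - j + i) - 1
def Mem (e : ℕ) (g : ℕ → ℕ) (a : ℕ → ℕ) : Prop :=
  ∀ j ≤ e, (j ≠ 0 → 0 < a (e - j)) → rkc j (bt e a j) < g j
def pos (e : ℕ) (a : ℕ → ℕ) : Finset ℕ := (Finset.range e).biUnion fun l => {a l + 2 * l, a l + 2 * l + 1}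
def Rp (e : ℕ) (a : ℕ → ℕ) : Finset ℕ := ((Finset.range e).filter fun l => 0 < a l).image fun l => a l + 2 * l + 1

lemma mem_pos {e : ℕ} {a : ℕ → ℕ} {x : ℕ} : x ∈ pos e a ↔ ∃ l < e, x = a l + 2 * l ∨ x = a l + 2 * l + 1 := by
  simp [pos]
lemma mem_Rp {e : ℕ} {a : ℕ → ℕ} {x : ℕ} : x ∈ Rp e a ↔ ∃ l < e, 0 < a l ∧ x = a l + 2 * l + 1 := by
  simp [Rp, and_assoc, eq_comm]

lemma mc_mono {c c' : ℕ} (h : c ≤ c') (n : ℕ) : Nat.multichoose c n ≤ Nat.multichoose c' n := by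
  induction h with
  | refl => rfl
  | @step m _ ih =>
    refine ih.trans ?_
    cases n with
    | zero => simp
    | succ n => rw [Nat.multichoose_succ_succ]; omega

lemma hockey (c n : ℕ) : ∑ i ∈ Finset.range n, Nat.multichoose c (i + 1) + 1 = Nat.multichoose (c + 1) n := by
  induction n with
  | zero => simp
  | succ n ih => rw [Finset.sum_range_succ, Nat.multichoose_succ_succ]; omega

lemma rkc_mono {k : ℕ} {b b' : ℕ → ℕ} (h : ∀ i < k, b i ≤ b' i) : rkc k b ≤ rkc k b' :=
  Finset.sum_le_sum fun i hi => mc_mono (h i (Finset.mem_range.1 hi)) _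

lemma rkc_lt {k l : ℕ} {b b' : ℕ → ℕ} (hl : l < k) (h1 : ∀ i, l < i → i < k → b i = b' i)
    (h2 : ∀ i ≤ l, b i ≤ b l) (h3 : b l < b' l) : rkc k b < rkc k b' := by
  induction k with
  | zero => omega
  | succ k ih =>
    rw [rkc, rkc, Finset.sum_range_succ, Finset.sum_range_succ]
    rcases Nat.lt_succ_iff_lt_or_eq.1 hl with h | rfl
    · have := ih h (fun i a b => h1 i a (by omega))
      rw [rkc, rkc] at this
      grind
    · have h4 : rkc (l + 1) b ≤ rkc (l + 1) fun _ => b l := rkc_mono fun i hi => h2 i (by omega)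
      have h5 := hockey (b l) (l + 1)
      have h6 := mc_mono (show b l + 1 ≤ b' l from h3) (l + 1)
      rw [rkc, rkc, Finset.sum_range_succ] at h4
      omega

lemma rkc_surj (k r : ℕ) (h : k = 0 → r = 0) : ∃ b, Mon k b ∧ rkc k b = r := by
  induction k generalizing r with
  | zero => exact ⟨fun _ => 0, fun _ _ _ h => absurd h (by omega), by rw [h rfl]; rfl⟩
  | succ k ih =>
    have hex : ∃ c, r < Nat.multichoose (c + 1) (k + 1) := ⟨r, by
      have := hockey r (k + 1)
      rw [Finset.sum_range_succ'] at this
      simp at this; omega⟩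
    let c := Nat.find hex
    have hc : r < Nat.multichoose (c + 1) (k + 1) := Nat.find_spec hex
    have hc' : Nat.multichoose c (k + 1) ≤ r := by
      by_cases h0 : c = 0
      · rw [h0]; simp
      · have := Nat.find_min hex (m := c - 1) (by omega)
        grind
    rw [Nat.multichoose_succ_succ] at hc
    obtain ⟨b, hb, hr⟩ := ih (r - Nat.multichoose c (k + 1)) (by rintro rfl; rw [Nat.multichoose_zero_right] at hc; omega)
    have hbc : ∀ i < k, b i ≤ c := by
      intro i hi
      by_contra hcon
      have h1 : Nat.multichoose (c + 1) k ≤ rkc k b := by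
        obtain ⟨k, rfl⟩ : ∃ m, k = m + 1 := ⟨k - 1, by omega⟩
        rw [rkc, Finset.sum_range_succ]
        have := mc_mono (show c + 1 ≤ b k by have := hb i k (by omega) (by omega); omega) (k + 1)
        omega
      omega
    refine ⟨fun i => if i < k then b i else c, ?_, ?_⟩
    · intro i j hij hj
      dsimp only
      split_ifs with h1 h2
      · exact hb i j hij h2
      · grind
      · omega
      · rfl
    · rw [rkc, Finset.sum_range_succ, if_neg (lt_irrefl _)]
      rw [Finset.sum_congr rfl fun i hi => by rw [if_pos (Finset.mem_range.1 hi)]]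
      rw [rkc] at hr; omega

lemma exists_deg (e : ℕ) (a : ℕ → ℕ) (ha : Mon e a) : ∃ k ≤ e, ∀ i < e, (0 < a i ↔ e - k ≤ i) := by
  by_cases h : ∃ i, i < e ∧ 0 < a i
  · refine ⟨e - Nat.find h, by omega, fun i hi => ?_⟩
    have := Nat.find_spec h
    rw [show e - (e - Nat.find h) = Nat.find h by omega]
    constructor
    · intro h'; exact Nat.find_min' h ⟨hi, h'⟩
    · intro h'; exact lt_of_lt_of_le this.2 (ha _ _ h' hi)
  · push Not at h
    exact ⟨0, by omega, fun i hi => ⟨fun h' => by have := h i hi; omega, fun h' => by omega⟩⟩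

section
variable {e : ℕ} {g : ℕ → ℕ} {a a' : ℕ → ℕ}

/-- membership is decided in the top degree -/
lemma mem_of_deg (hg : ∀ k b, k + 1 ≤ e → rkc (k + 1) b < g (k + 1) → rkc k (fun i => b (i + 1)) < g k)
    {k : ℕ} (hk : k ≤ e) (hd : ∀ i < e, (0 < a i ↔ e - k ≤ i)) (h : rkc k (bt e a k) < g k) : Mem e g a := by
  have key : ∀ n ≤ k, rkc (k - n) (bt e a (k - n)) < g (k - n) := by
    intro n
    induction n with
    | zero => intro _; exact h
    | succ n ih =>
      intro hn
      have := ih (by omega)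
      rw [show k - n = k - (n + 1) + 1 by omega] at this
      have := hg _ _ (by omega) this
      convert this using 3 with i
      simp only [bt]
      grind
  intro j hj h0
  have hjk : j ≤ k := by
    grind
  have := key (k - j) (by omega)
  grind

lemma Mem.mono (h : Mem e g a) (h' : ∀ i < e, a' i ≤ a i) : Mem e g a' := by
  intro j hj h0
  refine lt_of_le_of_lt (rkc_mono fun i hi => ?_) (h j hj fun h1 => lt_of_lt_of_le (h0 h1) (h' _ (by omega)))
  have := h' (e - j + i) (by omega)
  simp only [bt]; omega

lemma pos_uniq (ha : Mon e a) (ha' : Mon e a') (h1 : Rp e a ⊆ pos e a') (h2 : Rp e a' ⊆ pos e a) :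
    ∀ i < e, a i = a' i := by
  have key : ∀ a a', Mon e a → Mon e a' → Rp e a' ⊆ pos e a → ∀ l < e, (∀ i, l < i → i < e → a i = a' i) → ¬ a l < a' l := by
    intro a a' ha ha' h l hl heq hlt
    obtain ⟨m, hm, hx⟩ := mem_pos.1 (h (mem_Rp.2 ⟨l, hl, by omega, rfl⟩))
    rcases lt_trichotomy m l with h3 | h3 | h3
    · have := ha m l h3.le hl; omega
    · grind
    · have := ha' l m h3.le hm
      grind
  have : ∀ n ≤ e, ∀ i, e - n ≤ i → i < e → a i = a' i := by
    intro n
    induction n with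
    | zero => intro _ i; omega
    | succ n ih =>
      grind
  exact fun i hi => this e le_rfl i (by omega) hi

lemma pos_exists (ha : Mon e a) (hm : Mem e g a) (S : Finset ℕ) (hS : S ⊆ pos e a) :
    ∃ a', Mon e a' ∧ Mem e g a' ∧ Rp e a' ⊆ S ∧ S ⊆ pos e a' := by
  induction hn : ∑ i ∈ Finset.range e, a i using Nat.strong_induction_on generalizing a with
  | _ n ih =>
    by_cases hR : Rp e a ⊆ S
    · grind
    · rw [Finset.not_subset] at hR
      obtain ⟨x0, hx0, hxS⟩ := hR
      obtain ⟨l, hl, h0, rfl⟩ := mem_Rp.1 hx0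
      have hle : ∀ i < e, (if i ≤ l then min (a i) (a l - 1) else a i) ≤ a i := by
        grind
      refine ih _ ?_ (a := fun i => if i ≤ l then min (a i) (a l - 1) else a i) ?_ (hm.mono hle) ?_ rfl
      · rw [← hn]
        refine Finset.sum_lt_sum (fun i hi => hle i (Finset.mem_range.1 hi)) ⟨l, Finset.mem_range.2 hl, ?_⟩
        grind
      · intro i j hij hj
        have h1 := ha i j hij hj
        grind
      · intro x hx
        obtain ⟨i, hi, h1⟩ := mem_pos.1 (hS hx)
        rw [mem_pos]
        by_cases h2 : i ≤ l ∧ a i = a l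
        · rcases h1 with h1 | h1
          · grind
          · have h3 : i ≠ l := by rintro rfl; grind
            have h4 := ha i (i + 1) (by omega) (by omega)
            have h5 := ha (i + 1) l (by omega) hl
            exact ⟨i + 1, by omega, by rw [if_pos (by omega)]; omega⟩
        · refine ⟨i, hi, ?_⟩
          have : (if i ≤ l then min (a i) (a l - 1) else a i) = a i := by
            split_ifs with h3
            · have := ha i l h3 hl
              have : a i ≠ a l := fun h => h2 ⟨h3, h⟩
              omega
            · rfl
          rwa [this]

/-- Gale's evenness condition -/
lemma gale (e : ℕ) (S : Finset ℕ) (hS : S.card = 2 * e) (h : ∀ x, (∃ y ∈ S, x ≤ y) → x ∉ S → Even (S.filter fun y => x < y).card) :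
    ∃ a, Mon e a ∧ S = pos e a := by
  induction e generalizing S with
  | zero => exact ⟨fun _ => 0, fun _ _ _ h => absurd h (by omega), by simpa [pos] using hS⟩
  | succ e ih =>
    have hne : S.Nonempty := Finset.card_pos.1 (by omega)
    set M := S.max' hne with hM
    have hMS : M ∈ S := Finset.max'_mem _ _
    have hle : ∀ y ∈ S, y ≤ M := fun y hy => Finset.le_max' _ _ hy
    have hcard : S ⊆ Finset.range (M + 1) := fun y hy => Finset.mem_range.2 (by have := hle y hy; omega)
    have hM1 : 1 ≤ M := by have := Finset.card_le_card hcard; simp at this; omega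
    have hM2 : M - 1 ∈ S := by
      by_contra hcon
      have := h (M - 1) ⟨M, hMS, by omega⟩ hcon
      rw [show S.filter (fun y => M - 1 < y) = {M} by
        ext y; simp only [Finset.mem_filter, Finset.mem_singleton]
        constructor
        · rintro ⟨h1, h2⟩; have := hle y h1; omega
        · rintro rfl; exact ⟨hMS, by omega⟩] at this
      simp at this
    have hS' : ((S.erase M).erase (M - 1)).card = 2 * e := by
      grind
    obtain ⟨a, ha, hSa⟩ := ih _ hS' (by
      rintro x ⟨y, hy, hxy⟩ hx
      simp only [Finset.mem_erase] at hy hx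
      have := hle y hy.2.2
      have h1 := h x ⟨y, hy.2.2, hxy⟩ (fun h => hx ⟨by omega, by omega, h⟩)
      rw [Finset.filter_erase, Finset.filter_erase, Finset.card_erase_of_mem (by simp [hM2]; omega),
        Finset.card_erase_of_mem (by simp [hMS]; omega)]
      obtain ⟨c, hc⟩ := h1
      exact ⟨c - 1, by omega⟩)
    have hlt : ∀ y ∈ pos e a, y < M - 1 := by
      grind
    have hM3 : 2 * e ≤ M - 1 := by
      have := Finset.card_le_card (show pos e a ⊆ Finset.range (M - 1) from fun y hy => Finset.mem_range.2 (hlt y hy))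
      grind
    refine ⟨fun i => if i < e then a i else M - 1 - 2 * e, ?_, ?_⟩
    · intro i j hij hj
      dsimp only
      split_ifs with h1 h2 h2
      · exact ha i j hij h2
      · have h3 := hlt (a (e - 1) + 2 * (e - 1) + 1) (mem_pos.2 ⟨e - 1, by omega, Or.inr rfl⟩)
        have := ha i (e - 1) (by omega) (by omega)
        omega
      · omega
      · rfl
    · have : S = insert M (insert (M - 1) (pos e a)) := by
        grind
      rw [this]
      ext x
      simp only [Finset.mem_insert, mem_pos]
      constructor
      · rintro (h | h | ⟨l, hl, h⟩)
        · exact ⟨e, by omega, by rw [if_neg (lt_irrefl _)]; omega⟩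
        · exact ⟨e, by omega, by rw [if_neg (lt_irrefl _)]; omega⟩
        grind
      grind
end

noncomputable def tt (e : ℕ) : ℕ → ℝ
  | 0 => 1
  | x + 1 => tt e x + 1 + 2 * e * tt e x ^ (2 * e)

noncomputable def psi (e r p : ℕ) : ℝ := (tt e r - tt e p) * (tt e r - tt e (p + 1))
noncomputable def Phi' (e : ℕ) (a : ℕ → ℕ) (r : ℕ) : ℝ := ∏ l ∈ Finset.range e, psi e r (a l + 2 * l)

lemma tt_one (e x : ℕ) : 1 ≤ tt e x := by
  induction x with
  | zero => exact le_refl _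
  | succ x ih =>
    rw [tt]
    have : (0 : ℝ) ≤ 2 * e * tt e x ^ (2 * e) := by positivity
    linarith
  
lemma tt_succ (e x : ℕ) : tt e x + 1 ≤ tt e (x + 1) := by
  have := tt_one e x
  rw [tt]
  have : (0 : ℝ) ≤ 2 * e * tt e x ^ (2 * e) := by positivity
  linarith

lemma tt_mono (e : ℕ) : StrictMono (tt e) := strictMono_nat_of_lt_succ fun x => by have := tt_succ e x; linarith

lemma tt_gap {e x y : ℕ} (h : x < y) : tt e x + 1 ≤ tt e y :=
  (tt_succ e x).trans ((tt_mono e).monotone h)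

lemma psi_nonneg (e r p : ℕ) : 0 ≤ psi e r p := by
  rcases le_or_gt r p with h | h
  · exact mul_nonneg_of_nonpos_of_nonpos (sub_nonpos.2 ((tt_mono e).monotone h)) (sub_nonpos.2 ((tt_mono e).monotone (by omega)))
  · exact mul_nonneg (sub_nonneg.2 ((tt_mono e).monotone h.le)) (sub_nonneg.2 ((tt_mono e).monotone h))

lemma psi_one {e r p : ℕ} (h : r ≠ p) (h' : r ≠ p + 1) : 1 ≤ psi e r p := by
  rcases lt_or_gt_of_ne h with h | h
  · have h1 := tt_gap (e := e) h
    have h2 := tt_gap (e := e) (show r < p + 1 by omega)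
    rw [psi]; nlinarith
  · have h1 := tt_gap (e := e) h
    have h2 := tt_gap (e := e) (show p + 1 < r by omega)
    rw [psi]; nlinarith

lemma psi_le {e r p x : ℕ} (h : r ≤ x) (h' : p + 1 ≤ x) : psi e r p ≤ tt e x ^ 2 := by
  have k : ∀ y ≤ x, |tt e r - tt e y| ≤ tt e x := fun y hy => by
    rw [abs_le]
    have := tt_one e r
    have := tt_one e y
    have := (tt_mono e).monotone hy
    have := (tt_mono e).monotone h
    grind
  have := mul_le_mul (k p (by omega)) (k (p + 1) h') (abs_nonneg _) (by have := tt_one e x; linarith)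
  rw [← abs_mul] at this
  rw [sq]; exact (le_abs_self _).trans this

lemma Phi_nonneg (e : ℕ) (a : ℕ → ℕ) (r : ℕ) : 0 ≤ Phi' e a r := Finset.prod_nonneg fun _ _ => psi_nonneg _ _ _

lemma Phi_lt {e : ℕ} {a a' : ℕ → ℕ} (ha : Mon e a) {l r : ℕ} (hl : l < e) (h1 : ∀ i, l < i → i < e → a i = a' i)
    (h2 : a l < a' l) (hr : r < a' l + 2 * l) (h3 : ∀ i < e, r ≠ a' i + 2 * i ∧ r ≠ a' i + 2 * i + 1) :
    2 * e * Phi' e a r < Phi' e a' r := by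
  rw [Phi', Phi', ← Finset.prod_range_mul_prod_Ico _ hl, ← Finset.prod_range_mul_prod_Ico (fun i => psi e r (a' i + 2 * i)) hl]
  rw [Finset.prod_congr (s₁ := Finset.Ico _ _) rfl fun i hi => by rw [h1 i (by have := (Finset.mem_Ico.1 hi).1; omega) (Finset.mem_Ico.1 hi).2]]
  rw [← mul_assoc]
  set x := a' l + 2 * l
  refine mul_lt_mul_of_pos_right ?_ (Finset.prod_pos fun i hi => lt_of_lt_of_le one_pos
    (psi_one (h3 i (Finset.mem_Ico.1 hi).2).1 (h3 i (Finset.mem_Ico.1 hi).2).2))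
  have hx := tt_one e x
  have e1 : ∏ i ∈ Finset.range (l + 1), psi e r (a i + 2 * i) ≤ tt e x ^ (2 * e) := by
    calc _ ≤ ∏ i ∈ Finset.range (l + 1), tt e x ^ 2 := by
          refine Finset.prod_le_prod (fun i _ => psi_nonneg _ _ _) fun i hi => psi_le hr.le ?_
          have hi := Finset.mem_range.1 hi
          have := ha i l (by omega) hl
          omega
      _ ≤ _ := by
          rw [Finset.prod_const, Finset.card_range, ← pow_mul]
          exact pow_le_pow_right₀ hx (by omega)
  have e2 : 2 * e * tt e x ^ (2 * e) < psi e r x := by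
    have := tt_gap (e := e) hr
    have h4 : tt e (x + 1) = tt e x + 1 + 2 * e * tt e x ^ (2 * e) := by rw [tt]
    have : 0 ≤ 2 * e * tt e x ^ (2 * e) := by positivity
    rw [psi]; nlinarith
  have e3 : psi e r x ≤ ∏ i ∈ Finset.range (l + 1), psi e r (a' i + 2 * i) := by
    rw [Finset.prod_range_succ]
    refine le_mul_of_one_le_left (psi_nonneg _ _ _) (Finset.one_le_prod fun i hi => ?_)
    have hi := Finset.mem_range.1 hi
    exact psi_one (h3 i (by omega)).1 (h3 i (by omega)).2
  exact lt_of_le_of_lt (mul_le_mul_of_nonneg_left e1 (by positivity)) (e2.trans_le e3)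

lemma rkc_top {k : ℕ} {b b' : ℕ → ℕ} (h : ∃ i < k, b i ≠ b' i) :
    ∃ l < k, (∀ i, l < i → i < k → b i = b' i) ∧ b l ≠ b' l := by
  have hne : ((Finset.range k).filter fun i => b i ≠ b' i).Nonempty := by
    obtain ⟨i, h1, h2⟩ := h; exact ⟨i, Finset.mem_filter.2 ⟨Finset.mem_range.2 h1, h2⟩⟩
  have hm := Finset.max'_mem _ hne
  simp only [Finset.mem_filter, Finset.mem_range] at hm
  refine ⟨_, hm.1, fun i h1 h2 => ?_, hm.2⟩
  by_contra h3
  have := Finset.le_max' ((Finset.range k).filter fun i => b i ≠ b' i) i (Finset.mem_filter.2 ⟨Finset.mem_range.2 h2, h3⟩)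
  omega

lemma rkc_colex {k : ℕ} {b b' : ℕ → ℕ} (hb' : Mon k b') (h : rkc k b < rkc k b') :
    ∃ l < k, (∀ i, l < i → i < k → b i = b' i) ∧ b l < b' l := by
  obtain ⟨l, hl, h1, h2⟩ := rkc_top (k := k) (b := b) (b' := b') (by
    by_contra hc
    push Not at hc
    rw [rkc, rkc, Finset.sum_congr rfl fun i hi => by rw [hc i (Finset.mem_range.1 hi)]] at h
    grind)
  refine ⟨l, hl, h1, ?_⟩
  by_contra hc
  exact absurd (rkc_lt hl (fun i a b => (h1 i a b).symm) (fun i hi => hb' i l hi hl) (by omega)) (by omega)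

lemma rkc_inj {k : ℕ} {b b' : ℕ → ℕ} (hb : Mon k b) (hb' : Mon k b') (h : rkc k b = rkc k b') : ∀ i < k, b i = b' i := by
  by_contra hc
  push Not at hc
  obtain ⟨l, hl, h1, h2⟩ := rkc_top hc
  rcases lt_or_gt_of_ne h2 with h3 | h3
  · exact absurd (rkc_lt hl h1 (fun i hi => hb i l hi hl) h3) (by omega)
  · exact absurd (rkc_lt hl (fun i a b => (h1 i a b).symm) (fun i hi => hb' i l hi hl) h3) (by omega)

def mk (e k : ℕ) (b : ℕ → ℕ) (i : ℕ) : ℕ := if i < e - k then 0 else b (i - (e - k)) + 1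

lemma mk_spec {e k : ℕ} {b : ℕ → ℕ} (hk : k ≤ e) (hb : Mon k b) :
    Mon e (mk e k b) ∧ (∀ i < e, (0 < mk e k b i ↔ e - k ≤ i)) ∧ bt e (mk e k b) k = b := by
  refine ⟨fun i j hij hj => ?_, fun i hi => ?_, ?_⟩
  · simp only [mk]
    split_ifs with h1 h2
    · rfl
    · omega
    · omega
    · have := hb (i - (e - k)) (j - (e - k)) (by omega) (by omega); omega
  · simp only [mk]; grind
  · ext i; simp [bt, mk]

lemma bt_mon {e k : ℕ} {a : ℕ → ℕ} (hk : k ≤ e) (ha : Mon e a) : Mon k (bt e a k) := by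
  intro i j hij hj
  have := ha (e - k + i) (e - k + j) (by omega) (by omega)
  simp only [bt]; omega

section
variable {e k : ℕ} {a a' : ℕ → ℕ}

/-- comparison at level `k` -/
lemma Phi_cmp (hk : 1 ≤ k) (hke : k ≤ e) (ha : Mon e a) (ha' : Mon e a') (h0 : 0 < a (e - k))
    (hd : ∀ i < e, (0 < a' i ↔ e - k ≤ i)) (h : rkc k (bt e a k) < rkc k (bt e a' k)) :
    2 * e * Phi' e a (2 * (e - k)) < Phi' e a' (2 * (e - k)) := by
  obtain ⟨l, hl, h1, h2⟩ := rkc_colex (bt_mon hke ha') h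
  have p : ∀ i < k, 0 < a (e - k + i) ∧ 0 < a' (e - k + i) := fun i hi =>
    ⟨lt_of_lt_of_le h0 (ha _ _ (by omega) (by omega)), (hd _ (by omega)).2 (by omega)⟩
  refine Phi_lt ha (l := e - k + l) (by omega) (fun i h3 h4 => ?_) ?_ (by have := p l hl; omega) fun i hi => ?_
  · have := h1 (i - (e - k)) (by omega) (by omega)
    have := p (i - (e - k)) (by omega)
    simp only [bt] at *
    grind
  · have := p l hl
    simp only [bt] at h2; omega
  grind

lemma Phi_one (hd : ∀ i < e, (0 < a' i ↔ e - k ≤ i)) : 1 ≤ Phi' e a' (2 * (e - k)) :=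
  Finset.one_le_prod fun i hi => by
    have := hd i (Finset.mem_range.1 hi)
    exact psi_one (by omega) (by omega)

lemma Phi_zero (hk : 1 ≤ k) (hke : k ≤ e) (h0 : a (e - k) = 0) : Phi' e a (2 * (e - k)) = 0 :=
  Finset.prod_eq_zero (i := e - k) (Finset.mem_range.2 (by omega)) (by rw [h0]; simp [psi])
end

lemma exists_kappa (e : ℕ) (g : ℕ → ℕ) (g0 : g 0 = 1)
    (hg : ∀ k b, k + 1 ≤ e → rkc (k + 1) b < g (k + 1) → rkc k (fun i => b (i + 1)) < g k) (N : ℕ) :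
    ∃ κ : ℕ → ℝ, (∀ j, 0 ≤ κ j) ∧
      (∀ a, Mon e a → Mem e g a → ∑ j ∈ Finset.Icc 1 e, κ j * Phi' e a (2 * (e - j)) < 1) ∧
      (∀ a, Mon e a → ¬ Mem e g a → 1 < ∑ j ∈ Finset.Icc 1 e, κ j * Phi' e a (2 * (e - j))) ∧
      ∀ G ∈ Finset.powersetCard (2 * e) (Finset.range N),
        ∑ j ∈ Finset.Icc 1 e, κ j * ∏ i ∈ G, (tt e (2 * (e - j)) - tt e i) ≠ 1 := by
  have hex : ∀ j, ∃ b, 1 ≤ j → Mon j b ∧ rkc j b = g j := fun j => by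
    by_cases hj : 1 ≤ j
    · obtain ⟨b, hb⟩ := rkc_surj j (g j) (by omega); grind
    · exact ⟨fun _ => 0, fun h => absurd h hj⟩
  choose b hb using hex
  let P : ℕ → ℝ := fun j => Phi' e (mk e j (b j)) (2 * (e - j))
  have P1 : ∀ j ∈ Finset.Icc 1 e, 1 ≤ P j := fun j hj => by
    rw [Finset.mem_Icc] at hj
    exact Phi_one (mk_spec hj.2 (hb j hj.1).1).2.1
  obtain ⟨s, hs, hs'⟩ := (Set.Ioo_infinite (show (1 / 2 : ℝ) < 1 by norm_num)).exists_notMem_finset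
    ((Finset.powersetCard (2 * e) (Finset.range N)).image fun G =>
      (∑ j ∈ Finset.Icc 1 e, 2 / P j * ∏ i ∈ G, (tt e (2 * (e - j)) - tt e i))⁻¹)
  have fac : ∀ Q : ℕ → ℝ, ∑ j ∈ Finset.Icc 1 e, s * |2 / P j| * Q j = s * ∑ j ∈ Finset.Icc 1 e, 2 / P j * Q j := fun Q => by
    rw [Finset.mul_sum]
    refine Finset.sum_congr rfl fun j hj => ?_
    grind
  have s0 : 0 < s := by have := hs.1; linarith
  refine ⟨fun j => s * |2 / P j|, fun j => by positivity, fun a ha hm => ?_, fun a ha hm => ?_, fun G hG h => hs' ?_⟩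
  · rw [fac]
    have : ∀ j ∈ Finset.Icc 1 e, 2 / P j * Phi' e a (2 * (e - j)) ≤ 1 / e := by
      intro j hj
      have p1 := P1 j hj
      rw [Finset.mem_Icc] at hj
      have he : (0 : ℝ) < e := by exact_mod_cast (by omega : 0 < e)
      by_cases h0 : a (e - j) = 0
      · rw [Phi_zero hj.1 hj.2 h0]; simp
      · have hm' := hm j hj.2 (fun _ => by omega)
        have ms := mk_spec hj.2 (hb j hj.1).1
        rw [← (hb j hj.1).2] at hm'
        have := Phi_cmp hj.1 hj.2 ha ms.1 (by omega) ms.2.1 (by rw [ms.2.2]; exact hm')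
        rw [div_mul_eq_mul_div, div_le_div_iff₀ (by linarith) he]
        grind
    have := Finset.sum_le_sum this
    rw [Finset.sum_const, Nat.card_Icc, nsmul_eq_mul] at this
    have h1 : ((e + 1 - 1 : ℕ) : ℝ) * (1 / e) ≤ 1 := by
      rw [Nat.add_sub_cancel, mul_one_div]; exact div_self_le_one _
    have h2 := hs.2
    have h3 : 0 ≤ ∑ j ∈ Finset.Icc 1 e, 2 / P j * Phi' e a (2 * (e - j)) := Finset.sum_nonneg fun j hj => by
      have := P1 j hj
      have := Phi_nonneg e a (2 * (e - j))
      positivity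
    nlinarith
  · rw [fac]
    obtain ⟨k, hk, hd⟩ := exists_deg e a ha
    have hr : g k ≤ rkc k (bt e a k) := by
      by_contra hc
      exact hm (mem_of_deg hg hk hd (by omega))
    have k1 : 1 ≤ k := by
      by_contra hc
      obtain rfl : k = 0 := by omega
      rw [g0] at hr; simp [rkc] at hr
    have hj : k ∈ Finset.Icc 1 e := Finset.mem_Icc.2 ⟨k1, hk⟩
    have p1 := P1 k hj
    have h2 : P k ≤ Phi' e a (2 * (e - k)) := by
      have ms := mk_spec hk (hb k k1).1
      rcases hr.lt_or_eq with h | h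
      · have := Phi_cmp k1 hk ms.1 ha ((ms.2.1 _ (by omega)).2 (by omega)) hd (by rw [ms.2.2, (hb k k1).2]; exact h)
        have he : (1 : ℝ) ≤ e := by exact_mod_cast (by omega : 1 ≤ e)
        change 2 * e * P k < _ at this
        nlinarith
      · have h3 := rkc_inj (hb k k1).1 (bt_mon hk ha) ((hb k k1).2.trans h)
        refine le_of_eq (Finset.prod_congr rfl fun i hi => ?_)
        congr 2
        have hi := Finset.mem_range.1 hi
        have h4 := hd i hi
        simp only [mk]
        split_ifs with h5
        · omega
        · have := h3 (i - (e - k)) (by omega)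
          simp only [bt] at this
          grind
    have h3 : 2 ≤ 2 / P k * Phi' e a (2 * (e - k)) := by
      rw [div_mul_eq_mul_div, le_div_iff₀ (by linarith)]; linarith
    have h4 := h3.trans (Finset.single_le_sum (f := fun j => 2 / P j * Phi' e a (2 * (e - j))) (fun j hj => by
      have := P1 j hj
      have := Phi_nonneg e a (2 * (e - j))
      positivity) hj)
    have := hs.1
    nlinarith
  · rw [fac] at h
    grind

/-- Homogeneous simplicial vector configuration. -/
structure VC (d : ℕ) (ι V : Type) [AddCommGroup V] [Module ℝ V] where
  X : ι → V
  w : V →ₗ[ℝ] ℝ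
  wpos : ∀ i, 0 < w (X i)
  ti : ∀ p : V →ₗ[ℝ] ℝ, p ≠ 0 → (∀ i, 0 ≤ p (X i)) → LinearIndepOn ℝ X {i | p (X i) = 0}
  sp : Submodule.span ℝ (Set.range X) = ⊤
  fd : FiniteDimensional ℝ V
  fr : Module.finrank ℝ V = d + 1

def VC.IsFac {d : ℕ} {ι V : Type} [AddCommGroup V] [Module ℝ V] (c : VC d ι V) (F : Finset ι) : Prop :=
  F.card = d ∧ ∃ p : V →ₗ[ℝ] ℝ, p ≠ 0 ∧ (∀ i, 0 ≤ p (c.X i)) ∧ ∀ i, i ∈ F ↔ p (c.X i) = 0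

noncomputable def qS (e : ℕ) (S : Finset ℕ) : ℝ[X] := ∏ i ∈ S, (X - C (tt e i))

noncomputable def lam (e N : ℕ) (κ : ℕ → ℝ) : Option (Fin N) → ℝ[X] →ₗ[ℝ] ℝ
  | none => lcoeff ℝ (2 * e) - ∑ j ∈ Finset.Icc 1 e, κ j • leval (tt e (2 * (e - j)))
  | some i => leval (tt e i)

def phn (N n : ℕ) : Option (Fin N) := if h : n < N then some ⟨n, h⟩ else none

lemma eval_qS (e : ℕ) (S : Finset ℕ) (x : ℝ) : (qS e S).eval x = ∏ i ∈ S, (x - tt e i) := by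
  simp [qS, eval_prod]

lemma pos_disj {e : ℕ} {a : ℕ → ℕ} (ha : Mon e a) :
    ((Finset.range e : Finset ℕ) : Set ℕ).PairwiseDisjoint fun l => ({a l + 2 * l, a l + 2 * l + 1} : Finset ℕ) := by
  intro l hl m hm hne
  simp only [Finset.coe_range, Set.mem_Iio] at hl hm
  rw [Function.onFun, Finset.disjoint_left]
  intro x h1 h2
  simp only [Finset.mem_insert, Finset.mem_singleton] at h1 h2
  rcases lt_or_gt_of_ne hne with h | h
  · have := ha l m h.le hm; omega
  · have := ha m l h.le hl; omega

lemma card_pos' {e : ℕ} {a : ℕ → ℕ} (ha : Mon e a) : (pos e a).card = 2 * e := by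
  rw [pos, Finset.card_biUnion (pos_disj ha), Finset.sum_congr rfl fun l _ => Finset.card_pair (by omega)]
  simp [mul_comm]

lemma prod_pos' {e : ℕ} {a : ℕ → ℕ} (ha : Mon e a) (r : ℕ) : ∏ i ∈ pos e a, (tt e r - tt e i) = Phi' e a r := by
  rw [pos, Finset.prod_biUnion (pos_disj ha), Phi']
  exact Finset.prod_congr rfl fun l _ => Finset.prod_pair (by omega)

lemma pos_lt {e : ℕ} {g : ℕ → ℕ} {a : ℕ → ℕ} (ha : Mon e a) (hm : Mem e g a) : ∀ x ∈ pos e a, x < g 1 + 2 * e := by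
  intro x hx
  obtain ⟨l, hl, h⟩ := mem_pos.1 hx
  have h1 := ha l (e - 1) (by omega) (by omega)
  by_cases h0 : a (e - 1) = 0
  · omega
  · have := hm 1 (by omega) (fun _ => by omega)
    simp [rkc, bt] at this
    omega

lemma lam_none (e N : ℕ) (κ : ℕ → ℝ) (S : Finset ℕ) (hS : S.card = 2 * e) :
    lam e N κ none (qS e S) = 1 - ∑ j ∈ Finset.Icc 1 e, κ j * ∏ i ∈ S, (tt e (2 * (e - j)) - tt e i) := by
  have h : (qS e S).coeff (2 * e) = 1 := by
    have h1 : (qS e S).Monic := monic_prod_X_sub_C _ _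
    have h2 : (qS e S).natDegree = 2 * e := (natDegree_finsetProd_X_sub_C_eq_card _ _).trans hS
    rw [← h2]; exact h1
  simp [lam, h, LinearMap.sum_apply, eval_qS]

lemma parity (e : ℕ) (S : Finset ℕ) (x : ℕ) (hx : x ∉ S) (h : 0 ≤ ∏ i ∈ S, (tt e x - tt e i)) :
    Even (S.filter fun y => x < y).card := by
  rw [← Finset.prod_filter_mul_prod_filter_not S (fun y => x < y)] at h
  have h1 : ∏ i ∈ S.filter (fun y => x < y), (tt e x - tt e i) =
      (-1) ^ (S.filter fun y => x < y).card * ∏ i ∈ S.filter (fun y => x < y), (tt e i - tt e x) := by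
    rw [← Finset.prod_neg]; simp
  have h2 : 0 < ∏ i ∈ S.filter (fun y => x < y), (tt e i - tt e x) := Finset.prod_pos fun i hi =>
    sub_pos.2 (tt_mono e (Finset.mem_filter.1 hi).2)
  have h3 : 0 < ∏ i ∈ S.filter (fun y => ¬ x < y), (tt e x - tt e i) := Finset.prod_pos fun i hi => by
    rw [Finset.mem_filter] at hi
    have : i ≠ x := by rintro rfl; grind
    exact sub_pos.2 (tt_mono e (by omega))
  by_contra hc
  rw [Nat.not_even_iff_odd] at hc
  rw [h1, hc.neg_one_pow] at h
  nlinarith [mul_pos h2 h3]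

noncomputable def fn (n : ℕ) (q : ℝ[X]) : (Fin n → ℝ) →ₗ[ℝ] ℝ := ∑ j : Fin n, q.coeff j • LinearMap.proj j

noncomputable def pol {n : ℕ} (p : (Fin n → ℝ) →ₗ[ℝ] ℝ) : ℝ[X] := ∑ j : Fin n, C (p fun k => if j = k then 1 else 0) * X ^ (j : ℕ)

lemma fn_apply {n : ℕ} (q : ℝ[X]) (hq : q.natDegree < n) (l : ℝ[X] →ₗ[ℝ] ℝ) : fn n q (fun j => l (X ^ (j : ℕ))) = l q := by
  conv_rhs => rw [q.as_sum_range' n hq]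
  rw [fn, LinearMap.sum_apply, map_sum, Finset.sum_range]
  refine Finset.sum_congr rfl fun j _ => ?_
  rw [← C_mul_X_pow_eq_monomial, ← smul_eq_C_mul, map_smul]; rfl

lemma pol_apply {n : ℕ} (p : (Fin n → ℝ) →ₗ[ℝ] ℝ) (l : ℝ[X] →ₗ[ℝ] ℝ) : p (fun j => l (X ^ (j : ℕ))) = l (pol p) := by
  rw [LinearMap.pi_apply_eq_sum_univ, pol, map_sum]
  refine Finset.sum_congr rfl fun j _ => ?_
  rw [← smul_eq_C_mul, map_smul, smul_eq_mul, smul_eq_mul, mul_comm]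

lemma pol_coeff {n : ℕ} (p : (Fin n → ℝ) →ₗ[ℝ] ℝ) (m : ℕ) (hm : n ≤ m) : (pol p).coeff m = 0 := by
  rw [pol, finsetSum_coeff]
  refine Finset.sum_eq_zero fun j _ => ?_
  grind

lemma pol_ne {n : ℕ} (p : (Fin n → ℝ) →ₗ[ℝ] ℝ) (h : pol p = 0) : p = 0 := by
  ext j
  have : (fun i : Fin n => lcoeff ℝ (j : ℕ) (X ^ (i : ℕ))) = Pi.single j 1 := by
    ext i; simp [coeff_X_pow, Pi.single_apply, Fin.ext_iff, eq_comm]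
  have h2 := pol_apply p (lcoeff ℝ j)
  rw [this, h] at h2
  simpa using h2

lemma phi_inj (N : ℕ) : ∀ x < N, ∀ y < N, phn N x = phn N y → x = y := by
  intro x hx y hy h
  simpa [phn, hx, hy] using h

theorem even_vc (e : ℕ) (g : ℕ → ℕ) (g0 : g 0 = 1)
    (hg : ∀ k b, k + 1 ≤ e → rkc (k + 1) b < g (k + 1) → rkc k (fun i => b (i + 1)) < g k) (N : ℕ) (hN : N = g 1 + 2 * e) :
    ∃ c : VC (2 * e) (Option (Fin N)) (Fin (2 * e + 1) → ℝ), ∀ F : Finset (Option (Fin N)), none ∉ F →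
      (c.IsFac F ↔ ∃ a, Mon e a ∧ Mem e g a ∧ F = (pos e a).image (phn N)) := by
  obtain ⟨κ, k0, k1, k2, k3⟩ := exists_kappa e g g0 hg N
  let Y : Option (Fin N) → Fin (2 * e + 1) → ℝ := fun o j => lam e N κ o (X ^ (j : ℕ))
  have hfn : ∀ q : ℝ[X], q.natDegree < 2 * e + 1 → ∀ o, fn _ q (Y o) = lam e N κ o q := fun q hq o => fn_apply q hq _
  have hpol : ∀ (p : (Fin (2 * e + 1) → ℝ) →ₗ[ℝ] ℝ) o, p (Y o) = lam e N κ o (pol p) := fun p o => pol_apply p _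
  have hdeg : ∀ S : Finset ℕ, S.card ≤ 2 * e → (qS e S).natDegree < 2 * e + 1 := fun S hS => by
    rw [qS, natDegree_finsetProd_X_sub_C_eq_card]; omega
  have hsome : ∀ (i : Fin N) (q : ℝ[X]), lam e N κ (some i) q = q.eval (tt e i) := fun i q => rfl
  have ind : ∀ G : Finset (Fin N), G.card = 2 * e → LinearIndepOn ℝ Y (Finset.insertNone G : Set (Option (Fin N))) := by
    intro G hG
    rw [linearIndepOn_finset_iff]
    intro f hf
    have key : ∀ q : ℝ[X], q.natDegree < 2 * e + 1 → f none * lam e N κ none q + ∑ i ∈ G, f (some i) * q.eval (tt e i) = 0 := by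
      intro q hq
      have := congrArg (fn (2 * e + 1) q) hf
      rw [map_zero, map_sum, Finset.sum_insertNone] at this
      simpa [map_smul, hfn q hq, hsome] using this
    have hc : (G.map Fin.valEmbedding).card = 2 * e := by grind
    have h0 : f none = 0 := by
      have := key (qS e (G.map Fin.valEmbedding)) (hdeg _ hc.le)
      rw [Finset.sum_eq_zero, add_zero, lam_none _ _ _ _ hc] at this
      · refine (mul_eq_zero.1 this).resolve_right (sub_ne_zero.2 (k3 _ ?_).symm)
        rw [Finset.mem_powersetCard]
        refine ⟨fun x hx => ?_, hc⟩
        obtain ⟨i, _, rfl⟩ := Finset.mem_map.1 hx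
        simp
      · intro i hi
        rw [eval_qS, Finset.prod_eq_zero (i := (i : ℕ)) (Finset.mem_map_of_mem Fin.valEmbedding hi) (by simp), mul_zero]
    intro o ho
    cases o with
    | none => exact h0
    | some i =>
      have hi : i ∈ G := by simpa using ho
      have := key (qS e ((G.erase i).map Fin.valEmbedding)) (hdeg _ (by rw [Finset.card_map, Finset.card_erase_of_mem hi]; omega))
      rw [h0, zero_mul, zero_add, Finset.sum_eq_single_of_mem i hi] at this
      · refine (mul_eq_zero.1 this).resolve_right ?_
        rw [eval_qS]
        refine Finset.prod_ne_zero_iff.2 ?_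
        intro x hx
        obtain ⟨m, hm, rfl⟩ := Finset.mem_map.1 hx
        refine sub_ne_zero.2 fun h => ?_
        exact (Finset.mem_erase.1 hm).1 (Fin.ext ((tt_mono e).injective h)).symm
      · intro m hm hne
        rw [eval_qS, Finset.prod_eq_zero (i := (m : ℕ)) (Finset.mem_map_of_mem Fin.valEmbedding (Finset.mem_erase.2 ⟨hne, hm⟩)) (by simp), mul_zero]
  obtain ⟨G, -, hG⟩ := Finset.exists_superset_card_eq (s := (∅ : Finset (Fin N))) (n := 2 * e) (by simp) (by simp; omega)
  let ε : ℝ := 1 / (2 * (|lam e N κ none 1| + 1))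
  have hε : 0 < ε := by positivity
  let q0 := qS e (pos e fun _ => 0) + C ε
  have m0 : Mon e fun _ => 0 := fun _ _ _ _ => le_rfl
  let cfg : VC (2 * e) (Option (Fin N)) (Fin (2 * e + 1) → ℝ) := {
    X := Y
    w := fn _ q0
    wpos := by
      have hd : q0.natDegree < 2 * e + 1 := by
        refine lt_of_le_of_lt (natDegree_add_le _ _) ?_
        rw [natDegree_C]
        have := hdeg _ (card_pos' m0).le
        omega
      intro o
      rw [hfn _ hd]
      cases o with
      | none =>
        rw [map_add, lam_none _ _ _ _ (card_pos' m0), Finset.sum_eq_zero, ← mul_one (C ε), ← smul_eq_C_mul, map_smul, smul_eq_mul]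
        · have h1 := neg_abs_le (lam e N κ none 1)
          have h2 : ε * (|lam e N κ none 1| + 1) = 1 / 2 := by
            grind
          nlinarith
        · intro j hj
          rw [Finset.mem_Icc] at hj
          rw [prod_pos' m0, Phi_zero hj.1 hj.2 rfl, mul_zero]
      | some i =>
        rw [hsome, eval_add, eval_C, eval_qS, prod_pos' m0]
        have := Phi_nonneg e (fun _ => 0) i
        linarith
    ti := by
      intro p hp hn
      have hQ : pol p ≠ 0 := fun h => hp (pol_ne p h)
      let T : Finset (Fin N) := Finset.univ.filter fun i => (pol p).eval (tt e i) = 0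
      have hT : T.card ≤ 2 * e := by
        by_contra hc
        refine hQ (eq_zero_of_degree_lt_of_eval_finset_eq_zero (T.image fun i : Fin N => tt e i) ?_ ?_)
        · rw [Finset.card_image_of_injective _ fun i j h => Fin.ext ((tt_mono e).injective h), degree_lt_iff_coeff_zero]
          exact fun m hm => pol_coeff p m (by omega)
        grind
      obtain ⟨G, hTG, hG⟩ := Finset.exists_superset_card_eq hT (by simp; omega)
      refine (ind G hG).mono ?_
      intro o ho
      cases o with
      | none => simp
      | some i =>
        simp only [Finset.mem_coe, Finset.some_mem_insertNone]
        grind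
    sp := by
      have h := ind G hG
      have : Nonempty (Finset.insertNone G : Set (Option (Fin N))) := ⟨none, by simp⟩
      have := LinearIndependent.span_eq_top_of_card_eq_finrank h (by rw [← Nat.card_eq_fintype_card, Nat.card_coe_set_eq, Set.ncard_coe_finset, Finset.card_insertNone, hG, Module.finrank_fin_fun])
      rw [eq_top_iff, ← this]
      refine Submodule.span_mono ?_
      rintro _ ⟨o, rfl⟩
      grind
    fd := inferInstance
    fr := by simp }
  refine ⟨cfg, fun F hF => ⟨?_, ?_⟩⟩
  · rintro ⟨hc, p, hp, hn, ht⟩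
    change ∀ i, 0 ≤ p (Y i) at hn
    change ∀ i, i ∈ F ↔ p (Y i) = 0 at ht
    simp only [hpol] at hn ht
    set Q := pol p
    have hL : 0 < lam e N κ none Q := lt_of_le_of_ne (hn none) fun h => hF ((ht none).2 h.symm)
    let S : Finset ℕ := (Finset.eraseNone F).map Fin.valEmbedding
    have hFS : F = S.image (phn N) := by
      ext o
      cases o with
      | none => 
        simp only [hF, Finset.mem_image, false_iff, not_exists, not_and]
        intro x hx
        obtain ⟨i, _, rfl⟩ := Finset.mem_map.1 hx
        simp [phn]
      | some i => 
        simp only [Finset.mem_image, S, Finset.mem_map, Finset.mem_eraseNone]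
        constructor
        · intro h; exact ⟨i, ⟨i, h, rfl⟩, by simp [phn]⟩
        · rintro ⟨_, ⟨j, h, rfl⟩, h2⟩
          simp [phn] at h2; rwa [← h2]
    have hS : S.card = 2 * e := by
      rw [Finset.card_map, ← hc, ← Finset.card_map Function.Embedding.some, Finset.map_some_eraseNone, Finset.erase_eq_of_notMem hF]
    have hmem : ∀ i : Fin N, (i : ℕ) ∈ S ↔ some i ∈ F := by
      intro i
      simp only [S, Finset.mem_map, Finset.mem_eraseNone]
      constructor
      · rintro ⟨j, h, h2⟩; rwa [← Fin.ext h2]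
      · intro h; exact ⟨i, h, rfl⟩
    have hSN : ∀ x ∈ S, x < N := by
      intro x hx
      obtain ⟨i, _, rfl⟩ := Finset.mem_map.1 hx
      exact i.2
    have hQ : Q = C (Q.coeff (2 * e)) * qS e S := by
      have hm : (qS e S).Monic := monic_prod_X_sub_C _ _
      have hd2 : (qS e S).natDegree = 2 * e := (natDegree_finsetProd_X_sub_C_eq_card _ _).trans hS
      refine sub_eq_zero.1 (eq_zero_of_degree_lt_of_eval_finset_eq_zero (S.image (tt e)) ?_ ?_)
      · rw [Finset.card_image_of_injective _ (tt_mono e).injective, hS, degree_lt_iff_coeff_zero]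
        intro m hm'
        rw [coeff_sub, coeff_C_mul]
        rcases hm'.eq_or_lt with rfl | h
        · have : (qS e S).coeff (2 * e) = 1 := by rw [← hd2]; exact hm
          grind
        · rw [pol_coeff p m (by omega), coeff_eq_zero_of_natDegree_lt (p := qS e S) (by omega)]; ring
      · intro x hx
        obtain ⟨i, hi, rfl⟩ := Finset.mem_image.1 hx
        have h2 := (ht (some ⟨i, hSN i hi⟩)).1 ((hmem ⟨i, hSN i hi⟩).1 hi)
        rw [hsome] at h2
        rw [eval_sub, eval_mul, eval_qS, Finset.prod_eq_zero hi (by simp), h2]; simp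
    set c := Q.coeff (2 * e)
    have hL2 : lam e N κ none Q = c * lam e N κ none (qS e S) := by
      conv_lhs => rw [hQ, ← smul_eq_C_mul, map_smul, smul_eq_mul]
    have hev : ∀ x < N, 0 ≤ c * ∏ i ∈ S, (tt e x - tt e i) := by
      intro x hx
      have := hn (some ⟨x, hx⟩)
      rw [hsome, hQ, eval_mul, eval_C, eval_qS] at this
      exact this
    have hcpos : 0 < c := by
      rcases lt_trichotomy c 0 with h | h | h
      · exfalso
        have : 0 < lam e N κ none (qS e S) := by
          rw [lam_none _ _ _ _ hS]
          have : ∑ j ∈ Finset.Icc 1 e, κ j * ∏ i ∈ S, (tt e (2 * (e - j)) - tt e i) ≤ 0 :=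
            Finset.sum_nonpos fun j hj => mul_nonpos_of_nonneg_of_nonpos (k0 j) (by
              rw [Finset.mem_Icc] at hj
              have := hev (2 * (e - j)) (by omega)
              by_contra hc; push Not at hc
              nlinarith [mul_pos (neg_pos.2 h) hc])
          linarith
        rw [hL2] at hL
        nlinarith [mul_pos (neg_pos.2 h) this]
      · grind
      · exact h
    obtain ⟨a, ha, hSa⟩ := gale e S hS fun x ⟨y, hy, hxy⟩ hx =>
      parity e S x hx (nonneg_of_mul_nonneg_right (hev x (by have := hSN y hy; omega)) hcpos)
    refine ⟨a, ha, ?_, by grind⟩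
    by_contra hm
    have h2 := k2 a ha hm
    rw [hL2, lam_none _ _ _ _ hS, hSa, Finset.sum_congr rfl fun j _ => by rw [prod_pos' ha]] at hL
    nlinarith
  · rintro ⟨a, ha, hm, rfl⟩
    have hlt := pos_lt ha hm
    have hc := card_pos' ha
    have hpos : 0 < lam e N κ none (qS e (pos e a)) := by
      rw [lam_none _ _ _ _ hc, Finset.sum_congr rfl fun j _ => by rw [prod_pos' ha]]
      grind
    have hfn' := hfn (qS e (pos e a)) (hdeg _ hc.le)
    refine ⟨?_, fn _ (qS e (pos e a)), ?_, ?_, ?_⟩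
    · rw [Finset.card_image_of_injOn, hc]
      intro x hx y hy h
      exact phi_inj N x (hN ▸ hlt x hx) y (hN ▸ hlt y hy) h
    · intro h
      have := hfn' none
      rw [h, LinearMap.zero_apply] at this
      linarith
    · intro o
      change 0 ≤ fn _ _ (Y o)
      rw [hfn']
      cases o with
      | none => grind
      | some i => rw [hsome, eval_qS, prod_pos' ha]; exact Phi_nonneg _ _ _
    · intro o
      change _ ↔ fn _ _ (Y o) = 0
      rw [hfn']
      cases o with
      | none => grind
      | some i =>
        rw [hsome, eval_qS, Finset.prod_eq_zero_iff, Finset.mem_image]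
        constructor
        · rintro ⟨x, hx, h⟩
          have := hlt x hx
          rw [phn, dif_pos (by omega)] at h
          grind
        · rintro ⟨x, hx, h⟩
          rw [sub_eq_zero] at h
          have := (tt_mono e).injective h
          exact ⟨x, hx, by rw [← this]; simp [phn]⟩

lemma lio_iff {ι V : Type} [Fintype ι] [AddCommGroup V] [Module ℝ V] (v : ι → V) (s : Set ι) :
    LinearIndepOn ℝ v s ↔ ∀ f : ι → ℝ, (∀ i ∉ s, f i = 0) → ∑ i, f i • v i = 0 → ∀ i, f i = 0 := by
  have : s = (s.toFinset : Set ι) := by simp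
  rw [this, linearIndepOn_finset_iff]
  constructor
  · intro h f h1 h2 i
    by_cases hi : i ∈ s
    · refine h f ?_ i (by grind)
      rw [← h2]
      exact Finset.sum_subset (Finset.subset_univ _) fun i _ hi => by rw [h1 i (by grind), zero_smul]
    grind
  · intro h f h1 i hi
    have := h (fun i => if i ∈ s.toFinset then f i else 0) (fun i hi => if_neg hi) (by
      simp only [ite_smul, zero_smul]
      rw [Finset.sum_ite_mem, Finset.univ_inter]; exact h1) i
    grind

theorem odd_vc {d : ℕ} {κ V : Type} [Fintype κ] [AddCommGroup V] [Module ℝ V] (c : VC d (Option κ) V) :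
    ∃ c' : VC (d + 1) (Option (Option κ)) (V × ℝ), ∀ F : Finset (Option (Option κ)), none ∉ F →
      (c'.IsFac F ↔ ∃ F0, none ∉ F0 ∧ c.IsFac F0 ∧ F = insert (some none) (F0.image some)) := by
  have := c.fd
  let Y : Option (Option κ) → V × ℝ
    | none => (c.X none, -1)
    | some j => (c.X j, if j = none then 1 else 0)
  have Yn : Y none = (c.X none, -1) := rfl
  have Ysn : Y (some none) = (c.X none, 1) := rfl
  have Yss : ∀ i, Y (some (some i)) = (c.X (some i), 0) := fun i => by simp [Y]
  have dec : ∀ P : V × ℝ →ₗ[ℝ] ℝ, ∃ (p : V →ₗ[ℝ] ℝ) (γ : ℝ), ∀ v r, P (v, r) = p v + r * γ := fun P =>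
    ⟨P ∘ₗ LinearMap.inl ℝ V ℝ, P (0, 1), fun v r => by
      have : ((v, r) : V × ℝ) = (v, 0) + r • (0, 1) := by simp
      rw [this, map_add, map_smul]; simp⟩
  have good : ∀ (P : V × ℝ →ₗ[ℝ] ℝ) (p : V →ₗ[ℝ] ℝ) (γ : ℝ), (∀ v r, P (v, r) = p v + r * γ) → P ≠ 0 → (∀ o, 0 ≤ P (Y o)) →
      p ≠ 0 ∧ (∀ j, 0 ≤ p (c.X j)) := by
    intro P p γ h hP hn
    have h1 := hn none
    have h2 := hn (some none)
    rw [Yn, h] at h1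
    rw [Ysn, h] at h2
    refine ⟨?_, fun j => ?_⟩
    · rintro rfl
      apply hP
      have : γ = 0 := by simp at h1 h2; linarith
      ext v <;> simp [h, this]
    · cases j with
      | none => linarith
      | some i => have := hn (some (some i)); rw [Yss, h] at this; linarith
  let cfg : VC (d + 1) (Option (Option κ)) (V × ℝ) := {
    X := Y
    w := c.w ∘ₗ LinearMap.fst ℝ V ℝ
    wpos := fun o => by cases o with
      | none => exact c.wpos none
      | some j => exact c.wpos j
    ti := by
      intro P hP hn
      obtain ⟨p, γ, h⟩ := dec P
      obtain ⟨hp, hn'⟩ := good P p γ h hP hn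
      have hi := (lio_iff _ _).1 (c.ti p hp hn')
      rw [lio_iff]
      intro f hf hs
      simp only [Fintype.sum_option, Yn, Ysn, Yss] at hs
      have e1 := congrArg Prod.fst hs
      have e2 := congrArg Prod.snd hs
      simp only [Prod.fst_add, Prod.snd_add, Prod.fst_sum, Prod.snd_sum, Prod.smul_fst, Prod.smul_snd, Prod.fst_zero, Prod.snd_zero,
        smul_eq_mul, mul_zero, Finset.sum_const_zero, mul_one] at e1 e2
      have e3 : f (some none) = f none := by linarith
      have key := hi (fun j => Option.rec (f none + f (some none)) (fun i => f (some (some i))) j) (fun j hj => by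
        cases j with
        | none =>
          grind
        | some i => grind) (by
        rw [Fintype.sum_option, ← e1]
        simp only [add_smul, add_assoc])
      intro o
      have k0 : f none + f (some none) = 0 := key none
      rcases o with _ | _ | i
      · linarith
      · linarith
      · exact key (some i)
    sp := by
      rw [eq_top_iff]
      have hY : ∀ o, Y o ∈ Submodule.span ℝ (Set.range Y) := fun o => Submodule.subset_span ⟨o, rfl⟩
      have h1 : ((0, 1) : V × ℝ) ∈ Submodule.span ℝ (Set.range Y) := by
        have := Submodule.smul_mem _ (1 / 2 : ℝ) (Submodule.sub_mem _ (hY (some none)) (hY none))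
        convert this using 1
        rw [Yn, Ysn]; ext <;> simp; norm_num
      have h2 : Submodule.span ℝ (Set.range c.X) ≤ (Submodule.span ℝ (Set.range Y)).comap (LinearMap.inl ℝ V ℝ) := by
        rw [Submodule.span_le]
        rintro _ ⟨j, rfl⟩
        cases j with
        | none =>
          have := Submodule.sub_mem _ (hY (some none)) h1
          rw [Ysn] at this; simpa using this
        | some i => have := hY (some (some i)); rw [Yss] at this; exact this
      rintro ⟨v, r⟩ -
      have h3 : v ∈ Submodule.span ℝ (Set.range c.X) := by rw [c.sp]; trivial
      have h4 : ((v, 0) : V × ℝ) ∈ Submodule.span ℝ (Set.range Y) := h2 h3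
      have := Submodule.add_mem _ h4 (Submodule.smul_mem _ r h1)
      simpa using this
    fd := inferInstance
    fr := by rw [Module.finrank_prod, c.fr, Module.finrank_self] }
  refine ⟨cfg, fun F hF => ⟨?_, ?_⟩⟩
  · rintro ⟨hc, P, hP, hn, ht⟩
    change ∀ o, 0 ≤ P (Y o) at hn
    change ∀ i, i ∈ F ↔ P (Y i) = 0 at ht
    obtain ⟨p, γ, h⟩ := dec P
    obtain ⟨hp, hn'⟩ := good P p γ h hP hn
    let F0 : Finset (Option κ) := (Finset.eraseNone F).erase none
    have hF0 : F0.image some = F.erase (some none) := by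
      ext o
      simp only [F0, Finset.mem_image, Finset.mem_erase, Finset.mem_eraseNone]
      grind
    have hm : ∀ i, some i ∈ F0 ↔ p (c.X (some i)) = 0 := fun i => by
      simp only [F0, Finset.mem_erase, Finset.mem_eraseNone, ne_eq, reduceCtorEq, not_false_eq_true, true_and]
      grind
    have hcard : F0.card = (F.erase (some none)).card := by
      rw [← hF0, Finset.card_image_of_injective _ (Option.some_injective _)]
    have hsn : some none ∈ F := by
      by_contra hcon
      rw [Finset.erase_eq_of_notMem hcon, hc] at hcard
      have hi : LinearIndepOn ℝ c.X (F0 : Set (Option κ)) := (c.ti p hp hn').mono fun j hj => by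
        cases j with
        | none => grind
        | some i => grind
      have : Nonempty (F0 : Set (Option κ)) := by
        obtain ⟨x, hx⟩ := Finset.card_pos.1 (by omega : 0 < F0.card); exact ⟨x, hx⟩
      have hsp := LinearIndependent.span_eq_top_of_card_eq_finrank hi (by
        rw [← Nat.card_eq_fintype_card, Nat.card_coe_set_eq, Set.ncard_coe_finset, hcard, c.fr])
      refine hp (LinearMap.ext_on_range hsp fun j => ?_)
      obtain ⟨j, hj⟩ := j
      cases j with
      | none => grind
      | some i => simpa using (hm i).1 hj
    have h1 := (ht _).1 hsn
    have h2 := lt_of_le_of_ne (hn none) fun h => hF ((ht none).2 h.symm)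
    rw [Ysn, h] at h1
    rw [Yn, h] at h2
    refine ⟨F0, by simp [F0], ⟨by rw [hcard, Finset.card_erase_of_mem hsn, hc]; rfl, p, hp, hn', fun j => ?_⟩,
      by grind⟩
    cases j with
    | none => 
      grind
    | some i => exact hm i
  · rintro ⟨F0, hn0, ⟨hc, p, hp, hn, ht⟩, rfl⟩
    have hz : 0 < p (c.X none) := lt_of_le_of_ne (hn none) fun h => hn0 ((ht none).2 h.symm)
    refine ⟨?_, p ∘ₗ LinearMap.fst ℝ V ℝ - p (c.X none) • LinearMap.snd ℝ V ℝ, ?_, ?_, ?_⟩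
    · rw [Finset.card_insert_of_notMem (by grind), Finset.card_image_of_injective _ (Option.some_injective _), hc]
    · intro h
      have := LinearMap.congr_fun h (Y none)
      rw [Yn] at this
      simp at this; linarith
    · intro o
      change 0 ≤ (_ : V × ℝ →ₗ[ℝ] ℝ) (Y o)
      rcases o with _ | _ | i
      · rw [Yn]; simp; linarith
      · rw [Ysn]; simp
      · rw [Yss]; simpa using hn (some i)
    · intro o
      change _ ↔ (_ : V × ℝ →ₗ[ℝ] ℝ) (Y o) = 0
      rcases o with _ | _ | i
      · rw [Yn]; simp; linarith
      · rw [Ysn]; simp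
      · rw [Yss]; simpa using ht (some i)

lemma card_Rp {e k : ℕ} {a : ℕ → ℕ} (ha : Mon e a) (hk : k ≤ e) (hd : ∀ i < e, (0 < a i ↔ e - k ≤ i)) : (Rp e a).card = k := by
  rw [Rp, Finset.card_image_of_injOn]
  · rw [show (Finset.range e).filter (fun l => 0 < a l) = Finset.Ico (e - k) e by
      ext l
      simp only [Finset.mem_filter, Finset.mem_range, Finset.mem_Ico]
      constructor
      · rintro ⟨h1, h2⟩; exact ⟨(hd l h1).1 h2, h1⟩
      · rintro ⟨h1, h2⟩; exact ⟨h2, (hd l h2).2 h1⟩, Nat.card_Ico]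
    omega
  · intro x hx y hy h
    simp only [Finset.coe_filter, Finset.mem_range, Set.mem_ofPred_eq] at hx hy
    dsimp only at h
    by_contra hne
    rcases lt_or_gt_of_ne hne with h' | h'
    · have := ha x y h'.le hy.1; omega
    · have := ha y x h'.le hx.1; omega

lemma Rp_sub (e : ℕ) (a : ℕ → ℕ) : Rp e a ⊆ pos e a := fun x hx => by
  obtain ⟨l, hl, _, h⟩ := mem_Rp.1 hx
  exact mem_pos.2 ⟨l, hl, Or.inr h⟩

theorem cnt {d : ℕ} {ι E : Type} [Fintype ι] [AddCommGroup E] [Module ℝ E] (s : SD d ι E) (z : ι) (φ : ℕ → ι)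
    (Cc : Finset ι) (e : ℕ) (g : ℕ → ℕ)
    (hg : ∀ k b, k + 1 ≤ e → rkc (k + 1) b < g (k + 1) → rkc k (fun i => b (i + 1)) < g k)
    (hφ : ∀ x < g 1 + 2 * e, ∀ y < g 1 + 2 * e, φ x = φ y → x = y)
    (hC : ∀ x < g 1 + 2 * e, φ x ∉ Cc) (hz : ∀ x < g 1 + 2 * e, φ x ≠ z) (hz' : z ∉ Cc)
    (hfac : ∀ F, z ∉ F → (F ∈ s.fac ↔ ∃ a, Mon e a ∧ Mem e g a ∧ F = Cc ∪ (pos e a).image φ))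
    (hd : 2 * e ≤ d) {k : ℕ} (hk : 1 ≤ k) (hke : k ≤ e) :
    (Hp d s.fac).coeff k - (Hp d s.fac).coeff (k - 1) = g k := by
  obtain ⟨v, hv⟩ := s.exists_generic
  let J : (ℕ → ℕ) → Finset ι := fun a => Cc ∪ (pos e a).image φ
  have hzJ : ∀ a, Mon e a → Mem e g a → z ∉ J a := by
    intro a h1 h2 h
    rcases Finset.mem_union.1 h with h | h
    · exact hz' h
    · obtain ⟨x, hx, h⟩ := Finset.mem_image.1 h
      exact hz x (pos_lt h1 h2 x hx) h
  have im : ∀ a, Mon e a → Mem e g a → ∀ x < g 1 + 2 * e, (φ x ∈ J a ↔ x ∈ pos e a) := by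
    intro a h1 h2 x hx
    refine ⟨fun h => ?_, fun h => Finset.mem_union_right _ (Finset.mem_image_of_mem _ h)⟩
    rcases Finset.mem_union.1 h with h | h
    · exact absurd h (hC x hx)
    · obtain ⟨y, hy, h⟩ := Finset.mem_image.1 h
      rwa [← hφ _ (pos_lt h1 h2 y hy) _ hx h]
  have sub : ∀ a, Mon e a → Mem e g a → ∀ a', Mon e a' → Mem e g a' → (Rp e a).image φ ⊆ J a' → Rp e a ⊆ pos e a' := by
    intro a h1 h2 a' h3 h4 h x hx
    exact (im a' h3 h4 x (pos_lt h1 h2 x (Rp_sub e a hx))).1 (h (Finset.mem_image_of_mem _ hx))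
  have RJ : ∀ a, (Rp e a).image φ ⊆ J a := fun a => (Finset.image_subset_image (Rp_sub e a)).trans Finset.subset_union_right
  have uniq : ∀ a, Mon e a → Mem e g a → ∀ a', Mon e a' → Mem e g a' → (Rp e a).image φ ⊆ J a' → (Rp e a').image φ ⊆ J a →
      ∀ i < e, a i = a' i := fun a h1 h2 a' h3 h4 h5 h6 => pos_uniq h1 h3 (sub a h1 h2 a' h3 h4 h5) (sub a' h3 h4 a h1 h2 h6)
  have congrp : ∀ a a' : ℕ → ℕ, (∀ i < e, a i = a' i) → pos e a = pos e a' ∧ Rp e a = Rp e a' := by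
    intro a a' h
    constructor
    · ext x; rw [mem_pos, mem_pos]
      exact exists_congr fun l => and_congr_right fun hl => by rw [h l hl]
    · ext x; rw [mem_Rp, mem_Rp]
      exact exists_congr fun l => and_congr_right fun hl => by rw [h l hl]
  let Rc : Finset ι → Finset ι := fun F => if h : ∃ a, Mon e a ∧ Mem e g a ∧ F = J a then (Rp e h.choose).image φ else ∅
  have hRc : ∀ a, Mon e a → Mem e g a → Rc (J a) = (Rp e a).image φ := by
    intro a h1 h2
    have h : ∃ a', Mon e a' ∧ Mem e g a' ∧ J a = J a' := ⟨a, h1, h2, rfl⟩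
    simp only [Rc, dif_pos h]
    obtain ⟨h3, h4, h5⟩ := h.choose_spec
    rw [(congrp _ _ (uniq _ h3 h4 a h1 h2 ((RJ _).trans h5.ge) ((RJ _).trans h5.le))).2]
  have cRc : ∀ a, Mon e a → Mem e g a → (Rc (J a)).card = (Rp e a).card := by
    intro a h1 h2
    rw [hRc a h1 h2, Finset.card_image_of_injOn]
    intro x hx y hy h
    exact hφ x (pos_lt h1 h2 x (Rp_sub e a hx)) y (pos_lt h1 h2 y (Rp_sub e a hy)) h
  have hb := (s.shell v hv).ball z Rc (fun F hF => by
      by_cases hzF : z ∈ F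
      · obtain ⟨F', h1, h2, h3⟩ := s.ridge' hF hzF
        exact ⟨F', h1, h2, h3⟩
      · exact ⟨F, hF, hzF, Finset.erase_subset _ _⟩) (fun F hF hzF => by
      obtain ⟨a, h1, h2, rfl⟩ := (hfac F hzF).1 hF
      rw [hRc a h1 h2]; exact RJ a) (fun F hF F' hF' hzF hzF' h h' => by
      obtain ⟨a, h1, h2, rfl⟩ := (hfac F hzF).1 hF
      obtain ⟨a', h3, h4, rfl⟩ := (hfac F' hzF').1 hF'
      rw [hRc a h1 h2] at h
      rw [hRc a' h3 h4] at h'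
      rw [(congrp _ _ (uniq a h1 h2 a' h3 h4 h h')).1]) (fun F hF hzF S hS => by
      obtain ⟨a, h1, h2, rfl⟩ := (hfac F hzF).1 hF
      obtain ⟨a', h3, h4, h5, h6⟩ := pos_exists h1 h2 ((pos e a).filter fun x => φ x ∈ S) (Finset.filter_subset _ _)
      refine ⟨J a', (hfac _ (hzJ a' h3 h4)).2 ⟨a', h3, h4, rfl⟩, hzJ a' h3 h4, ?_, ?_⟩
      · rw [hRc a' h3 h4]
        intro y hy
        obtain ⟨x, hx, rfl⟩ := Finset.mem_image.1 hy
        exact (Finset.mem_filter.1 (h5 hx)).2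
      · intro y hy
        rcases Finset.mem_union.1 (hS hy) with h | h
        · exact Finset.mem_union_left _ h
        · obtain ⟨x, hx, rfl⟩ := Finset.mem_image.1 h
          exact Finset.mem_union_right _ (Finset.mem_image_of_mem _ (h6 (Finset.mem_filter.2 ⟨hx, hy⟩)))) hk (by omega)
  refine hb.trans ?_
  change ((s.fac.filter fun F => z ∉ F ∧ (Rc F).card = k).card : ℚ) - (s.fac.filter fun F => z ∉ F ∧ (Rc F).card = d + 1 - k).card = g k
  have h0 : s.fac.filter (fun F => z ∉ F ∧ (Rc F).card = d + 1 - k) = ∅ := by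
    rw [Finset.filter_eq_empty_iff]
    rintro F hF ⟨hzF, hc⟩
    obtain ⟨a, h1, h2, rfl⟩ := (hfac F hzF).1 hF
    obtain ⟨k', hk', hd'⟩ := exists_deg e a h1
    have := cRc a h1 h2
    rw [card_Rp h1 hk' hd'] at this
    change (Rc (J a)).card = _ at hc
    omega
  choose b hb1 hb2 using fun r => rkc_surj k r (by omega)
  have hM : ∀ r < g k, Mem e g (mk e k (b r)) := fun r hr =>
    have ms := mk_spec hke (hb1 r)
    mem_of_deg hg hke ms.2.1 (by rw [ms.2.2, hb2]; exact hr)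
  have h1 : s.fac.filter (fun F => z ∉ F ∧ (Rc F).card = k) = (Finset.range (g k)).image fun r => J (mk e k (b r)) := by
    ext F
    simp only [Finset.mem_filter, Finset.mem_image, Finset.mem_range]
    constructor
    · rintro ⟨hF, hzF, hc⟩
      obtain ⟨a, h1, h2, rfl⟩ := (hfac F hzF).1 hF
      obtain ⟨k', hk', hd'⟩ := exists_deg e a h1
      have h3 := cRc a h1 h2
      rw [card_Rp h1 hk' hd'] at h3
      obtain rfl : k = k' := hc.symm.trans h3
      have h4 : rkc k (bt e a k) < g k := h2 k hke fun _ => (hd' _ (by omega)).2 le_rfl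
      refine ⟨_, h4, ?_⟩
      have h5 := rkc_inj (hb1 (rkc k (bt e a k))) (bt_mon hke h1) (hb2 _)
      have h6 := (congrp (mk e k (b (rkc k (bt e a k)))) a fun i hi => by
        have h4 := hd' i hi
        simp only [mk]
        split_ifs with h7
        · omega
        · have := h5 (i - (e - k)) (by omega)
          rw [this]
          simp only [bt]
          rw [show e - k + (i - (e - k)) = i by omega]
          omega).1
      simp only [J, h6]
    · rintro ⟨r, hr, rfl⟩
      have ms := mk_spec hke (hb1 r)
      have hm := hM r hr
      exact ⟨(hfac _ (hzJ _ ms.1 hm)).2 ⟨_, ms.1, hm, rfl⟩, hzJ _ ms.1 hm, by rw [cRc _ ms.1 hm, card_Rp ms.1 hke ms.2.1]⟩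
  rw [h0, h1, Finset.card_image_of_injOn]
  · simp
  · intro r hr r' hr' h
    simp only [Finset.coe_range, Set.mem_Iio] at hr hr'
    dsimp only at h
    have ms := mk_spec hke (hb1 r)
    have ms' := mk_spec hke (hb1 r')
    have h3 := uniq _ ms.1 (hM r hr) _ ms'.1 (hM r' hr') (h ▸ RJ _) (h ▸ RJ _)
    rw [← hb2 r, ← hb2 r', ← ms.2.2, ← ms'.2.2]
    refine Finset.sum_congr rfl fun i hi => ?_
    rw [bt, bt, h3 _ (by have := Finset.mem_range.1 hi; omega)]

section
variable {d : ℕ} {ι V : Type} [Fintype ι] [AddCommGroup V] [Module ℝ V] (c : VC d ι V)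

lemma exists_fun {S : Finset ι} {x : ι → V} (h : LinearIndepOn ℝ x (S : Set ι)) (f : ι → ℝ) :
    ∃ η : V →ₗ[ℝ] ℝ, ∀ i ∈ S, η (x i) = f i := by
  have h' : LinearIndependent ℝ (fun i : (S : Set ι) => x i) := h
  obtain ⟨η, hη⟩ := LinearMap.exists_extend ((Module.Basis.span h').constr ℝ fun i => f i)
  refine ⟨η, fun i hi => ?_⟩
  have := LinearMap.congr_fun hη (Module.Basis.span h' ⟨i, hi⟩)
  rw [Module.Basis.constr_basis, LinearMap.comp_apply, Submodule.subtype_apply, Module.Basis.span_apply] at this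
  exact this

namespace VC

noncomputable def T (p : V →ₗ[ℝ] ℝ) : Finset ι := Finset.univ.filter fun i => p (c.X i) = 0

lemma mem_T {p : V →ₗ[ℝ] ℝ} {i : ι} : i ∈ c.T p ↔ p (c.X i) = 0 := by simp [T]

lemma nall {p : V →ₗ[ℝ] ℝ} (hp : p ≠ 0) : ∃ i, p (c.X i) ≠ 0 := by
  by_contra! h
  exact hp (LinearMap.ext_on_range c.sp h)

lemma li {p : V →ₗ[ℝ] ℝ} (hp : p ≠ 0) (hn : ∀ i, 0 ≤ p (c.X i)) : LinearIndepOn ℝ c.X (c.T p : Set ι) := by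
  convert c.ti p hp hn using 1
  ext i; simp [T]

lemma rot {p : V →ₗ[ℝ] ℝ} (hp : p ≠ 0) (hn : ∀ i, 0 ≤ p (c.X i)) (η : V →ₗ[ℝ] ℝ)
    (hη : ∀ i, p (c.X i) = 0 → 0 ≤ η (c.X i)) (hm : ∀ t : ℝ, η + t • p ≠ 0) :
    ∃ q : V →ₗ[ℝ] ℝ, q ≠ 0 ∧ (∀ i, 0 ≤ q (c.X i)) ∧ (∀ i, p (c.X i) = 0 → q (c.X i) = η (c.X i)) ∧
      ∃ j, p (c.X j) ≠ 0 ∧ q (c.X j) = 0 := by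
  obtain ⟨i0, hi0⟩ := c.nall hp
  obtain ⟨j, hj, hmax⟩ := Finset.exists_max_image (Finset.univ.filter fun i => p (c.X i) ≠ 0)
    (fun i => - η (c.X i) / p (c.X i)) ⟨i0, by simp [hi0]⟩
  have hj' : p (c.X j) ≠ 0 := by grind
  refine ⟨η + (- η (c.X j) / p (c.X j)) • p, hm _, fun i => ?_, fun i hi => by simp [hi], j, hj', by simp; field_simp; ring⟩
  by_cases hi : p (c.X i) = 0
  · simpa [hi] using hη i hi
  · have h1 := hmax i (by simp [hi])
    have h2 : 0 < p (c.X i) := lt_of_le_of_ne (hn i) (Ne.symm hi)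
    rw [div_le_iff₀ h2] at h1
    simp only [LinearMap.add_apply, LinearMap.smul_apply, smul_eq_mul]; linarith

lemma fr_ker (c : VC d ι V) {p : V →ₗ[ℝ] ℝ} (hp : p ≠ 0) : Module.finrank ℝ (LinearMap.ker p) = d := by
  have := c.fd
  have h1 := Module.Dual.finrank_ker_add_one_of_ne_zero (f := p) hp
  have := c.fr; omega

lemma fr_span {S : Finset ι} (h : LinearIndepOn ℝ c.X (S : Set ι)) :
    Module.finrank ℝ (Submodule.span ℝ (c.X '' (S : Set ι))) = S.card := by
  have h' : LinearIndependent ℝ (fun i : (S : Set ι) => c.X i) := h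
  have := finrank_span_eq_card h'
  rw [Set.image_eq_range]; rw [this]; simp

lemma span_le {p : V →ₗ[ℝ] ℝ} : Submodule.span ℝ (c.X '' (c.T p : Set ι)) ≤ LinearMap.ker p := by
  rw [Submodule.span_le]
  rintro _ ⟨i, hi, rfl⟩
  exact c.mem_T.1 hi

lemma card_le {p : V →ₗ[ℝ] ℝ} (hp : p ≠ 0) (hn : ∀ i, 0 ≤ p (c.X i)) : (c.T p).card ≤ d := by
  have := c.fd
  rw [← c.fr_span (c.li hp hn)]
  exact (Submodule.finrank_mono c.span_le).trans (c.fr_ker hp).le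

lemma isFac_T {p : V →ₗ[ℝ] ℝ} (hp : p ≠ 0) (hn : ∀ i, 0 ≤ p (c.X i)) (h : d ≤ (c.T p).card) : c.IsFac (c.T p) :=
  ⟨le_antisymm (c.card_le hp hn) h, p, hp, hn, fun _ => c.mem_T⟩

lemma extend (n : ℕ) : ∀ p : V →ₗ[ℝ] ℝ, p ≠ 0 → (∀ i, 0 ≤ p (c.X i)) → d - (c.T p).card ≤ n → ∃ F, c.IsFac F ∧ c.T p ⊆ F := by
  induction n with
  | zero => exact fun p hp hn h => ⟨_, c.isFac_T hp hn (by omega), subset_rfl⟩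
  | succ n ih =>
    intro p hp hn h
    by_cases h0 : d ≤ (c.T p).card
    · grind
    have := c.fd
    have h1 : ¬ LinearMap.ker p ≤ Submodule.span ℝ (c.X '' (c.T p : Set ι)) := fun hl => by
      have := Submodule.finrank_mono hl
      rw [c.fr_ker hp, c.fr_span (c.li hp hn)] at this
      grind
    obtain ⟨v, hv, hv'⟩ := SetLike.not_le_iff_exists.1 h1
    obtain ⟨η, hη, hs⟩ := Submodule.exists_le_ker_of_notMem hv'
    obtain ⟨q, hq, hqn, hqe, j, hj, hqj⟩ := c.rot hp hn η (fun i hi => by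
      rw [show η (c.X i) = 0 from hs (Submodule.subset_span ⟨i, c.mem_T.2 hi, rfl⟩)]) (fun t ht => by
      have := LinearMap.congr_fun ht v
      simp [show p v = 0 from hv] at this
      grind)
    have hsub : c.T p ⊆ c.T q := fun i hi => by
      rw [c.mem_T, hqe i (c.mem_T.1 hi)]
      exact hs (Submodule.subset_span ⟨i, hi, rfl⟩)
    have hlt : (c.T p).card < (c.T q).card := Finset.card_lt_card ⟨hsub, fun h => hj (c.mem_T.1 (h (c.mem_T.2 hqj)))⟩
    grind

lemma sub_fac {F S : Finset ι} (hF : c.IsFac F) (hS : S ⊆ F) :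
    ∃ q : V →ₗ[ℝ] ℝ, q ≠ 0 ∧ (∀ i, 0 ≤ q (c.X i)) ∧ c.T q = S := by
  obtain ⟨hc, p, hp, hn, ht⟩ := hF
  have hFT : F = c.T p := by ext i; rw [ht, c.mem_T]
  subst hFT
  obtain ⟨η, hη⟩ := exists_fun (c.li hp hn) (fun i => if i ∈ S then 0 else 1)
  obtain ⟨t, h⟩ : ∃ t : ℝ, ∀ i, i ∉ c.T p → 0 < η (c.X i) + t * p (c.X i) := by
    obtain ⟨t, ht⟩ := Finset.exists_le (Finset.univ.image fun i => (1 - η (c.X i)) / p (c.X i))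
    refine ⟨t, fun i hi => ?_⟩
    have h1 := ht _ (Finset.mem_image_of_mem _ (Finset.mem_univ i))
    rw [div_le_iff₀ (lt_of_le_of_ne (hn i) (Ne.symm (mt c.mem_T.2 hi)))] at h1
    linarith
  have hT : c.T (η + t • p) = S := by
    ext i
    rw [c.mem_T]
    simp only [LinearMap.add_apply, LinearMap.smul_apply, smul_eq_mul]
    grind
  refine ⟨η + t • p, ?_, fun i => ?_, hT⟩
  · intro h0
    obtain ⟨i, hi⟩ := c.nall hp
    have := h i (mt c.mem_T.1 hi)
    have h2 := LinearMap.congr_fun h0 (c.X i)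
    simp at h2; linarith
  · by_cases hi : i ∈ c.T p
    · simp only [LinearMap.add_apply, LinearMap.smul_apply, smul_eq_mul]
      rw [c.mem_T.1 hi, hη i hi]; split_ifs <;> simp
    · exact (h i hi).le

lemma exists_sd (hd : 1 ≤ d) : ∃ s : SD d ι (LinearMap.ker c.w), ∀ F, F ∈ s.fac ↔ c.IsFac F := by
  have := c.fd
  have hw : c.w ≠ 0 := fun h => by
    have h1 := c.sp
    have h3 : Nonempty ι := by
      by_contra h
      rw [not_nonempty_iff] at h
      rw [Set.range_eq_empty, Submodule.span_empty] at h1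
      have := c.fr
      rw [← finrank_top, ← h1, finrank_bot] at this
      omega
    have := c.wpos h3.some
    simp [h] at this
  obtain ⟨i0, hi0⟩ := c.nall hw
  have hN : (0 : ℝ) < Fintype.card ι := by exact_mod_cast Fintype.card_pos_iff.2 ⟨i0⟩
  let Y : ι → V := fun i => (c.w (c.X i))⁻¹ • c.X i
  have wY : ∀ i, c.w (Y i) = 1 := fun i => by simp [Y, (c.wpos i).ne']
  let o : V := (Fintype.card ι : ℝ)⁻¹ • ∑ i, Y i
  have wo : c.w o = 1 := by simp [o, wY, hN.ne']
  have po : ∀ p : V →ₗ[ℝ] ℝ, p ≠ 0 → (∀ i, 0 ≤ p (c.X i)) → 0 < p o := by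
    intro p hp hn
    obtain ⟨j, hj⟩ := c.nall hp
    have : 0 < ∑ i, p (Y i) := by
      apply Finset.sum_pos' (fun i _ => by simp only [Y, map_smul, smul_eq_mul]; exact mul_nonneg (inv_pos.2 (c.wpos i)).le (hn i))
      exact ⟨j, Finset.mem_univ _, by
        simp only [Y, map_smul, smul_eq_mul]; exact mul_pos (inv_pos.2 (c.wpos j)) (lt_of_le_of_ne (hn j) (Ne.symm hj))⟩
    simp only [o, map_smul, map_sum, smul_eq_mul]; positivity
  let xx : ι → LinearMap.ker c.w := fun i => ⟨Y i - o, by rw [LinearMap.mem_ker, map_sub, wY, wo, sub_self]⟩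
  let pp : Finset ι → V →ₗ[ℝ] ℝ := fun F => if h : c.IsFac F then h.2.choose else 0
  have hpp : ∀ F, c.IsFac F → pp F ≠ 0 ∧ (∀ i, 0 ≤ pp F (c.X i)) ∧ ∀ i, i ∈ F ↔ pp F (c.X i) = 0 := fun F h => by
    grind
  have ux : ∀ F, c.IsFac F → ∀ i, (-((pp F o)⁻¹)) * pp F (Y i - o) = 1 - (pp F o)⁻¹ * ((c.w (c.X i))⁻¹ * pp F (c.X i)) := by
    intro F h i
    have := (po _ (hpp F h).1 (hpp F h).2.1).ne'
    simp only [map_sub, Y, map_smul, smul_eq_mul]; field_simp; ring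
  have mf : ∀ F, F ∈ Finset.univ.filter c.IsFac ↔ c.IsFac F := by simp
  refine ⟨{ fac := Finset.univ.filter c.IsFac, x := xx
            u := fun F => (-((pp F o)⁻¹)) • (pp F).comp (LinearMap.ker c.w).subtype
            card := fun F hF => ((mf F).1 hF).1
            ind := ?_, one := ?_, lt := ?_, ridge := ?_, ne := ?_, fr := c.fr_ker hw, fd := inferInstance }, mf⟩
  · intro F hF
    obtain ⟨h1, h2, h3⟩ := hpp F ((mf F).1 hF)
    have hFT : F = c.T (pp F) := by ext i; rw [h3, c.mem_T]
    have hl := c.li h1 h2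
    rw [← hFT] at hl
    have hl' : LinearIndependent ℝ (fun i : F => c.X i) := hl
    rw [Fintype.linearIndependent_iff] at hl' ⊢
    intro a ha i
    have ha' := congrArg Subtype.val ha
    simp only [xx, Submodule.coe_sum, Submodule.coe_smul, Submodule.coe_zero, smul_sub, Finset.sum_sub_distrib, ← Finset.sum_smul] at ha'
    have hs : ∑ i, a i = 0 := by
      have := congrArg (pp F) ha'
      simp only [map_sub, map_sum, map_smul, Y, smul_eq_mul, map_zero] at this
      rw [Finset.sum_eq_zero fun i _ => by rw [(h3 i).1 i.2]; ring] at this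
      grind
    rw [hs, zero_smul, sub_zero] at ha'
    have := hl' (fun i => a i * (c.w (c.X i))⁻¹) (by rw [← ha']; simp only [Y, mul_smul]) i
    exact (mul_eq_zero.1 this).resolve_right (inv_ne_zero (c.wpos i).ne')
  · intro F hF i hi
    have hF := (mf F).1 hF
    refine (ux F hF i).trans ?_
    grind
  · intro F hF i hi
    have hF := (mf F).1 hF
    refine (ux F hF i).trans_lt ?_
    obtain ⟨h1, h2, h3⟩ := hpp F hF
    have := mul_pos (inv_pos.2 (po _ h1 h2)) (mul_pos (inv_pos.2 (c.wpos i)) (lt_of_le_of_ne (h2 i) (Ne.symm (mt (h3 i).2 hi))))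
    linarith
  · intro F hF i hi
    have hF := (mf F).1 hF
    obtain ⟨hc, p, hp, hn, ht⟩ := hF
    have hFT : F = c.T p := by ext i; rw [ht, c.mem_T]
    subst hFT
    obtain ⟨η, hη⟩ := exists_fun (c.li hp hn) (fun j => if j = i then 1 else 0)
    have hηi : η (c.X i) = 1 := by rw [hη i hi]; simp
    have hpi := c.mem_T.1 hi
    obtain ⟨q, hq, hqn, hqe, j, hj, hqj⟩ := c.rot hp hn η (fun k hk => by
      rw [hη k (c.mem_T.2 hk)]; split_ifs <;> simp) (fun t ht => by
      have := LinearMap.congr_fun ht (c.X i)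
      simp [hηi, hpi] at this)
    have hsub : insert j ((c.T p).erase i) ⊆ c.T q := by
      intro k hk
      rw [c.mem_T]
      grind
    have hjT : j ∉ c.T p := mt c.mem_T.1 hj
    refine ⟨c.T q, (mf _).2 (c.isFac_T hq hqn ?_), fun h => hjT (h ▸ c.mem_T.2 hqj), (Finset.subset_insert _ _).trans hsub⟩
    have := Finset.card_le_card hsub
    grind
  · obtain ⟨F, hF, -⟩ := c.extend d c.w hw (fun i => (c.wpos i).le) (by omega)
    grind

end VC
end

section
variable {d : ℕ} {ι V E : Type} [Fintype ι] [AddCommGroup V] [Module ℝ V] [AddCommGroup E] [Module ℝ E]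

lemma hull_le {y : ι → E} {l : E →ₗ[ℝ] ℝ} {μ : ℝ} (hle : ∀ i, l (y i) ≤ μ) {S : Finset ι}
    (hS : ∀ i, l (y i) = μ → i ∈ S) {x : E} (hx : x ∈ convexHull ℝ (Set.range y)) :
    l x ≤ μ ∧ (l x = μ → x ∈ convexHull ℝ (y '' S)) := by
  refine convexHull_min (t := {x | l x ≤ μ ∧ (l x = μ → x ∈ convexHull ℝ (y '' S))}) ?_ ?_ hx
  · rintro _ ⟨i, rfl⟩
    exact ⟨hle i, fun h => subset_convexHull _ _ ⟨i, hS i h, rfl⟩⟩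
  · rintro x ⟨h1, h2⟩ z ⟨h3, h4⟩ a b ha hb hab
    have e : l (a • x + b • z) = a * l x + b * l z := by simp
    refine ⟨by rw [e]; linear_combination a * h1 + b * h3 + μ * hab, fun h => ?_⟩
    rw [e] at h
    have e1 : a * (μ - l x) + b * (μ - l z) = 0 := by grind
    have p1 := mul_nonneg ha (sub_nonneg.2 h1)
    have p2 := mul_nonneg hb (sub_nonneg.2 h3)
    rcases mul_eq_zero.1 (show a * (μ - l x) = 0 by linarith) with h5 | h5
    · have hb1 : b = 1 := by linarith
      subst h5 hb1
      simp only [zero_smul, one_smul, zero_add]; grind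
    · rcases mul_eq_zero.1 (show b * (μ - l z) = 0 by linarith) with h6 | h6
      · have ha1 : a = 1 := by linarith
        subst h6 ha1
        simp only [zero_smul, one_smul, add_zero]; grind
      · exact convex_convexHull ℝ _ (h2 (by linarith)) (h4 (by linarith)) ha hb hab

lemma hull_eq {y : ι → E} {l : E →ₗ[ℝ] ℝ} {μ : ℝ} {S : Finset ι} (hS : ∀ i ∈ S, l (y i) = μ) {x : E}
    (hx : x ∈ convexHull ℝ (y '' S)) : l x = μ := by
  refine convexHull_min (t := {x | l x = μ}) ?_ (convex_hyperplane l.isLinear μ) hx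
  grind

lemma maxset {y : ι → E} {l : E →ₗ[ℝ] ℝ} {μ : ℝ} (hle : ∀ i, l (y i) ≤ μ) {S : Finset ι}
    (hS : ∀ i, i ∈ S ↔ l (y i) = μ) (hne : S.Nonempty) :
    {x | x ∈ convexHull ℝ (Set.range y) ∧ ∀ z ∈ convexHull ℝ (Set.range y), l z ≤ l x} = convexHull ℝ (y '' S) := by
  ext x
  constructor
  · rintro ⟨h1, h2⟩
    obtain ⟨h3, h4⟩ := hull_le hle (fun i => (hS i).2) h1
    obtain ⟨i, hi⟩ := hne
    have := h2 (y i) (subset_convexHull _ _ ⟨i, rfl⟩)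
    rw [(hS i).1 hi] at this
    exact h4 (le_antisymm h3 this)
  · intro h
    refine ⟨convexHull_mono (Set.image_subset_range _ _) h, fun z hz => ?_⟩
    rw [hull_eq (fun i => (hS i).1) h]
    exact (hull_le hle (fun i => (hS i).2) hz).1

structure Link (c : VC d ι V) (y : ι → E) : Prop where
  a : ∀ (l : E →ₗ[ℝ] ℝ) (μ : ℝ), ∃ p : V →ₗ[ℝ] ℝ, ∀ i, p (c.X i) = c.w (c.X i) * (μ - l (y i))
  b : ∀ p : V →ₗ[ℝ] ℝ, ∃ (l : E →ₗ[ℝ] ℝ) (μ : ℝ), ∀ i, p (c.X i) = c.w (c.X i) * (μ - l (y i))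

namespace Link
variable {c : VC d ι V} {y : ι → E}

lemma nn (c : VC d ι V) {r : ℝ} {i : ι} : 0 ≤ c.w (c.X i) * r ↔ 0 ≤ r := mul_nonneg_iff_of_pos_left (c.wpos i)
lemma zz (c : VC d ι V) {r : ℝ} {i : ι} : c.w (c.X i) * r = 0 ↔ r = 0 := by simp [(c.wpos i).ne']

lemma ai (L : Link c y) {S : Finset ι} (hS : LinearIndepOn ℝ c.X (S : Set ι)) : AffineIndependent ℝ (fun i : S => y i) := by
  have hS' : LinearIndependent ℝ (fun i : S => c.X i) := hS
  rw [affineIndependent_iff]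
  intro s a h0 h1 i hi
  rw [linearIndependent_iff'] at hS'
  have := hS' s (fun i => a i * (c.w (c.X i))⁻¹) (by
    have := c.fd
    rw [← Module.forall_dual_apply_eq_zero_iff ℝ]
    intro p
    obtain ⟨l, μ, h⟩ := L.b p
    have : ∀ i : S, a i * (c.w (c.X i))⁻¹ * (c.w (c.X i) * (μ - l (y i))) = a i * μ - l (a i • y i) := fun i => by
      have := (c.wpos i).ne'
      rw [map_smul, smul_eq_mul]; field_simp
    change p _ = 0
    simp only [map_sum, map_smul, smul_eq_mul, h, this, Finset.sum_sub_distrib, ← Finset.sum_mul]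
    have h2 := congrArg l h1
    simp only [map_sum, map_smul, smul_eq_mul, map_zero] at h2
    rw [h0, h2]; simp) i hi
  exact (mul_eq_zero.1 this).resolve_right (inv_ne_zero (c.wpos i).ne')

lemma simplex (L : Link c y) {S : Finset ι} (hS : LinearIndepOn ℝ c.X (S : Set ι)) : IsSimplexSet (convexHull ℝ (y '' S)) := by
  refine ⟨S.image y, ?_, by simp⟩
  have h := (L.ai hS).range
  have e : Set.range (fun i : S => y i) = ((S.image y : Finset E) : Set E) := by ext; simp
  grind

lemma pd (L : Link c y) {S : Finset ι} (hS : LinearIndepOn ℝ c.X (S : Set ι)) : pdim (convexHull ℝ (y '' S)) = S.card - 1 := by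
  rcases S.eq_empty_or_nonempty with rfl | hne
  · simp [pdim]
  obtain ⟨k, hk⟩ : ∃ k, S.card = k + 1 := ⟨S.card - 1, by have := hne.card_pos; omega⟩
  have h := (L.ai hS).finrank_vectorSpan (n := k) (by simpa using hk)
  have e : Set.range (fun i : S => y i) = y '' S := by ext; simp
  rw [e] at h
  rw [pdim, if_neg (by simpa using hne.ne_empty), affineSpan_convexHull, direction_affineSpan, h, hk]; simp

lemma face (L : Link c y) {F : Set E} (hF : IsFace (convexHull ℝ (Set.range y)) F) (hne : F ≠ convexHull ℝ (Set.range y)) (hd : 1 ≤ d) :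
    ∃ p : V →ₗ[ℝ] ℝ, p ≠ 0 ∧ (∀ i, 0 ≤ p (c.X i)) ∧ F = convexHull ℝ (y '' (c.T p)) := by
  have hι : Nonempty ι := by
    by_contra h
    rw [not_nonempty_iff] at h
    have h1 := c.sp
    rw [Set.range_eq_empty, Submodule.span_empty] at h1
    have := c.fr
    rw [← finrank_top, ← h1, finrank_bot] at this
    omega
  rcases hF with h | h | ⟨l, h⟩
  · grind
  · refine ⟨c.w, fun h0 => by have := c.wpos hι.some; simp [h0] at this, fun i => (c.wpos i).le, ?_⟩
    have : c.T c.w = ∅ := by ext i; simp [c.mem_T, (c.wpos i).ne']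
    rw [h, this]; simp
  · obtain ⟨j, -, hj⟩ := Finset.exists_max_image Finset.univ (fun i => l (y i)) Finset.univ_nonempty
    obtain ⟨p, hp⟩ := L.a l (l (y j))
    have ht : ∀ i, i ∈ c.T p ↔ l (y i) = l (y j) := fun i => by
      rw [c.mem_T, hp, zz, sub_eq_zero]; grind
    have hm := maxset (fun i => hj i (Finset.mem_univ i)) ht ⟨j, (ht j).2 rfl⟩
    rw [← h] at hm
    refine ⟨p, fun h0 => hne ?_, fun i => ?_, hm⟩
    · have : c.T p = Finset.univ := by ext i; simp [c.mem_T, h0]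
      rw [hm, this]; simp
    · rw [hp, nn]; grind

lemma count (L : Link c y) (hd : 1 ≤ d) (hP : pdim (convexHull ℝ (Set.range y)) = d) {s : SD d ι (LinearMap.ker c.w)}
    (hs : ∀ F, F ∈ s.fac ↔ c.IsFac F) (k : ℕ) (hk : k < d) :
    {F : Set E | IsFace (convexHull ℝ (Set.range y)) F ∧ pdim F = (k : ℤ)}.ncard =
      ((faces s.fac).filter fun S => S.card = k + 1).card := by
  have tight : ∀ S ∈ faces s.fac, ∃ q : V →ₗ[ℝ] ℝ, q ≠ 0 ∧ (∀ i, 0 ≤ q (c.X i)) ∧ c.T q = S := fun S hS => by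
    obtain ⟨F, hF, h⟩ := (Finset.mem_filter.1 hS).2
    exact c.sub_fac ((hs F).1 hF) h
  have e : {F : Set E | IsFace (convexHull ℝ (Set.range y)) F ∧ pdim F = (k : ℤ)} =
      (fun S : Finset ι => convexHull ℝ (y '' S)) '' (((faces s.fac).filter fun S => S.card = k + 1 : Finset (Finset ι)) : Set (Finset ι)) := by
    ext F
    simp only [Set.mem_image, Finset.coe_filter, Set.mem_ofPred_eq]
    constructor
    · rintro ⟨hF, hk'⟩
      obtain ⟨p, hp, hn, rfl⟩ := L.face hF (by rintro rfl; rw [hP] at hk'; norm_cast at hk'; omega) hd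
      refine ⟨c.T p, ⟨?_, ?_⟩, rfl⟩
      · obtain ⟨F, hF, h⟩ := c.extend d p hp hn (by omega)
        exact Finset.mem_filter.2 ⟨Finset.mem_univ _, F, (hs F).2 hF, h⟩
      · rw [L.pd (c.li hp hn)] at hk'; omega
    · rintro ⟨S, ⟨hS, hc⟩, rfl⟩
      obtain ⟨q, hq, hn, rfl⟩ := tight S hS
      refine ⟨?_, by rw [L.pd (c.li hq hn), hc]; simp⟩
      obtain ⟨l, μ, h⟩ := L.b q
      refine Or.inr (Or.inr ⟨l, ?_⟩)
      refine (maxset (μ := μ) (fun i => ?_) (fun i => ?_) (Finset.card_pos.1 (by omega))).symm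
      · have := hn i
        rw [h, nn] at this; linarith
      · rw [c.mem_T, h, zz, sub_eq_zero]; grind
  rw [e, Set.ncard_image_of_injOn, Set.ncard_coe_finset]
  have key : ∀ S ∈ faces s.fac, ∀ S' ∈ faces s.fac, convexHull ℝ (y '' S) = convexHull ℝ (y '' S') → S ⊆ S' := by
    intro S _ S' hS' h i hi
    obtain ⟨q, -, -, rfl⟩ := tight S' hS'
    obtain ⟨l, μ, hl⟩ := L.b q
    have h1 : y i ∈ convexHull ℝ (y '' (c.T q : Set ι)) := h ▸ subset_convexHull _ _ ⟨i, hi, rfl⟩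
    have := hull_eq (l := l) (μ := μ) (fun j hj => by
      have := c.mem_T.1 hj
      rw [hl, zz] at this; linarith) h1
    rw [c.mem_T, hl, this]; simp
  intro S hS S' hS' h
  grind

end Link

/-- Homogenization dimension count. -/
lemma fr_hom [FiniteDimensional ℝ E] [Nonempty ι] {x : ι → E} {w : E →ₗ[ℝ] ℝ} (hw : ∀ i, w (x i) = 1) :
    Module.finrank ℝ (Submodule.span ℝ (Set.range x)) = Module.finrank ℝ (vectorSpan ℝ (Set.range x)) + 1 := by
  obtain ⟨i0⟩ := ‹Nonempty ι›
  have hv : vectorSpan ℝ (Set.range x) ≤ LinearMap.ker w := by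
    rw [vectorSpan_def, Submodule.span_le]
    rintro _ ⟨_, ⟨i, rfl⟩, _, ⟨j, rfl⟩, rfl⟩
    simp [hw]
  have hx : x i0 ≠ 0 := fun h => by have := hw i0; grind
  have h1 : Submodule.span ℝ (Set.range x) = vectorSpan ℝ (Set.range x) ⊔ Submodule.span ℝ {x i0} := by
    apply le_antisymm
    · rw [Submodule.span_le]
      rintro _ ⟨i, rfl⟩
      have := Submodule.add_mem_sup (vsub_mem_vectorSpan ℝ (Set.mem_range_self (f := x) i) (Set.mem_range_self i0))
        (Submodule.mem_span_singleton_self (R := ℝ) (x i0))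
      simpa using this
    · refine sup_le ?_ (Submodule.span_mono (by rintro _ rfl; grind))
      rw [vectorSpan_def, Submodule.span_le]
      rintro _ ⟨_, hi, _, hj, rfl⟩
      exact Submodule.sub_mem _ (Submodule.subset_span hi) (Submodule.subset_span hj)
  have h2 : vectorSpan ℝ (Set.range x) ⊓ Submodule.span ℝ {x i0} = ⊥ := by
    rw [eq_bot_iff]
    rintro v ⟨h3, h4⟩
    obtain ⟨a, rfl⟩ := Submodule.mem_span_singleton.1 h4
    have : w (a • x i0) = 0 := hv h3
    simp [hw] at this
    simp [this]
  have := Submodule.finrank_sup_add_finrank_inf_eq (vectorSpan ℝ (Set.range x)) (Submodule.span ℝ {x i0})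
  rw [h2, finrank_bot, finrank_span_singleton hx, ← h1] at this
  omega
end

section
variable {d : ℕ} {ι V : Type} [Fintype ι] [AddCommGroup V] [Module ℝ V]

lemma suff_geom (c : VC d ι V) (hd : 1 ≤ d) (s : SD d ι (LinearMap.ker c.w)) (hs : ∀ F, F ∈ s.fac ↔ c.IsFac F) :
    ∃ (n : ℕ) (P : Set (Fin n → ℝ)), IsPolytope P ∧ pdim P = (d : ℤ) ∧
      (∀ F : Set (Fin n → ℝ), IsFace P F → F ≠ P → IsSimplexSet F) ∧
      (∀ k < d, {F : Set (Fin n → ℝ) | IsFace P F ∧ pdim F = (k : ℤ)}.ncard = ((faces s.fac).filter fun S => S.card = k + 1).card) := by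
  have := c.fd
  obtain ⟨F0, hF0⟩ := s.ne
  have : Nonempty ι := by
    obtain ⟨i, -⟩ := Finset.card_pos.1 (by rw [s.card F0 hF0]; omega : 0 < F0.card)
    exact ⟨i⟩
  let Φ : V ≃ₗ[ℝ] (Fin (d + 1) → ℝ) := LinearEquiv.ofFinrankEq _ _ (by simp [c.fr])
  let y : ι → Fin (d + 1) → ℝ := fun i => (c.w (c.X i))⁻¹ • Φ (c.X i)
  have L : Link c y := by
    refine ⟨fun l μ => ⟨μ • c.w - l.comp Φ.toLinearMap, fun i => ?_⟩, fun p => ⟨-(p.comp Φ.symm.toLinearMap), 0, fun i => ?_⟩⟩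
    · have := (c.wpos i).ne'
      simp [y]; field_simp
    · have := (c.wpos i).ne'
      simp [y]; field_simp
  have hP : pdim (convexHull ℝ (Set.range y)) = d := by
    have h := fr_hom (x := y) (w := c.w.comp Φ.symm.toLinearMap) (fun i => by simp [y, (c.wpos i).ne'])
    have h1 : Submodule.span ℝ (Set.range y) = ⊤ := by
      rw [eq_top_iff, ← LinearMap.range_eq_top.2 Φ.surjective, ← Submodule.map_top, ← c.sp, Submodule.map_span, Submodule.span_le]
      rintro _ ⟨_, ⟨i, rfl⟩, rfl⟩
      have := Submodule.smul_mem _ (c.w (c.X i)) (Submodule.subset_span (R := ℝ) (Set.mem_range_self (f := y) i))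
      simpa [y, (c.wpos i).ne'] using this
    rw [h1, finrank_top] at h
    simp only [Module.finrank_fintype_fun_eq_card, Fintype.card_fin] at h
    rw [pdim, if_neg (by simpa using Set.range_nonempty y |>.ne_empty), affineSpan_convexHull, direction_affineSpan]
    omega
  refine ⟨d + 1, convexHull ℝ (Set.range y), ⟨Finset.univ.image y, by simp⟩, hP, fun F hF hne => ?_, fun k hk => L.count hd hP hs k hk⟩
  obtain ⟨p, hp, hn, rfl⟩ := L.face hF hne hd
  exact L.simplex (c.li hp hn)
end

lemma nec_geom {n d : ℕ} {P : Set (Fin n → ℝ)} (hP : IsPolytope P) (hd : pdim P = (d : ℤ))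
    (hs : ∀ F : Set (Fin n → ℝ), IsFace P F → F ≠ P → IsSimplexSet F) :
    ∃ (S : Finset (Fin n → ℝ)) (V : Submodule ℝ ((Fin n → ℝ) × ℝ)) (c : VC d S V),
      Link c (fun i : S => (i : Fin n → ℝ)) ∧ P = convexHull ℝ (Set.range fun i : S => (i : Fin n → ℝ)) := by
  obtain ⟨S0, hS0⟩ := hP
  have hsub : P.extremePoints ℝ ⊆ S0 := hS0 ▸ extremePoints_convexHull_subset
  have hfin : (P.extremePoints ℝ).Finite := S0.finite_toSet.subset hsub
  have hcv : Convex ℝ P := hS0 ▸ convex_convexHull ℝ _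
  have hKM : convexHull ℝ (P.extremePoints ℝ) = P := by
    have hc : IsCompact P := hS0 ▸ S0.finite_toSet.isCompact_convexHull ℝ
    have := closure_convexHull_extremePoints hc hcv
    rwa [(hfin.isClosed_convexHull ℝ).closure_eq] at this
  let S := hfin.toFinset
  let y : S → (Fin n → ℝ) := fun i => i
  have hy : Set.range y = P.extremePoints ℝ := by simp [y, S]
  have hPy : P = convexHull ℝ (Set.range y) := by rw [hy, hKM]
  have hne : Nonempty S := by
    by_contra h
    rw [not_nonempty_iff] at h
    rw [hPy, Set.range_eq_empty, convexHull_empty, pdim, if_pos rfl] at hd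
    omega
  let x : S → (Fin n → ℝ) × ℝ := fun i => (y i, 1)
  let V := Submodule.span ℝ (Set.range x)
  let xV : S → V := fun i => ⟨x i, Submodule.subset_span ⟨i, rfl⟩⟩
  have lk : ∀ p : V →ₗ[ℝ] ℝ, ∃ (l : (Fin n → ℝ) →ₗ[ℝ] ℝ) (μ : ℝ), ∀ i, p (xV i) = μ - l (y i) := by
    intro p
    obtain ⟨q, rfl⟩ := LinearMap.exists_extend p
    refine ⟨-(q.comp (LinearMap.inl ℝ _ _)), q (0, 1), fun i => ?_⟩
    simp only [xV, x, LinearMap.comp_apply, Submodule.subtype_apply, LinearMap.neg_apply, LinearMap.inl_apply, sub_neg_eq_add, ← map_add]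
    simp
  have spV : Submodule.span ℝ (Set.range xV) = ⊤ := by
    have h : Set.range x = V.subtype '' Set.range xV := by rw [← Set.range_comp]; rfl
    apply Submodule.map_injective_of_injective V.injective_subtype
    rw [Submodule.map_span, ← h, Submodule.map_top, Submodule.range_subtype]
  let c : VC d S V :=
  { X := xV
    w := (LinearMap.snd ℝ _ _).comp V.subtype
    wpos := fun i => by simp [xV, x]
    ti := by
      intro p hp hn
      obtain ⟨l, μ, h⟩ := lk p
      let T : Finset S := Finset.univ.filter fun i => p (xV i) = 0
      have hT : {i | p (xV i) = 0} = (T : Set S) := by ext; simp [T]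
      have hT' : ∀ i, i ∈ T ↔ l (y i) = μ := fun i => by
        simp only [T, Finset.mem_filter, Finset.mem_univ, true_and, h, sub_eq_zero]; exact eq_comm
      rw [hT]
      rcases T.eq_empty_or_nonempty with h0 | h0
      · rw [h0]; simp
      have hm := maxset (l := l) (μ := μ) (y := y) (fun i => by have := hn i; rw [h] at this; linarith) hT' h0
      rw [← hPy] at hm
      obtain ⟨T', hai, hT''⟩ := hs _ (Or.inr (Or.inr ⟨l, hm.symm⟩)) (fun he => hp (LinearMap.ext_on_range spV fun i => by
        have h1 : y i ∈ convexHull ℝ (y '' T) := by rw [he, hPy]; exact subset_convexHull _ _ ⟨i, rfl⟩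
        rw [h, hull_eq (fun i => (hT' i).1) h1]; simp))
      have hsubT : (y '' T : Set (Fin n → ℝ)) ⊆ T' := by
        rintro _ ⟨i, hi, rfl⟩
        apply extremePoints_convexHull_subset (𝕜 := ℝ)
        have h1 : y i ∈ P.extremePoints ℝ := hy ▸ ⟨i, rfl⟩
        refine inter_extremePoints_subset_extremePoints_of_subset (A := P) ?_ ⟨?_, h1⟩
        · grind
        · rw [← hT'']; exact subset_convexHull _ _ ⟨i, hi, rfl⟩
      have hai' := hai.mono hsubT
      have hai2 : AffineIndependent ℝ (fun i : T => y i) :=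
        hai'.comp_embedding ⟨fun i : T => (⟨y i, ⟨i, i.2, rfl⟩⟩ : (y '' T : Set (Fin n → ℝ))), fun i j hij => by
          have := congrArg Subtype.val hij
          exact Subtype.ext (Subtype.ext this)⟩
      change LinearIndependent ℝ (fun i : T => xV i)
      rw [affineIndependent_iff] at hai2
      rw [linearIndependent_iff']
      intro s a ha
      have ha' := congrArg Subtype.val ha
      have e1 := congrArg Prod.fst ha'
      have e2 := congrArg Prod.snd ha'
      simp only [xV, x, Submodule.coe_sum, Submodule.coe_smul, Submodule.coe_zero, Prod.fst_sum, Prod.snd_sum, Prod.smul_fst, Prod.smul_snd,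
        Prod.fst_zero, Prod.snd_zero, smul_eq_mul, mul_one] at e1 e2
      exact hai2 s a e2 e1
    sp := spV
    fd := inferInstance
    fr := by
      have h := fr_hom (x := x) (w := LinearMap.snd ℝ _ _) (fun i => rfl)
      refine h.trans ?_
      have h1 : vectorSpan ℝ (Set.range x) = (vectorSpan ℝ (Set.range y)).map (LinearMap.inl ℝ (Fin n → ℝ) ℝ) := by
        rw [vectorSpan_range_eq_span_range_vsub_right ℝ x hne.some, vectorSpan_range_eq_span_range_vsub_right ℝ y hne.some,
          Submodule.map_span, ← Set.range_comp]
        congr 2; ext i <;> simp [x]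
      rw [h1, ← (Submodule.equivMapOfInjective _ LinearMap.inl_injective _).finrank_eq]
      · rw [hPy, pdim, if_neg (by grind), affineSpan_convexHull, direction_affineSpan] at hd
        omega }
  refine ⟨S, V, c, ⟨fun l μ => ⟨(μ • LinearMap.snd ℝ _ _ - l.comp (LinearMap.fst ℝ _ _)).comp V.subtype, fun i => ?_⟩, fun p => ?_⟩, hPy⟩
  · simp [c, xV, x, y]
  · obtain ⟨l, μ, h⟩ := lk p
    exact ⟨l, μ, fun i => by simpa [c, xV, x] using h i⟩

lemma exists_vc (d : ℕ) (g : ℕ → ℕ) (g0 : g 0 = 1)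
    (hg : ∀ k b, 2 * (k + 1) ≤ d → rkc (k + 1) b < g (k + 1) → rkc k (fun i => b (i + 1)) < g k) :
    ∃ (ι V : Type) (_ : Fintype ι) (_ : AddCommGroup V) (_ : Module ℝ V) (c : VC d ι V),
      ∀ s : SD d ι (LinearMap.ker c.w), (∀ F, F ∈ s.fac ↔ c.IsFac F) → ∀ k, 1 ≤ k → 2 * k ≤ d →
        (Hp d s.fac).coeff k - (Hp d s.fac).coeff (k - 1) = g k := by
  obtain ⟨e, he⟩ := Nat.even_or_odd' d
  have hg' : ∀ k b, k + 1 ≤ e → rkc (k + 1) b < g (k + 1) → rkc k (fun i => b (i + 1)) < g k := fun k b h => hg k b (by omega)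
  obtain ⟨c, hc⟩ := even_vc e g g0 hg' _ rfl
  have phs : ∀ x (h : x < g 1 + 2 * e), phn (g 1 + 2 * e) x = some ⟨x, h⟩ := fun x h => dif_pos h
  rcases he with rfl | rfl
  · refine ⟨_, _, inferInstance, _, _, c, fun s hs k h1 h2 => ?_⟩
    refine cnt s none (phn _) ∅ e g hg' (fun x hx y hy h => ?_) (by simp) (fun x hx => by rw [phs x hx]; simp) (by simp)
      (fun F hF => ?_) le_rfl h1 (by omega)
    · grind
    · rw [hs, hc F hF]
      exact exists_congr fun a => and_congr_right fun _ => and_congr_right fun _ => by rw [Finset.ext_iff, Finset.ext_iff]; simp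
  · obtain ⟨c', hc'⟩ := odd_vc c
    refine ⟨_, _, inferInstance, _, _, c', fun s hs k h1 h2 => ?_⟩
    refine cnt s none (fun x => some (phn _ x)) {some none} e g hg' (fun x hx y hy h => ?_) (fun x hx => by grind) (fun x hx => by simp)
      (by simp) (fun F hF => ?_) (by omega) h1 (by omega)
    · grind
    · rw [hs, hc' F hF]
      constructor
      · rintro ⟨F0, h0, h1, rfl⟩
        obtain ⟨a, h2, h3, rfl⟩ := (hc F0 h0).1 h1
        exact ⟨a, h2, h3, by ext o; simp⟩
      · rintro ⟨a, h2, h3, rfl⟩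
        have hn : none ∉ (pos e a).image (phn (g 1 + 2 * e)) := fun h => by
          obtain ⟨x, hx, h⟩ := Finset.mem_image.1 h
          rw [phs x (pos_lt h2 h3 x hx)] at h; simp at h
        exact ⟨_, hn, (hc _ hn).2 ⟨a, h2, h3, rfl⟩, by ext o; simp⟩

lemma hS_eq {d : ℕ} {ι : Type} [Fintype ι] {fac : Finset (Finset ι)} (hc : ∀ F ∈ fac, F.card = d) (hne : fac.Nonempty) (f : Fin d → ℕ)
    (hf : ∀ k : Fin d, f k = ((faces fac).filter fun S => S.card = (k : ℕ) + 1).card) : hSimplicial d f = Hp d fac := by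
  have h1 : ∀ S ∈ faces fac, S.card ∈ Finset.range (d + 1) := fun S hS => by
    obtain ⟨F, hF, h⟩ := (Finset.mem_filter.1 hS).2
    have := Finset.card_le_card h
    rw [hc F hF] at this
    exact Finset.mem_range.2 (by omega)
  have h0 : (faces fac).filter (fun S => S.card = 0) = {∅} := by
    ext S
    simp only [faces, Finset.mem_filter, Finset.mem_univ, true_and, Finset.card_eq_zero, Finset.mem_singleton, and_iff_right_iff_imp]
    grind
  rw [Hp, ← Finset.sum_fiberwise_of_maps_to h1, Finset.sum_range_succ', h0, hSimplicial, add_comm]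
  simp only [Finset.sum_singleton, Finset.card_empty, Nat.sub_zero]
  congr 1
  rw [Finset.sum_range]
  refine Finset.sum_congr rfl fun i _ => ?_
  rw [Finset.sum_congr rfl (g := fun _ => (X - 1 : ℚ[X]) ^ (d - 1 - (i : ℕ))) fun S hS => by
    rw [(Finset.mem_filter.1 hS).2]; congr 1; omega, Finset.sum_const, ← hf i]
  exact Nat.cast_smul_eq_nsmul ℚ _ _

lemma deg_term (a : ℚ) (n : ℕ) : (a • (X - 1 : ℚ[X]) ^ n).natDegree ≤ n :=
  (natDegree_smul_le _ _).trans (by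
    have : (X - 1 : ℚ[X]) = X - C 1 := by simp
    rw [this, natDegree_pow, natDegree_X_sub_C, mul_one])

lemma hS_deg {d : ℕ} (f : Fin d → ℕ) {k : ℕ} (hk : d < k) : (hSimplicial d f).coeff k = 0 := by
  refine coeff_eq_zero_of_natDegree_lt (lt_of_le_of_lt (natDegree_add_le_of_degree_le (n := d) ?_ ?_) hk)
  · simpa using deg_term 1 d
  · exact natDegree_sum_le_of_forall_le _ _ fun i _ => (deg_term _ _).trans (by omega)

lemma hS_top {d : ℕ} (f : Fin d → ℕ) : (hSimplicial d f).coeff d = 1 := by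
  rw [hSimplicial, coeff_add, finsetSum_coeff, Finset.sum_eq_zero fun i _ =>
    coeff_eq_zero_of_natDegree_lt (lt_of_le_of_lt (deg_term _ _) (by have := i.2; omega))]
  have : (X - 1 : ℚ[X]) = X - C 1 := by simp
  have h2 : ((X - C 1 : ℚ[X]) ^ d).Monic := (monic_X_sub_C 1).pow d
  have h3 : ((X - C 1 : ℚ[X]) ^ d).natDegree = d := by rw [natDegree_pow, natDegree_X_sub_C, mul_one]
  rw [this, add_zero]
  rw [Monic, leadingCoeff, h3] at h2
  exact h2

lemma hS_inj {d : ℕ} {f f' : Fin d → ℕ} (h : hSimplicial d f = hSimplicial d f') : f = f' := by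
  have key : ∀ (f : Fin d → ℕ) (k : Fin d), ((hSimplicial d f).comp (X + 1)).coeff (d - 1 - k) = f k := by
    intro f k
    have := k.2
    have hsc : ∀ (g : Fin d → ℚ[X]) (q : ℚ[X]), (∑ i, g i).comp q = ∑ i, (g i).comp q :=
      fun g q => map_sum (compRingHom q) _ _
    simp only [hSimplicial, add_comp, pow_comp, sub_comp, X_comp, one_comp, add_sub_cancel_right, hsc, smul_comp, coeff_add,
      finsetSum_coeff, coeff_smul, coeff_X_pow, smul_eq_mul]
    rw [if_neg (by omega), Finset.sum_eq_single k]
    · simp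
    · grind
    · simp
  funext k
  have h1 := key f k
  rw [h, key f' k] at h1
  exact_mod_cast h1.symm

lemma hg_of_alg {A : Type} [CommRing A] [Algebra ℝ A] (𝒜 : ℕ → Submodule ℝ A) [GradedAlgebra 𝒜]
    [FiniteDimensional ℝ A] (hA : Algebra.adjoin ℝ ((𝒜 1 : Submodule ℝ A) : Set A) = ⊤) (k : ℕ) (b : ℕ → ℕ)
    (h : rkc (k + 1) b < Module.finrank ℝ (𝒜 (k + 1))) : rkc k (fun i => b (i + 1)) < Module.finrank ℝ (𝒜 k) := by
  obtain ⟨Γ, h1, h2⟩ := ideal_of_alg 𝒜 hA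
  generalize Module.finrank ℝ (𝒜 1) = n at Γ h1 h2
  have hfin : ∀ k, {m | m ∈ Γ ∧ m.degree = k}.Finite := fun k => by
    refine Set.Finite.subset (Finset.finsuppAntidiag Finset.univ k).finite_toSet fun m hm => ?_
    rw [← hm.2]
    simp [Finsupp.degree_eq_sum]
  let W : ℕ → Finset (Fin n → ℕ) := fun k => (hfin k).toFinset.image fun m : Fin n →₀ ℕ => (m : Fin n → ℕ)
  have hW : ∀ k, (W k).card = Module.finrank ℝ (𝒜 k) := fun k => by
    rw [Finset.card_image_of_injective _ DFunLike.coe_injective, ← h2, Set.ncard_eq_toFinset_card _ (hfin k)]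
  have mW : ∀ k u, u ∈ W k ↔ Finsupp.equivFunOnFinite.symm u ∈ Γ ∧ ∑ l, u l = k := fun k u => by
    simp only [W, Finset.mem_image, Set.Finite.mem_toFinset, Set.mem_ofPred_eq]
    constructor
    · rintro ⟨m, ⟨h3, h4⟩, rfl⟩
      exact ⟨by simpa using h3, by rw [← h4, Finsupp.degree_eq_sum]⟩
    · rintro ⟨h3, h4⟩
      exact ⟨_, ⟨h3, by rw [Finsupp.degree_eq_sum, ← h4]; rfl⟩, rfl⟩
  rw [← hW] at h ⊢
  refine mac n k b (W (k + 1)) (W k) (fun u hu => ((mW _ _).1 hu).2) (fun u l hu => ?_) h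
  obtain ⟨h3, h4⟩ := (mW _ _).1 hu
  refine (mW _ _).2 ⟨h1 _ h3 _ fun i => ?_, ?_⟩
  · simp
  · simp only [Pi.add_apply, Finset.sum_add_distrib, Finset.sum_pi_single', Finset.mem_univ, if_true] at h4
    omega

theorem g_theorem (d : ℕ) (hd : 1 ≤ d) (f : Fin d → ℕ) :
    (∃ (n : ℕ) (P : Set (Fin n → ℝ)), IsPolytope P ∧ pdim P = (d : ℤ) ∧
      (∀ F : Set (Fin n → ℝ), IsFace P F → F ≠ P → IsSimplexSet F) ∧
      (∀ k : Fin d, f k = {F : Set (Fin n → ℝ) | IsFace P F ∧ pdim F = (k : ℤ)}.ncard)) ↔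
    ((∀ k : ℕ, k ≤ d → (hSimplicial d f).coeff k = (hSimplicial d f).coeff (d - k)) ∧
     (∀ k : ℕ, 2 * k ≤ d → 0 ≤ gSimplicial d f k) ∧
     (∃ (A : Type) (_ : CommRing A) (_ : Algebra ℝ A) (𝒜 : ℕ → Submodule ℝ A)
        (_ : GradedAlgebra 𝒜),
        FiniteDimensional ℝ A ∧
        Module.finrank ℝ (𝒜 0) = 1 ∧
        Algebra.adjoin ℝ ((𝒜 1 : Submodule ℝ A) : Set A) = ⊤ ∧
        (∀ i : ℕ, 2 * i ≤ d → (Module.finrank ℝ (𝒜 i) : ℚ) = gSimplicial d f i) ∧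
        (∀ i : ℕ, d < 2 * i → 𝒜 i = ⊥))) := by
  constructor
  · rintro ⟨n, P, hP, hPd, hs, hf⟩
    obtain ⟨S, V, c, L, rfl⟩ := nec_geom hP hPd hs
    obtain ⟨s, hsf⟩ := c.exists_sd hd
    have e : hSimplicial d f = Hp d s.fac := hS_eq s.card s.ne f fun k => by rw [hf k, L.count hd hPd hsf k k.2]
    obtain ⟨v, hv⟩ := s.exists_generic
    have DS : ∀ k : ℕ, k ≤ d → (hSimplicial d f).coeff k = (hSimplicial d f).coeff (d - k) := fun k hk => by
      rw [e]; exact (s.shell v hv).palin hk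
    obtain ⟨Γ, h1, h2, h3⟩ := s.order_ideal
    have h2' : ∀ k, 2 * k ≤ d → (Set.ncard {m | m ∈ Γ ∧ m.degree = k} : ℚ) = gSimplicial d f k := fun k hk => by
      rw [h2 k hk, gSimplicial, e]
    have hfin : ∀ k, {m | m ∈ Γ ∧ m.degree = k}.Finite := fun k => by
      refine Set.Finite.subset (Finset.finsuppAntidiag Finset.univ k).finite_toSet fun m hm => ?_
      rw [← hm.2]
      simp only [Finset.mem_coe, Finset.mem_finsuppAntidiag]
      exact ⟨(Finsupp.degree_eq_sum m).symm, Finset.subset_univ _⟩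
    obtain ⟨A, i1, i2, 𝒜, i3, a1, a2, a3⟩ := alg_of_ideal Γ h1 d (fun m hm => by
      by_contra hlt
      have := (Set.ncard_eq_zero (hfin m.degree)).1 (h3 m.degree (by omega))
      have hm' : m ∈ {m' | m' ∈ Γ ∧ m'.degree = m.degree} := ⟨hm, rfl⟩
      rw [this] at hm'; exact hm')
    refine ⟨DS, fun k hk => by rw [← h2' k hk]; positivity, A, i1, i2, 𝒜, i3, a1, ?_, a2, fun i hi => by rw [a3, h2' i hi], fun i hi => ?_⟩
    · have h4 := h2' 0 (by omega)
      rw [gSimplicial, DS 0 (by omega), Nat.sub_zero, hS_top, if_pos rfl, sub_zero] at h4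
      rw [a3]; exact_mod_cast h4
    · have := a3 i
      rw [h3 i hi] at this
      exact Submodule.finrank_eq_zero.1 this
  · rintro ⟨DS, -, A, _, _, 𝒜, _, _, a0, a1, a2, -⟩
    obtain ⟨ι, V, _, _, _, c, hc⟩ := exists_vc d (fun k => Module.finrank ℝ (𝒜 k)) a0 (fun k b _ h => hg_of_alg 𝒜 a1 k b h)
    obtain ⟨s, hsf⟩ := c.exists_sd hd
    obtain ⟨n, P, hP, hPd, hs, hcnt⟩ := suff_geom c hd s hsf
    let f' : Fin d → ℕ := fun k => ((faces s.fac).filter fun S => S.card = (k : ℕ) + 1).card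
    have e : hSimplicial d f' = Hp d s.fac := hS_eq s.card s.ne f' fun k => rfl
    obtain ⟨v, hv⟩ := s.exists_generic
    have DS' : ∀ k : ℕ, k ≤ d → (hSimplicial d f').coeff k = (hSimplicial d f').coeff (d - k) := fun k hk => by
      rw [e]; exact (s.shell v hv).palin hk
    have lo : ∀ k, 2 * k ≤ d → (hSimplicial d f).coeff k = (hSimplicial d f').coeff k := by
      intro k
      induction k with
      | zero => intro _; rw [DS 0 (by omega), DS' 0 (by omega), Nat.sub_zero, hS_top, hS_top]
      | succ k ih =>
        intro hk
        have h1 := hc s hsf (k + 1) (by omega) hk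
        have h2 := a2 (k + 1) hk
        rw [gSimplicial, if_neg (by omega)] at h2
        grind
    have hff : f = f' := hS_inj (by
      ext k
      rcases lt_or_ge d k with h | h
      · rw [hS_deg f h, hS_deg f' h]
      grind)
    exact ⟨n, P, hP, hPd, hs, fun k => by rw [hff, hcnt k k.2]⟩
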